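/- arXiv:2112.10025 — 2 statements merged into one kernel-verified Lean document; each statement's English description precedes it below -/
import Mathlib

section
/- Let g ≥ 1 and let G be a connected multigraph with n vertices and m edges embedded in a surface of Euler genus g without crossings, where each face is bounded by a cycle. Let T be a spanning tree of G rooted at r, let Q = {a₁b₁, …, a_gb_g} be the set of edges of G dual to the edges of the dual spanning subgraph D outside a spanning tree T* of D, and let Z = Z₁ ∪ … ∪ Z_g, where Z_i is the union of the a_i r-path and the b_i r-path in T plus the edge a_i b_i; say Z has p vertices and q = p − 1 + g edges. Let G̃ be the embedded multigraph obtained by cutting G along the edges of Z (each edge of Z is replaced by two edges, and each vertex v of Z incident with edges e₁, …, e_d of Z in clockwise order is replaced by vertices v₁, …, v_d, with v_i incident to e'_i, e''_{i+1} and the edges incident with v clockwise between e_i and e_{i+1}). Then G̃ is connected, has n + p − 2 + 2g vertices and m + p − 1 + g edges, its induced embedding is in the plane (Euler genus 0), and all vertices introduced by the cutting lie on the boundary of a single face F of G̃, whose boundary is a cycle C_F with vertex set exactly the set Z' of introduced vertices. -/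
/-!
Common definitions: multigraphs, combinatorial (cellular) surface embeddings,
Euler genus, framed graphs, strong products, treewidth, partitions and layerings.
-/

/-- A multigraph on vertex type `V` with edge type `E`, given by its endpoints map. -/
structure Multigraph (V E : Type) where
  ends : E → Sym2 V

namespace Multigraph

variable {V E F : Type}

/-- The simple graph underlying a multigraph. -/
def simple (G : Multigraph V E) : SimpleGraph V where
  Adj u v := u ≠ v ∧ ∃ e, G.ends e = s(u, v)
  symm := by
    constructor
    rintro u v ⟨hne, e, he⟩
    exact ⟨hne.symm, e, he.trans Sym2.eq_swap⟩
  loopless := by constructor; rintro u ⟨hne, -⟩; exact hne rfl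

/-- The simple graph on `V` whose edges are the edges of `G` lying in `S`. -/
def simpleOn (G : Multigraph V E) (S : Set E) : SimpleGraph V where
  Adj u v := u ≠ v ∧ ∃ e ∈ S, G.ends e = s(u, v)
  symm := by
    constructor
    rintro u v ⟨hne, e, heS, he⟩
    exact ⟨hne.symm, e, heS, he.trans Sym2.eq_swap⟩
  loopless := by constructor; rintro u ⟨hne, -⟩; exact hne rfl

/-- A multigraph is simple: no loops and no parallel edges. -/
def IsSimple (G : Multigraph V E) : Prop :=
  (∀ e, ¬ (G.ends e).IsDiag) ∧ Function.Injective G.ends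

/-- A set `S` of edges of `G` forms a spanning tree of `G`. -/
def IsSpanningTree (G : Multigraph V E) (S : Set E) : Prop :=
  (G.simpleOn S).IsTree ∧ (∀ e ∈ S, ¬ (G.ends e).IsDiag) ∧
    ∀ e ∈ S, ∀ e' ∈ S, G.ends e = G.ends e' → e = e'

/-- A closed walk in a multigraph, recorded as periodic sequences of vertices and
edges: the walk visits `vtx 0, vtx 1, …, vtx (len - 1)` and returns to
`vtx len = vtx 0`, traversing the edge `edge i` between `vtx i` and `vtx (i+1)`. -/
structure CWalk (G : Multigraph V E) where
  len : ℕ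
  len_pos : 0 < len
  vtx : ℕ → V
  edge : ℕ → E
  vtx_per : ∀ i, vtx (i + len) = vtx i
  edge_per : ∀ i, edge (i + len) = edge i
  compat : ∀ i, G.ends (edge i) = s(vtx i, vtx (i + 1))

namespace CWalk

variable {G : Multigraph V E}

/-- The vertex `v` lies on the closed walk `W`. -/
def HasVtx (W : G.CWalk) (v : V) : Prop := ∃ i, i < W.len ∧ W.vtx i = v

/-- The edge `e` lies on the closed walk `W`. -/
def HasEdge (W : G.CWalk) (e : E) : Prop := ∃ i, i < W.len ∧ W.edge i = e

/-- The closed walk `W` is a cycle: it repeats no vertex and no edge. -/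
def IsCycle (W : G.CWalk) : Prop :=
  (∀ i j, i < W.len → j < W.len → W.vtx i = W.vtx j → i = j) ∧
  (∀ i j, i < W.len → j < W.len → W.edge i = W.edge j → i = j)

end CWalk

/-- `p = (f, i)` is an occurrence of the edge `e` in the family `bd` of closed walks:
the walk of face `f` traverses `e` at position `i`. -/
def IsOcc {G : Multigraph V E} (bd : F → G.CWalk) (e : E) (p : F × ℕ) : Prop :=
  p.2 < (bd p.1).len ∧ (bd p.1).edge p.2 = e

/-- `c = (f, i)` is a corner of the vertex `v`: the walk of face `f` visits `v`
at position `i`. -/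
def IsCorner {G : Multigraph V E} (bd : F → G.CWalk) (v : V) (c : F × ℕ) : Prop :=
  c.2 < (bd c.1).len ∧ (bd c.1).vtx c.2 = v

/-- The corner `c` is one of the two end corners of the edge occurrence `p`. -/
def EndOf {G : Multigraph V E} (bd : F → G.CWalk) (c p : F × ℕ) : Prop :=
  c.1 = p.1 ∧ (c.2 = p.2 ∨ c.2 = (p.2 + 1) % (bd p.1).len)

/-- Two corners of `v` are linked if they are end corners (at `v`) of the two
distinct occurrences of a common edge; this is the edge-to-edge gluing relation
around the vertex `v`. -/
def CornerLinked {G : Multigraph V E} (bd : F → G.CWalk) (v : V) (c c' : F × ℕ) : Prop :=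
  IsCorner bd v c ∧ IsCorner bd v c' ∧
    ∃ (e : E) (p p' : F × ℕ), p ≠ p' ∧ IsOcc bd e p ∧ IsOcc bd e p' ∧
      EndOf bd c p ∧ EndOf bd c' p'

/-- A combinatorial (cellular) embedding of a connected multigraph `G` in a closed
surface, with face set `F`: every face is given by its closed boundary walk, every
edge of `G` is traversed exactly twice in total by the boundary walks, and the link
of every vertex is connected (so the embedding is in a genuine surface, with no
pinch points). -/
structure Embedding (G : Multigraph V E) (F : Type) where
  boundary : F → G.CWalk
  conn : G.simple.Connected
  edge_twice : ∀ e : E, {p : F × ℕ | IsOcc boundary e p}.ncard = 2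
  link_conn : ∀ (v : V) (c c' : F × ℕ), IsCorner boundary v c → IsCorner boundary v c' →
    Relation.EqvGen (CornerLinked boundary v) c c'

/-- The Euler genus `2 - (|V| - |E| + |F|)` of an embedding, via Euler's formula. -/
noncomputable def Embedding.eulerGenus {G : Multigraph V E} {F : Type}
    (_ : Embedding G F) : ℤ :=
  2 - ((Nat.card V : ℤ) - Nat.card E + Nat.card F)

/-- The simple graph underlying the framed multigraph `G^{(d)}`: two distinct
vertices are adjacent iff they are joined by an edge of `G` or lie on a common
face of length at most `d` (in which case `G^{(d)}` has a chord between them). -/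
def framedGraph {G : Multigraph V E} {F : Type} (emb : Embedding G F) (d : ℕ) :
    SimpleGraph V where
  Adj u v := u ≠ v ∧ ((∃ e, G.ends e = s(u, v)) ∨
    ∃ f, (emb.boundary f).len ≤ d ∧ (emb.boundary f).HasVtx u ∧ (emb.boundary f).HasVtx v)
  symm := by
    constructor
    rintro u v ⟨hne, (⟨e, he⟩ | ⟨f, h1, h2, h3⟩)⟩
    · exact ⟨hne.symm, Or.inl ⟨e, he.trans Sym2.eq_swap⟩⟩
    · exact ⟨hne.symm, Or.inr ⟨f, h1, h3, h2⟩⟩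
  loopless := by constructor; rintro u ⟨hne, -⟩; exact hne rfl

end Multigraph

namespace SimpleGraph

/-- `G` is contained in `X`: `G` is isomorphic to a subgraph of `X`. -/
def IsContainedIn {α β : Type} (G : SimpleGraph α) (X : SimpleGraph β) : Prop :=
  ∃ f : G →g X, Function.Injective f

/-- The strong product of two simple graphs. -/
def strongProd {α β : Type} (G : SimpleGraph α) (H : SimpleGraph β) :
    SimpleGraph (α × β) where
  Adj x y := x ≠ y ∧ (x.1 = y.1 ∨ G.Adj x.1 y.1) ∧ (x.2 = y.2 ∨ H.Adj x.2 y.2)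
  symm := by
    constructor
    rintro x y ⟨hne, h1, h2⟩
    exact ⟨hne.symm, h1.imp Eq.symm (fun h => G.adj_symm h), h2.imp Eq.symm (fun h => H.adj_symm h)⟩
  loopless := by constructor; rintro x ⟨hne, -⟩; exact hne rfl

end SimpleGraph

/-- `G` has treewidth at most `k`: it has a tree-decomposition with all bags of
size at most `k + 1`. -/
def TreewidthLE {α : Type} (G : SimpleGraph α) (k : ℕ) : Prop :=
  ∃ (ι : Type) (T : SimpleGraph ι) (B : ι → Set α),
    T.IsTree ∧
    (∀ v, ∃ i, v ∈ B i) ∧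
    (∀ u v, G.Adj u v → ∃ i, u ∈ B i ∧ v ∈ B i) ∧
    (∀ v, (T.induce {i | v ∈ B i}).Connected) ∧
    ∀ i, (B i).encard ≤ (k : ℕ∞) + 1

/-- `G` has Euler genus at most `g`: `G` is (isomorphic to) a subgraph of a
multigraph having a combinatorial embedding of Euler genus at most `g`. -/
def HasEulerGenusLE {α : Type} (G : SimpleGraph α) (g : ℕ) : Prop :=
  ∃ (V' E' F' : Type), Finite V' ∧ Finite E' ∧ Finite F' ∧
    ∃ (M : Multigraph V' E') (emb : M.Embedding F'),
      emb.eulerGenus ≤ (g : ℤ) ∧ G.IsContainedIn M.simple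

/-- A planar graph: a graph of Euler genus `0`. -/
def IsPlanar {α : Type} (G : SimpleGraph α) : Prop := HasEulerGenusLE G 0

/-- An apex graph: deleting some vertex leaves a planar graph. -/
def IsApex {α : Type} (G : SimpleGraph α) : Prop :=
  ∃ v : α, IsPlanar (G.induce {w | w ≠ v})

/-- `A` indexes a partition of the vertices of `G` into nonempty parts `A x`, and the
quotient of `G` by this partition is (isomorphic to) `H`, via the indexing: this is an
`H`-partition of `G`. -/
def IsHPartition {α W : Type} (G : SimpleGraph α) (H : SimpleGraph W) (A : W → Set α) : Prop :=
  (∀ x, (A x).Nonempty) ∧ (∀ v, ∃! x, v ∈ A x) ∧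
    ∀ x y, x ≠ y → (H.Adj x y ↔ ∃ u ∈ A x, ∃ v ∈ A y, G.Adj u v)

/-- `(L 0, L 1, …)` is a layering of `G`: an ordered partition of the vertices such
that every edge joins vertices in the same or in consecutive layers. -/
def IsLayering {α : Type} (G : SimpleGraph α) (L : ℕ → Set α) : Prop :=
  (∀ v, ∃! j, v ∈ L j) ∧
    ∀ u v, G.Adj u v → ∀ i j, u ∈ L i → v ∈ L j → i ≤ j + 1 ∧ j ≤ i + 1

/-- `b` lies on every walk from `a` to `c` in `T` (for a tree: `b` is on the unique
`a`–`c` path). -/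
def BtwIn {α : Type} (T : SimpleGraph α) (a b c : α) : Prop :=
  ∀ p : T.Walk a c, b ∈ p.support

/-- `Q` is the vertex set of a vertical path in the tree `T` rooted at `r` with upper
end `w` and lower end `u`: `w` lies on the path from `r` to `u`, and `Q` is the set of
vertices of the `w`–`u` path. -/
def IsVerticalPathBtw {α : Type} (T : SimpleGraph α) (r : α) (Q : Set α) (w u : α) : Prop :=
  BtwIn T r w u ∧ Q = {x | BtwIn T w x u}

/-- `Q` is the vertex set of a vertical path in the tree `T` rooted at `r`. -/
def IsVerticalPath {α : Type} (T : SimpleGraph α) (r : α) (Q : Set α) : Prop :=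
  ∃ w u, IsVerticalPathBtw T r Q w u

/-- `Y` is the union of at most `k` vertical paths in the tree `T` rooted at `r`. -/
def IsUnionOfVPaths {α : Type} (T : SimpleGraph α) (r : α) (k : ℕ) (Y : Set α) : Prop :=
  ∃ m, m ≤ k ∧ ∃ Q : Fin m → Set α, (∀ i, IsVerticalPath T r (Q i)) ∧ Y = ⋃ i, Q i


namespace CutZ

/-- orbit relation of two functions -/
def Orb {H : Type} (a b : H → H) : H → H → Prop :=
  Relation.EqvGen (fun x y => y = a x ∨ y = b x)

namespace Orb
variable {H : Type} {a b : H → H}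

theorem refl (x : H) : Orb a b x x := Relation.EqvGen.refl x
theorem symm {x y : H} (h : Orb a b x y) : Orb a b y x := Relation.EqvGen.symm _ _ h
theorem trans {x y z : H} (h : Orb a b x y) (h' : Orb a b y z) : Orb a b x z :=
  Relation.EqvGen.trans _ _ _ h h'
theorem l (x : H) : Orb a b x (a x) := Relation.EqvGen.rel _ _ (Or.inl rfl)
theorem r (x : H) : Orb a b x (b x) := Relation.EqvGen.rel _ _ (Or.inr rfl)

/-- A relation which is an equivalence and contains the generators contains `Orb`. -/
theorem lift {R : H → H → Prop} (hR : Equivalence R) (ha : ∀ x, R x (a x))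
    (hb : ∀ x, R x (b x)) {x y : H} (h : Orb a b x y) : R x y := by
  induction h with
  | rel x y h => rcases h with rfl | rfl; exacts [ha x, hb x]
  | refl x => exact hR.refl x
  | symm x y _ ih => exact hR.symm ih
  | trans x y z _ _ ih1 ih2 => exact hR.trans ih1 ih2

theorem map_eq {β : Type*} (f : H → β) (ha : ∀ x, f (a x) = f x)
    (hb : ∀ x, f (b x) = f x) {x y : H} (h : Orb a b x y) : f x = f y :=
  lift (R := fun x y => f x = f y) ⟨fun _ => rfl, fun h => h.symm, fun h h' => h.trans h'⟩
    (fun x => (ha x).symm) (fun x => (hb x).symm) h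

theorem closed (P : H → Prop) (haa : ∀ x, a (a x) = x) (hbb : ∀ x, b (b x) = x)
    (ha : ∀ x, P x → P (a x)) (hb : ∀ x, P x → P (b x)) {x y : H} (h : Orb a b x y) :
    P x → P y := by
  have := lift (a := a) (b := b) (R := fun x y => P x ↔ P y)
    ⟨fun _ => Iff.rfl, fun h => h.symm, fun h h' => h.trans h'⟩
    (fun x => ⟨ha x, fun h => by simpa [haa] using ha _ h⟩)
    (fun x => ⟨hb x, fun h => by simpa [hbb] using hb _ h⟩) h
  exact this.1

end Orb

def orbSetoid {H : Type} (a b : H → H) : Setoid H := ⟨Orb a b, Orb.refl, Orb.symm, Orb.trans⟩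

theorem even_of_invol {H : Type} (s : Finset H) (f : H → H) (hf : ∀ x, f (f x) = x)
    (hs : ∀ x ∈ s, f x ∈ s) (hne : ∀ x ∈ s, f x ≠ x) : Even s.card := by
  have h : ∑ x ∈ s, (1 : ZMod 2) = 0 := by
    refine Finset.sum_involution (fun x _ => f x) ?_ ?_ ?_ ?_
    · intros; decide
    · intro x hx _; exact hne x hx
    · intro x hx; exact hs x hx
    · intro x hx; exact hf x
  rw [Finset.sum_const, nsmul_one] at h
  exact (ZMod.natCast_eq_zero_iff_even).1 h

theorem handshake {H : Type} [Finite H] (b m : H → H) (hb : ∀ x, b (b x) = x)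
    (hbne : ∀ x, b x ≠ x) (hm : ∀ x, m (m x) = x)
    (C T : Set H) (hCb : ∀ x ∈ C, b x ∈ C) (hCm : ∀ x ∈ C, x ∉ T → m x ∈ C ∧ m x ∉ T ∧ m x ≠ x) :
    Even (C ∩ T).ncard := by
  classical
  have := Fintype.ofFinite H
  have h1 : Even (C.toFinset).card :=
    even_of_invol _ b hb (by simpa using hCb) (fun x _ => hbne x)
  have h2 : Even ((C \ T).toFinset).card := by
    refine even_of_invol _ m hm ?_ ?_
    · intro x hx
      simp only [Set.mem_toFinset, Set.mem_sdiff] at hx ⊢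
      exact ⟨(hCm x hx.1 hx.2).1, (hCm x hx.1 hx.2).2.1⟩
    · intro x hx
      simp only [Set.mem_toFinset, Set.mem_sdiff] at hx 
      exact (hCm x hx.1 hx.2).2.2
  rw [← Set.ncard_eq_toFinset_card'] at h1 h2
  have h3 := Set.ncard_inter_add_ncard_sdiff_eq_ncard C T
  rw [← h3] at h1
  exact (Nat.even_add.1 h1).2 h2

theorem dihedral_unique {H : Type} (a b : H → H) (ha : ∀ x, a (a x) = x) (hb : ∀ x, b (b x) = x)
    (h x y : H) (hh : a h = h) (hx : a x = x) (hy : a y = y)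
    (hxh : x ≠ h) (hyh : y ≠ h) (ox : Orb a b h x) (oy : Orb a b h y) : x = y := by
  let A : Equiv.Perm H := ⟨a, a, ha, ha⟩
  let B : Equiv.Perm H := ⟨b, b, hb, hb⟩
  have hAA : A * A = 1 := Equiv.ext ha
  have hBB : B * B = 1 := Equiv.ext hb
  have hAi : A⁻¹ = A := by rw [inv_eq_iff_mul_eq_one, hAA]
  have hBi : B⁻¹ = B := by rw [inv_eq_iff_mul_eq_one, hBB]
  let ρ : Equiv.Perm H := A * B
  have hs : SemiconjBy A ρ ρ⁻¹ := by
    simp only [SemiconjBy, ρ, mul_inv_rev, hAi, hBi, mul_assoc]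
    rw [← mul_assoc A A, hAA, one_mul, mul_one]
  have hsz : ∀ k : ℤ, ∀ z, a ((ρ ^ k) z) = (ρ ^ (-k)) (a z) := by
    intro k z
    have := congrArg (fun e : Equiv.Perm H => e z) (hs.zpow_right k)
    simpa [A] using this
  have hbρ : ∀ z, b z = a (ρ z) := by
    intro z; simp [ρ, A, B, ha]
  have orb : ∀ z, Orb a b h z → ∃ k : ℤ, z = (ρ ^ k) h := by
    intro z hz
    refine Orb.closed (fun z => ∃ k : ℤ, z = (ρ ^ k) h) ha hb ?_ ?_ hz ⟨0, rfl⟩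
    · rintro z ⟨k, rfl⟩
      exact ⟨-k, by rw [hsz, hh]⟩
    · rintro z ⟨k, rfl⟩
      refine ⟨-(1 + k), ?_⟩
      rw [hbρ, ← Equiv.Perm.mul_apply, ← zpow_one_add, hsz, hh]
  have key : ∀ k : ℤ, (ρ ^ k) h = h ↔ (Function.minimalPeriod (fun z => ρ z) h : ℤ) ∣ k := by
    intro k
    exact MulAction.zpow_smul_eq_iff_minimalPeriod_dvd (a := ρ) (b := h) (n := k)
  have two : ∀ k : ℤ, a ((ρ ^ k) h) = (ρ ^ k) h → (ρ ^ (2 * k)) h = h := by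
    intro k hk
    rw [hsz, hh] at hk
    rw [two_mul, zpow_add, Equiv.Perm.mul_apply, ← hk, ← Equiv.Perm.mul_apply, ← zpow_add]
    simp
  obtain ⟨k, rfl⟩ := orb x ox
  obtain ⟨j, rfl⟩ := orb y oy
  have h1 := (key _).1 (two k hx)
  have h2 := (key _).1 (two j hy)
  have h3 := fun h => hxh ((key k).2 h)
  have h4 := fun h => hyh ((key j).2 h)
  have h5 : (ρ ^ (k - j)) h = h := by
    rw [key]
    obtain ⟨s, hs⟩ := h1
    obtain ⟨t, ht⟩ := h2
    rcases Int.even_or_odd' s with ⟨s', rfl | rfl⟩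
    · exact absurd ⟨s', by linarith⟩ h3
    rcases Int.even_or_odd' t with ⟨t', rfl | rfl⟩
    · exact absurd ⟨t', by linarith⟩ h4
    exact ⟨s' - t', by linarith⟩
  have h6 : (ρ ^ k) h = (ρ ^ (j + (k - j))) h := by congr 2; ring
  rw [h6, zpow_add, Equiv.Perm.mul_apply, h5]

/-- Two fixed point free involutions: the orbit of `h` under `τ = b ∘ a` never meets `a` of it. -/
theorem dihedral_disjoint {H : Type} (a b : H → H) (ha : ∀ x, a (a x) = x) (hb : ∀ x, b (b x) = x)
    (hane : ∀ x, a x ≠ x) (hbne : ∀ x, b x ≠ x) (n : ℕ) (h : H) :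
    ((fun x => b (a x))^[n]) h ≠ a h := by
  induction n using Nat.strong_induction_on generalizing h with
  | _ n ih =>
    rcases n with _ | _ | n
    · simpa using (hane h).symm
    · simpa using hbne (a h)
    · intro hh
      rw [Function.iterate_succ_apply, Function.iterate_succ_apply'] at hh
      have := congrArg (fun x => a (b x)) hh
      simp only [hb, ha] at this
      exact ih n (by omega) (b (a h)) this

end CutZ

namespace CutZ

/-- Flag system of an embedded multigraph. -/
structure FS {V E : Type} (G : Multigraph V E) (F H : Type) where
  α : H → H
  β : H → H
  γ : H → H
  vert : H → V
  edge : H → E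
  face : H → F
  αα : ∀ h, α (α h) = h
  ββ : ∀ h, β (β h) = h
  γγ : ∀ h, γ (γ h) = h
  βne : ∀ h, β h ≠ h
  αγ : ∀ h, α (γ h) = γ (α h)
  vβ : ∀ h, vert (β h) = vert h
  vγ : ∀ h, vert (γ h) = vert h
  eα : ∀ h, edge (α h) = edge h
  eγ : ∀ h, edge (γ h) = edge h
  fα : ∀ h, face (α h) = face h
  fβ : ∀ h, face (β h) = face h
  ends : ∀ h, G.ends (edge h) = s(vert h, vert (α h))
  vα : ∀ h, vert (α h) ≠ vert h
  fγ : ∀ h, face (γ h) ≠ face h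
  sameE : ∀ h h', edge h' = edge h → h' = h ∨ h' = α h ∨ h' = γ h ∨ h' = α (γ h)
  sameV : ∀ h h', vert h = vert h' → Orb β γ h h'
  sameF : ∀ h h', face h = face h' → Orb β α h h'
  vsurj : ∀ v, ∃ h, vert h = v
  esurj : ∀ e, ∃ h, edge h = e
  fsurj : ∀ f, ∃ h, face h = f

namespace FS
variable {V E F H : Type} {G : Multigraph V E} (φ : FS G F H)

theorem αne (h : H) : φ.α h ≠ h := fun hh => φ.vα h (by rw [hh])
theorem γne (h : H) : φ.γ h ≠ h := fun hh => φ.fγ h (by rw [hh])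

open Classical in
noncomputable def μ (X : Set E) (h : H) : H := if φ.edge h ∈ X then φ.α h else φ.γ h

theorem μ_pos {X : Set E} {h : H} (hh : φ.edge h ∈ X) : φ.μ X h = φ.α h := if_pos hh
theorem μ_neg {X : Set E} {h : H} (hh : φ.edge h ∉ X) : φ.μ X h = φ.γ h := if_neg hh

theorem eμ (X : Set E) (h : H) : φ.edge (φ.μ X h) = φ.edge h := by
  unfold μ; split_ifs; exacts [φ.eα h, φ.eγ h]

theorem μμ (X : Set E) (h : H) : φ.μ X (φ.μ X h) = h := by
  by_cases hh : φ.edge h ∈ X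
  · rw [φ.μ_pos hh, φ.μ_pos (by rwa [φ.eα]), φ.αα]
  · rw [φ.μ_neg hh, φ.μ_neg (by rwa [φ.eγ]), φ.γγ]

theorem μne (X : Set E) (h : H) : φ.μ X h ≠ h := by
  unfold μ; split_ifs; exacts [φ.αne h, φ.γne h]

theorem μ_congr {X Y : Set E} {h : H} (hh : φ.edge h ∈ X ↔ φ.edge h ∈ Y) :
    φ.μ X h = φ.μ Y h := by
  by_cases h1 : φ.edge h ∈ X
  · rw [φ.μ_pos h1, φ.μ_pos (hh.1 h1)]
  · rw [φ.μ_neg h1, φ.μ_neg (fun h2 => h1 (hh.2 h2))]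

theorem switch_merge [Finite H] (X : Set E) (h1 : H) (he : φ.edge h1 ∈ X)
    (hn : ¬ Orb φ.β (φ.μ X) h1 (φ.γ h1)) {x y : H} (hxy : Orb φ.β (φ.μ X) x y) :
    Orb φ.β (φ.μ (X \ {φ.edge h1})) x y := by
  classical
  set e := φ.edge h1 with hedef
  have hα : ∀ z, φ.edge z = e → Orb φ.β (φ.μ X) z (φ.α z) := by
    intro z hz
    have := Orb.r (a := φ.β) (b := φ.μ X) z
    rwa [φ.μ_pos (by rwa [hz])] at this
  have hn' : ∀ z, φ.edge z = e → ¬ Orb φ.β (φ.μ X) z (φ.γ z) := by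
    intro z hz hO
    apply hn
    rcases φ.sameE h1 z hz with rfl | rfl | rfl | rfl
    · exact hO
    · refine ((hα h1 rfl).trans hO).trans ?_
      rw [← φ.αγ]
      exact (hα _ (by rw [φ.eγ])).symm
    · rw [φ.γγ] at hO; exact hO.symm
    · rw [← φ.αγ, φ.γγ] at hO
      exact ((hα _ rfl).trans (hO.symm)).trans (hα _ (by rw [φ.eγ])).symm
  let m0 : H → H := fun x => if φ.edge x = e then x else φ.μ X x
  have m0neg : ∀ x, φ.edge x ≠ e → m0 x = φ.μ X x := fun x hx => if_neg hx
  have m0pos : ∀ x, φ.edge x = e → m0 x = x := fun x hx => if_pos hx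
  have sub1 : ∀ {x y}, Orb φ.β m0 x y → Orb φ.β (φ.μ X) x y := by
    intro x y h
    refine Orb.lift ⟨Orb.refl, Orb.symm, Orb.trans⟩ Orb.l ?_ h
    intro z
    by_cases hz : φ.edge z = e
    · rw [m0pos z hz]; exact Orb.refl _
    · rw [m0neg z hz]; exact Orb.r _
  have sub2 : ∀ {x y}, Orb φ.β m0 x y → Orb φ.β (φ.μ (X \ {e})) x y := by
    intro x y h
    refine Orb.lift ⟨Orb.refl, Orb.symm, Orb.trans⟩ Orb.l ?_ h
    intro z
    by_cases hz : φ.edge z = e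
    · rw [m0pos z hz]; exact Orb.refl _
    · rw [m0neg z hz, φ.μ_congr (X := X) (Y := X \ {e}) (by simp [hz])]; exact Orb.r _
  have key : ∀ z, φ.edge z = e → Orb φ.β m0 z (φ.α z) := by
    intro z hz
    by_contra hc
    have hE := handshake φ.β (φ.μ X) φ.ββ φ.βne (φ.μμ X) {x | Orb φ.β m0 z x}
      {x | φ.edge x = e} (fun x hx => Orb.trans hx (Orb.l _)) (by
        intro x hx hxe
        refine ⟨?_, ?_, φ.μne X x⟩
        · have := Orb.r (a := φ.β) (b := m0) x
          rw [m0neg x hxe] at this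
          exact Orb.trans hx this
        · simpa [φ.eμ] using hxe)
    have : {x | Orb φ.β m0 z x} ∩ {x | φ.edge x = e} = {z} := by
      ext x
      simp only [Set.mem_inter_iff, Set.mem_ofPred_eq, Set.mem_singleton_iff]
      constructor
      · rintro ⟨hO, hx⟩
        rcases φ.sameE z x (hx.trans hz.symm) with rfl | rfl | rfl | rfl
        · rfl
        · exact absurd hO hc
        · exact absurd (sub1 hO) (hn' z hz)
        · refine absurd ((sub1 hO).trans (hα (φ.γ z) (by rwa [φ.eγ])).symm) (hn' z hz)
      · rintro rfl; exact ⟨Orb.refl _, hz⟩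
    rw [this] at hE
    simp at hE
  refine Orb.lift ⟨Orb.refl, Orb.symm, Orb.trans⟩ Orb.l ?_ hxy
  intro z
  by_cases hz : φ.edge z = e
  · rw [φ.μ_pos (by rwa [hz])]; exact sub2 (key z hz)
  · rw [φ.μ_congr (X := X) (Y := X \ {e}) (by simp [hz])]; exact Orb.r _

noncomputable def c (X : Set E) : ℕ := Nat.card (Quotient (orbSetoid φ.β (φ.μ X)))

theorem c_switch [Finite H] (X : Set E) (e : E) : φ.c (X \ {e}) ≤ φ.c X + 1 := by
  classical
  by_cases heX : e ∈ X
  swap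
  · rw [Set.sdiff_singleton_eq_self heX]; omega
  obtain ⟨h1, rfl⟩ := φ.esurj e
  set e := φ.edge h1 with hedef
  let Y := X \ {e}
  let T : H → Prop := fun z => Orb φ.β (φ.μ Y) z h1 ∨ Orb φ.β (φ.μ Y) z (φ.α h1)
  have hT : ∀ {x y}, Orb φ.β (φ.μ Y) x y → T x → T y := by
    rintro x y h (h' | h')
    · exact Or.inl (h.symm.trans h')
    · exact Or.inr (h.symm.trans h')
  have hγ : ∀ z, φ.edge z = e → Orb φ.β (φ.μ Y) z (φ.γ z) := by
    intro z hz
    have := Orb.r (a := φ.β) (b := φ.μ Y) z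
    rwa [φ.μ_neg (by simp [Y, hz])] at this
  have hTe : ∀ z, φ.edge z = e → T z := by
    intro z hz
    rcases φ.sameE h1 z hz with rfl | rfl | rfl | rfl
    · exact Or.inl (Orb.refl _)
    · exact Or.inr (Orb.refl _)
    · exact Or.inl (hγ _ rfl).symm
    · rw [φ.αγ]
      exact Or.inr (hγ _ (φ.eα _)).symm
  have key : ∀ {x y}, Orb φ.β (φ.μ X) x y → Orb φ.β (φ.μ Y) x y ∨ (T x ∧ T y) := by
    intro x y h
    refine Orb.lift (R := fun x y => Orb φ.β (φ.μ Y) x y ∨ (T x ∧ T y)) ⟨?_, ?_, ?_⟩ ?_ ?_ h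
    · intro x; exact Or.inl (Orb.refl _)
    · rintro x y (h | h)
      · exact Or.inl h.symm
      · exact Or.inr h.symm
    · rintro x y z (h | h) (h' | h')
      · exact Or.inl (h.trans h')
      · exact Or.inr ⟨hT h.symm h'.1, h'.2⟩
      · exact Or.inr ⟨h.1, hT h' h.2⟩
      · exact Or.inr ⟨h.1, h'.2⟩
    · intro x; exact Or.inl (Orb.l _)
    · intro z
      by_cases hz : φ.edge z = e
      · exact Or.inr ⟨hTe z hz, hTe _ (by rw [φ.eμ, hz])⟩
      · rw [φ.μ_congr (X := X) (Y := Y) (by simp [Y, hz])]; exact Or.inl (Orb.r _)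
  let QX := Quotient (orbSetoid φ.β (φ.μ X))
  let QY := Quotient (orbSetoid φ.β (φ.μ Y))
  let mX : H → QX := Quotient.mk _
  let mY : H → QY := Quotient.mk _
  let f : Option QX → QY := fun o => match o with
    | none => mY (φ.α h1)
    | some q => if q = mX h1 then mY h1 else mY q.out
  have hf : Function.Surjective f := by
    intro q
    obtain ⟨x, rfl⟩ := Quotient.exists_rep q
    by_cases hx : T x
    · rcases hx with hx | hx
      · refine ⟨some (mX h1), ?_⟩
        simp only [f, if_true]
        exact Quotient.sound hx.symm
      · exact ⟨none, Quotient.sound hx.symm⟩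
    · refine ⟨some (mX x), ?_⟩
      have h1' : mX x ≠ mX h1 := by
        intro hh
        have hO : Orb φ.β (φ.μ X) x h1 := Quotient.exact hh
        rcases key hO with h | h
        · exact hx (Or.inl h)
        · exact hx h.1
      simp only [f, h1', if_false]
      have hO : Orb φ.β (φ.μ X) (mX x).out x :=
        Quotient.mk_out (s := orbSetoid φ.β (φ.μ X)) x
      rcases key hO with h | h
      · exact Quotient.sound h
      · exact absurd h.2 hx
  have := Nat.card_le_card_of_surjective f hf
  rwa [Finite.card_option] at this

theorem c_diff [Finite H] (X : Set E) (A : Finset E) : φ.c (X \ A) ≤ φ.c X + A.card := by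
  classical
  induction A using Finset.induction_on with
  | empty => simp
  | insert e A he ih =>
    have : X \ (insert e A : Finset E) = (X \ A) \ {e} := by
      ext x; simp; tauto
    rw [this, Finset.card_insert_of_notMem he]
    have := φ.c_switch (X \ A) e
    omega

theorem single_orbit [Finite H] (S : Set E) (D : Multigraph F {e : E // e ∉ S})
    (hD : ∀ h, ∀ hh : φ.edge h ∉ S, D.ends ⟨φ.edge h, hh⟩ = s(φ.face h, φ.face (φ.γ h)))
    (Sd : Set {e : E // e ∉ S}) (hfin : Sd.Finite) (hSd : D.IsSpanningTree Sd) (h h' : H) :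
    Orb φ.β (φ.μ (Subtype.val '' Sd)ᶜ) h h' := by
  classical
  have fwd : ∀ Y : Set {e : E // e ∉ S}, ∀ {x y}, Orb φ.β (φ.μ (Subtype.val '' Y)ᶜ) x y →
      (D.simpleOn Y).Reachable (φ.face x) (φ.face y) := by
    intro Y x y hO
    refine Orb.lift (R := fun x y => (D.simpleOn Y).Reachable (φ.face x) (φ.face y))
      ⟨fun _ => SimpleGraph.Reachable.refl _, fun h => h.symm, fun h h' => h.trans h'⟩ ?_ ?_ hO
    · intro x; rw [φ.fβ]
    · intro x
      by_cases hx : φ.edge x ∈ Subtype.val '' Y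
      · rw [φ.μ_neg (by simpa using hx)]
        obtain ⟨⟨e, heS⟩, heY, hee⟩ := hx
        simp only at hee
        subst hee
        exact SimpleGraph.Adj.reachable ⟨(φ.fγ x).symm, _, heY, hD x heS⟩
      · rw [φ.μ_pos hx, φ.fα]
  have main : ∀ Y : Finset {e : E // e ∉ S}, (Y : Set {e : E // e ∉ S}) ⊆ Sd → ∀ {x y},
      (D.simpleOn Y).Reachable (φ.face x) (φ.face y) →
      Orb φ.β (φ.μ (Subtype.val '' (Y : Set {e : E // e ∉ S}))ᶜ) x y := by
    intro Y
    induction Y using Finset.induction_on with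
    | empty =>
      intro _ x y hr
      have hb : D.simpleOn ((∅ : Finset {e : E // e ∉ S}) : Set {e : E // e ∉ S}) = ⊥ := by
        ext u v; simp [Multigraph.simpleOn]
      rw [hb, SimpleGraph.reachable_bot] at hr
      have := φ.sameF _ _ hr
      convert this using 2
      ext x; simp [μ]
    | insert e Y he ih =>
      intro hsub
      have hYsub : (Y : Set {e : E // e ∉ S}) ⊆ Sd := fun x hx => hsub (by simp [hx])
      have ih := @ih hYsub
      have heSd : e ∈ Sd := hsub (by simp)
      obtain ⟨e, heS⟩ := e
      obtain ⟨h1, rfl⟩ := φ.esurj e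
      have hnr : ¬ (D.simpleOn Y).Reachable (φ.face h1) (φ.face (φ.γ h1)) := by
        intro hr
        have hadj : (D.simpleOn Sd).Adj (φ.face h1) (φ.face (φ.γ h1)) :=
          ⟨(φ.fγ h1).symm, _, heSd, hD h1 heS⟩
        have hbr := SimpleGraph.isAcyclic_iff_forall_adj_isBridge.1 hSd.1.isAcyclic hadj
        rw [SimpleGraph.isBridge_iff] at hbr
        refine hbr (hr.mono ?_)
        rintro u w ⟨hne, e', he', hee'⟩
        rw [SimpleGraph.deleteEdges_adj]
        refine ⟨⟨hne, e', hYsub he', hee'⟩, ?_⟩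
        intro hmem
        rw [Set.mem_singleton_iff] at hmem
        have := hSd.2.2 e' (hYsub he') _ heSd (by rw [hee', hmem, hD h1 heS])
        exact he (by rw [← this]; exact he')
      have hX : (Subtype.val '' ((insert ⟨φ.edge h1, heS⟩ Y : Finset _) :
          Set {e : E // e ∉ S}))ᶜ = (Subtype.val '' (Y : Set {e : E // e ∉ S}))ᶜ \ {φ.edge h1} := by
        rw [Finset.coe_insert, Set.image_insert_eq]
        ext x; simp; tauto
      have hmerge : ∀ {x y}, Orb φ.β (φ.μ (Subtype.val '' (Y : Set {e : E // e ∉ S}))ᶜ) x y →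
          Orb φ.β (φ.μ (Subtype.val '' ((insert ⟨φ.edge h1, heS⟩ Y : Finset _) :
          Set {e : E // e ∉ S}))ᶜ) x y := by
        intro x y hxy
        rw [hX]
        refine φ.switch_merge _ h1 ?_ ?_ hxy
        · simp only [Set.mem_compl_iff, Set.mem_image, not_exists, not_and]
          rintro ⟨e', h'⟩ hY rfl; exact he hY
        · intro hO; exact hnr (fwd _ hO)
      have hone : Orb φ.β (φ.μ (Subtype.val '' ((insert ⟨φ.edge h1, heS⟩ Y : Finset _) :
          Set {e : E // e ∉ S}))ᶜ) h1 (φ.γ h1) := by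
        rw [hX, ← φ.μ_neg (X := _ \ {φ.edge h1}) (h := h1) (by simp)]
        exact Orb.r _
      have walk : ∀ {u w}, (D.simpleOn ((insert ⟨φ.edge h1, heS⟩ Y : Finset _) :
          Set {e : E // e ∉ S})).Walk u w → ∀ x y, φ.face x = u → φ.face y = w →
          Orb φ.β (φ.μ (Subtype.val '' ((insert ⟨φ.edge h1, heS⟩ Y : Finset _) :
            Set {e : E // e ∉ S}))ᶜ) x y := by
        intro u w p
        induction p with
        | nil =>
          intro x y hx hy
          exact hmerge (ih (by rw [hx, hy]))
        | cons hadj p ihp =>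
          rename_i u v w
          intro x y hx hy
          obtain ⟨z, hz⟩ := φ.fsurj v
          refine Orb.trans ?_ (ihp z y hz hy)
          obtain ⟨hne, e', he', hee'⟩ := hadj
          rw [Finset.coe_insert, Set.mem_insert_iff] at he'
          rcases he' with rfl | he'
          · rw [hD h1 heS, Sym2.eq_iff] at hee'
            rcases hee' with ⟨h2, h3⟩ | ⟨h2, h3⟩
            · have a1 := hmerge (@ih x h1 (by rw [hx, h2]))
              have a2 := hmerge (@ih (φ.γ h1) z (by rw [hz, h3]))
              exact (a1.trans hone).trans a2
            · have a1 := hmerge (@ih x (φ.γ h1) (by rw [hx, h3]))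
              have a2 := hmerge (@ih h1 z (by rw [hz, h2]))
              exact (a1.trans hone.symm).trans a2
          · apply hmerge
            apply ih
            rw [hx, hz]
            exact SimpleGraph.Adj.reachable ⟨hne, e', he', hee'⟩
      intro x y hr
      obtain ⟨p⟩ := hr
      exact walk p x y rfl rfl
  have := @main hfin.toFinset (by simp) h h'
  rw [hfin.coe_toFinset] at this
  exact this (hSd.1.connected.preconnected _ _)

end FS
end CutZ

namespace CutZ
open SimpleGraph

theorem tree_card {V : Type} [Finite V] (T : SimpleGraph V) (hT : T.IsTree) :
    T.edgeSet.ncard + 1 = Nat.card V := by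
  have := (SimpleGraph.isTree_iff_connected_and_card.1 hT).2
  rwa [Nat.card_coe_set_eq] at this

theorem spanning_card {V E : Type} [Finite V] (G : Multigraph V E) (S : Set E)
    (hS : G.IsSpanningTree S) : S.ncard + 1 = Nat.card V := by
  have h : (G.simpleOn S).edgeSet = G.ends '' S := by
    ext x
    induction x using Sym2.ind with
    | _ u v =>
      simp only [mem_edgeSet, Set.mem_image]
      constructor
      · rintro ⟨_, e, he, h⟩; exact ⟨e, he, h⟩
      · rintro ⟨e, he, h⟩
        refine ⟨?_, e, he, h⟩
        have := hS.2.1 e he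
        rw [h] at this; simpa using this
  rw [← tree_card _ hS.1, h, Set.ncard_image_of_injOn]
  intro e he e' he' hh
  exact hS.2.2 e he e' he' hh

theorem btw_trans {V : Type} {T : SimpleGraph V} {r x v a : V} (h : BtwIn T r x v)
    (h' : BtwIn T r v a) : BtwIn T r x a := by
  classical
  intro p
  exact Walk.support_takeUntil_subset_support p (h' p) (h (p.takeUntil v (h' p)))

theorem btw_of_path {V : Type} {T : SimpleGraph V} (hT : T.IsTree) {r v x : V} (p : T.Walk r v)
    (hp : p.IsPath) (hx : x ∈ p.support) : BtwIn T r x v := by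
  classical
  intro q
  have := (hT.isAcyclic.subsingleton_path _ _).elim ⟨p, hp⟩ q.toPath
  have h2 : p = q.bypass := congrArg Subtype.val this
  rw [h2] at hx
  exact Walk.support_bypass_subset_support q hx

theorem btw_adj {V : Type} {T : SimpleGraph V} (hT : T.IsTree) (r : V) {u w : V}
    (h : T.Adj u w) : BtwIn T r u w ∨ BtwIn T r w u := by
  classical
  obtain ⟨p, hp, -⟩ := hT.existsUnique_path r u
  by_cases hw : w ∈ p.support
  · exact Or.inr (btw_of_path hT p hp hw)
  · left
    have hp' : (p.concat h).IsPath := by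
      rw [Walk.concat_isPath_iff]; exact ⟨hp, hw⟩
    refine btw_of_path hT _ hp' ?_
    rw [Walk.support_concat]
    simp

theorem btw_end {V : Type} {T : SimpleGraph V} (r a : V) : BtwIn T r a a :=
  fun p => p.end_mem_support

theorem btw_start {V : Type} {T : SimpleGraph V} (r a : V) : BtwIn T r r a :=
  fun p => p.start_mem_support

theorem Z_facts {V E : Type} [Finite V] (G : Multigraph V E) (S : Set E)
    (hS : G.IsSpanningTree S) (hloop : ∀ e, ¬ (G.ends e).IsDiag) (r : V)
    (Q : Set E) (hQne : Q.Nonempty)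
    (VZ : Set V)
    (hVZ : VZ = {v | ∃ e ∈ Q, ∃ a ∈ G.ends e, BtwIn (G.simpleOn S) r v a})
    (EZ : Set E)
    (hEZ : EZ = Q ∪ {e | e ∈ S ∧ ∃ e' ∈ Q, ∃ a ∈ G.ends e',
      ∀ w ∈ G.ends e, BtwIn (G.simpleOn S) r w a}) :
    (∀ e ∈ EZ, ∀ v ∈ G.ends e, v ∈ VZ) ∧
    ({e | e ∈ S ∧ ∃ e' ∈ Q, ∃ a ∈ G.ends e',
      ∀ w ∈ G.ends e, BtwIn (G.simpleOn S) r w a}.ncard + 1 = VZ.ncard) ∧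
    (∀ v ∈ VZ, ∃ e ∈ EZ, v ∈ G.ends e) := by
  classical
  set T := G.simpleOn S with hTdef
  have hT : T.IsTree := hS.1
  have h1 : ∀ e ∈ EZ, ∀ v ∈ G.ends e, v ∈ VZ := by
    intro e he v hv
    rw [hEZ] at he
    rw [hVZ]
    rcases he with he | ⟨heS, e', he', a, ha, hb⟩
    · exact ⟨e, he, v, hv, btw_end _ _⟩
    · exact ⟨e', he', a, ha, hb v hv⟩
  set SZ := {e | e ∈ S ∧ ∃ e' ∈ Q, ∃ a ∈ G.ends e',
      ∀ w ∈ G.ends e, BtwIn T r w a} with hSZ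
  have hSZEZ : SZ ⊆ EZ := by rw [hEZ]; exact Set.subset_union_right
  have h2 : ∀ e, e ∈ SZ ↔ (e ∈ S ∧ ∀ w ∈ G.ends e, w ∈ VZ) := by
    intro e
    refine ⟨fun he => ⟨he.1, h1 e (hSZEZ he)⟩, ?_⟩
    rintro ⟨heS, hw⟩
    obtain ⟨⟨u, w⟩, huw⟩ := Quot.exists_rep (G.ends e)
    have huw : G.ends e = s(u, w) := huw.symm
    have hadj : T.Adj u w := by
      refine ⟨?_, e, heS, huw⟩
      have := hloop e; rw [huw] at this; simpa using this
    have hu : u ∈ VZ := hw u (by rw [huw]; simp)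
    have hw' : w ∈ VZ := hw w (by rw [huw]; simp)
    rw [hVZ] at hu hw'
    refine ⟨heS, ?_⟩
    rw [huw]
    rcases btw_adj hT r hadj with h | h
    · obtain ⟨e', he', a, ha, hb⟩ := hw'
      refine ⟨e', he', a, ha, ?_⟩
      intro x hx
      rcases Sym2.mem_iff.1 hx with rfl | rfl
      · exact btw_trans h hb
      · exact hb
    · obtain ⟨e', he', a, ha, hb⟩ := hu
      refine ⟨e', he', a, ha, ?_⟩
      intro x hx
      rcases Sym2.mem_iff.1 hx with rfl | rfl
      · exact hb
      · exact btw_trans h hb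
  have hr : r ∈ VZ := by
    obtain ⟨e, he⟩ := hQne
    rw [hVZ]
    exact ⟨e, he, (G.ends e).out.1, Sym2.out_fst_mem _, btw_start _ _⟩
  have hclosed : ∀ v ∈ VZ, ∀ x, BtwIn T r x v → x ∈ VZ := by
    intro v hv x hx
    rw [hVZ] at hv ⊢
    obtain ⟨e', he', a, ha, hb⟩ := hv
    exact ⟨e', he', a, ha, btw_trans hx hb⟩
  have hconn : (T.induce VZ).Connected := by
    have hreach : ∀ v : VZ, (T.induce VZ).Reachable ⟨r, hr⟩ v := by
      rintro ⟨v, hv⟩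
      obtain ⟨p, hp, -⟩ := hT.existsUnique_path r v
      exact ⟨p.induce VZ (fun x hx => hclosed v hv x (btw_of_path hT p hp hx))⟩
    have : Nonempty VZ := ⟨⟨r, hr⟩⟩
    exact ⟨fun u v => (hreach u).symm.trans (hreach v)⟩
  have htree : (T.induce VZ).IsTree := ⟨hconn, hT.isAcyclic.induce VZ⟩
  have h3 : Sym2.map Subtype.val '' (T.induce VZ).edgeSet = G.ends '' SZ := by
    ext x
    constructor
    · rintro ⟨y, hy, rfl⟩
      induction y using Sym2.ind with
      | _ u v =>
        obtain ⟨hne, e, heS, hee⟩ : T.Adj u v := by simpa using hy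
        refine ⟨e, (h2 e).2 ⟨heS, ?_⟩, hee⟩
        rw [hee]
        intro w hw
        rcases Sym2.mem_iff.1 hw with rfl | rfl
        exacts [u.2, v.2]
    · rintro ⟨e, he, rfl⟩
      obtain ⟨⟨u, w⟩, huw⟩ := Quot.exists_rep (G.ends e)
      have huw : G.ends e = s(u, w) := huw.symm
      obtain ⟨heS, hw⟩ := (h2 e).1 he
      have hadj : T.Adj u w := by
        refine ⟨?_, e, heS, huw⟩
        have := hloop e; rw [huw] at this; simpa using this
      have hu : u ∈ VZ := hw u (by rw [huw]; simp)
      have hw' : w ∈ VZ := hw w (by rw [huw]; simp)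
      exact ⟨s(⟨u, hu⟩, ⟨w, hw'⟩), by simpa using hadj, by rw [huw]; rfl⟩
  refine ⟨h1, ?_, ?_⟩
  · rw [← Nat.card_coe_set_eq VZ, ← tree_card _ htree,
      ← Set.ncard_image_of_injective _ (Sym2.map.injective Subtype.val_injective), h3,
      Set.ncard_image_of_injOn]
    intro e he e' he' hh
    exact hS.2.2 e he.1 e' he'.1 hh
  · intro v hv
    -- find another vertex
    have hex : ∃ w ∈ VZ, w ≠ v := by
      obtain ⟨e, he⟩ := hQne
      obtain ⟨⟨u, w⟩, huw⟩ := Quot.exists_rep (G.ends e)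
      have huw : G.ends e = s(u, w) := huw.symm
      have hne : u ≠ w := by
        have := hloop e; rw [huw] at this; simpa using this
      have heZ : e ∈ EZ := by rw [hEZ]; exact Or.inl he
      have hu := h1 e heZ u (by rw [huw]; simp)
      have hw := h1 e heZ w (by rw [huw]; simp)
      by_cases huv : u = v
      · exact ⟨w, hw, fun h => hne (huv.trans h.symm)⟩
      · exact ⟨u, hu, huv⟩
    obtain ⟨w, hw, hwv⟩ := hex
    obtain ⟨p⟩ := hconn.preconnected ⟨v, hv⟩ ⟨w, hw⟩
    cases p with
    | nil => exact absurd rfl hwv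
    | cons hadj p =>
      rename_i u
      obtain ⟨hne, e, heS, hee⟩ : T.Adj v u := hadj
      refine ⟨e, hSZEZ ((h2 e).2 ⟨heS, ?_⟩), by rw [hee]; simp⟩
      rw [hee]
      intro w hw
      rcases Sym2.mem_iff.1 hw with rfl | rfl
      exacts [hv, u.2]

end CutZ

namespace CutZ

theorem two_to_one {H K : Type} [Finite H] [Finite K] (s : Set H) (t : Set K) (f : H → K)
    (hm : ∀ x ∈ s, f x ∈ t)
    (h2 : ∀ y ∈ t, ∃ x1 x2, x1 ≠ x2 ∧ ∀ x, (x ∈ s ∧ f x = y) ↔ (x = x1 ∨ x = x2)) :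
    s.ncard = 2 * t.ncard := by
  classical
  have := Fintype.ofFinite H
  have := Fintype.ofFinite K
  rw [Set.ncard_eq_toFinset_card', Set.ncard_eq_toFinset_card',
    Finset.card_eq_sum_card_fiberwise (f := f) (t := t.toFinset) (by intro x hx; simpa using hm x (by simpa using hx)),
    Finset.sum_const_nat (m := 2), mul_comm]
  intro y hy
  obtain ⟨x1, x2, hne, hx⟩ := h2 y (by simpa using hy)
  have : (s.toFinset.filter (fun x => f x = y)) = {x1, x2} := by
    ext x; simp [← hx]
  rw [this, Finset.card_pair hne]

theorem one_to_one {H K : Type} [Finite H] [Finite K] (s : Set H) (t : Set K) (f : H → K)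
    (hm : ∀ x ∈ s, f x ∈ t)
    (h2 : ∀ y ∈ t, ∃ x1, ∀ x, (x ∈ s ∧ f x = y) ↔ x = x1) :
    s.ncard = t.ncard := by
  have : t = f '' s := by
    ext y
    constructor
    · intro hy
      obtain ⟨x1, h⟩ := h2 y hy
      exact ⟨x1, (h x1).2 rfl⟩
    · rintro ⟨x, hx, rfl⟩; exact hm x hx
  rw [this, Set.InjOn.ncard_image]
  intro x hx y hy hxy
  obtain ⟨x1, h⟩ := h2 (f x) (hm x hx)
  rw [(h x).1 ⟨hx, rfl⟩, (h y).1 ⟨hy, hxy.symm⟩]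

namespace FS
variable {V E F H : Type} {G : Multigraph V E} (φ : FS G F H)

open Classical in
noncomputable def γc (X : Set E) (h : H) : H := if φ.edge h ∈ X then h else φ.γ h

theorem γc_pos {X : Set E} {h : H} (hh : φ.edge h ∈ X) : φ.γc X h = h := if_pos hh
theorem γc_neg {X : Set E} {h : H} (hh : φ.edge h ∉ X) : φ.γc X h = φ.γ h := if_neg hh

theorem γcγc (X : Set E) (h : H) : φ.γc X (φ.γc X h) = h := by
  by_cases hh : φ.edge h ∈ X
  · rw [φ.γc_pos hh, φ.γc_pos hh]
  · rw [φ.γc_neg hh, φ.γc_neg (by rwa [φ.eγ]), φ.γγ]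

theorem γc_fix {X : Set E} {h : H} : φ.γc X h = h ↔ φ.edge h ∈ X := by
  constructor
  · intro hh
    by_contra hc
    rw [φ.γc_neg hc] at hh
    exact φ.γne h hh
  · exact φ.γc_pos

/-- being at the same vertex of the cut graph -/
def VO (X : Set E) : H → H → Prop := Orb (φ.γc X) φ.β

variable {φ} in
theorem VO.symm {X : Set E} {x y : H} (h : φ.VO X x y) : φ.VO X y x := Orb.symm h
variable {φ} in
theorem VO.trans {X : Set E} {x y z : H} (h : φ.VO X x y) (h' : φ.VO X y z) : φ.VO X x z :=
  Orb.trans h h'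
theorem VO_refl (X : Set E) (x : H) : φ.VO X x x := Orb.refl x
theorem VO_β (X : Set E) (x : H) : φ.VO X x (φ.β x) := Orb.r x
theorem VO_γ {X : Set E} {x : H} (hx : φ.edge x ∉ X) : φ.VO X x (φ.γ x) := by
  rw [← φ.γc_neg hx]; exact Orb.l x

variable {φ} in
theorem VO.vert {X : Set E} {x y : H} (h : φ.VO X x y) : φ.vert x = φ.vert y := by
  refine Orb.map_eq φ.vert ?_ φ.vβ h
  intro z
  unfold γc; split_ifs; exacts [rfl, φ.vγ z]

theorem exists_flag (e : E) (v : V) (hv : v ∈ G.ends e) : ∃ h, φ.edge h = e ∧ φ.vert h = v := by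
  obtain ⟨z, rfl⟩ := φ.esurj e
  rw [φ.ends] at hv
  rcases Sym2.mem_iff.1 hv with rfl | rfl
  · exact ⟨z, rfl, rfl⟩
  · exact ⟨φ.α z, φ.eα z, rfl⟩

theorem VO_other [Finite H] (X : Set E) (h : H) (hh : φ.edge h ∈ X) :
    ∃ h', φ.edge h' ∈ X ∧ h' ≠ h ∧ φ.VO X h h' := by
  by_contra! hc
  have hE := handshake φ.β φ.γ φ.ββ φ.βne φ.γγ {x | φ.VO X h x} {x | φ.edge x ∈ X}
    (fun x hx => VO.trans hx (φ.VO_β X x)) (by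
      intro x hx hxX
      exact ⟨VO.trans hx (φ.VO_γ hxX), by simpa [φ.eγ] using hxX, φ.γne x⟩)
  have : {x | φ.VO X h x} ∩ {x | φ.edge x ∈ X} = {h} := by
    ext x
    simp only [Set.mem_inter_iff, Set.mem_ofPred_eq, Set.mem_singleton_iff]
    constructor
    · rintro ⟨h1, h2⟩
      by_contra h3
      exact hc x h2 h3 h1
    · rintro rfl; exact ⟨φ.VO_refl X _, hh⟩
  rw [this] at hE
  simp at hE

theorem VO_unique (X : Set E) {h x y : H} (hh : φ.edge h ∈ X) (hx : φ.edge x ∈ X)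
    (hy : φ.edge y ∈ X) (hxh : x ≠ h) (hyh : y ≠ h) (ox : φ.VO X h x) (oy : φ.VO X h y) : x = y :=
  dihedral_unique (φ.γc X) φ.β (φ.γcγc X) φ.ββ h x y (φ.γc_pos hh) (φ.γc_pos hx) (φ.γc_pos hy)
    hxh hyh ox oy

theorem VO_bdry (X : Set E) (W : Set V) (hX2 : ∀ v ∈ W, ∃ e ∈ X, v ∈ G.ends e) (h : H)
    (hh : φ.vert h ∈ W) : ∃ h', φ.edge h' ∈ X ∧ φ.VO X h h' := by
  by_contra! hc
  obtain ⟨e, heX, hve⟩ := hX2 _ hh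
  obtain ⟨z, rfl, hz⟩ := φ.exists_flag e _ hve
  refine hc z heX ?_
  refine Orb.closed (fun y => φ.VO X h y) φ.ββ φ.γγ ?_ ?_ (φ.sameV h z hz.symm) (φ.VO_refl X h)
  · intro x hx; exact hx.trans (φ.VO_β X x)
  · intro x hx
    exact hx.trans (φ.VO_γ (fun hxX => hc x hxX hx))

theorem VO_out (X : Set E) (W : Set V) (hX1 : ∀ e ∈ X, ∀ v ∈ G.ends e, v ∈ W) (h h' : H)
    (hh : φ.vert h ∉ W) (hv : φ.vert h = φ.vert h') : φ.VO X h h' := by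
  refine Orb.closed (fun y => φ.VO X h y) φ.ββ φ.γγ ?_ ?_ (φ.sameV h h' hv) (φ.VO_refl X h)
  · intro x hx; exact hx.trans (φ.VO_β X x)
  · intro x hx
    refine hx.trans (φ.VO_γ (fun hxX => hh ?_))
    rw [hx.vert]
    exact hX1 _ hxX _ (by rw [φ.ends]; simp)

theorem bdry_single [Finite H] [Finite V] (X : Set E) (W : Set V)
    (hX1 : ∀ e ∈ X, ∀ v ∈ G.ends e, v ∈ W)
    (hc : φ.c X ≤ Wᶜ.ncard + 1) (h h' : H) (hh : φ.edge h ∈ X) (hh' : φ.edge h' ∈ X) :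
    Orb φ.β (φ.μ X) h h' := by
  classical
  by_contra hno
  have hW : ∀ x, φ.edge x ∈ X → φ.vert x ∈ W := fun x hx => hX1 _ hx _ (by rw [φ.ends]; simp)
  have hinv : ∀ {x y}, Orb φ.β (φ.μ X) x y → φ.vert x ∉ W → φ.vert x = φ.vert y := by
    intro x y hxy hx
    refine Orb.closed (fun y => φ.vert x = φ.vert y) φ.ββ (φ.μμ X) ?_ ?_ hxy rfl
    · intro y hy; rw [φ.vβ, hy]
    · intro y hy
      rw [φ.μ_neg (fun hyX => hx (hy ▸ hW y hyX)), φ.vγ, hy]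
  choose fl hfl using φ.vsurj
  let Q := Quotient (orbSetoid φ.β (φ.μ X))
  let mk : H → Q := Quotient.mk _
  have mk_eq : ∀ {x y}, mk x = mk y → Orb φ.β (φ.μ X) x y := fun h => Quotient.exact h
  let f : Option (Option (Wᶜ : Set V)) → Q := fun o => match o with
    | none => mk h
    | some none => mk h'
    | some (some v) => mk (fl v.1)
  have hf : Function.Injective f := by
    have hA : ∀ (v : (Wᶜ : Set V)) x, φ.edge x ∈ X → mk (fl v.1) ≠ mk x := by
      intro v x hx hm
      have := hinv (mk_eq hm) (by rw [hfl]; exact v.2)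
      rw [hfl] at this
      exact v.2 (this ▸ hW x hx)
    rintro (_ | _ | v) (_ | _ | w) hvw
    · rfl
    · exact absurd (mk_eq hvw) hno
    · exact absurd hvw.symm (hA w h hh)
    · exact absurd (mk_eq hvw).symm hno
    · rfl
    · exact absurd hvw.symm (hA w h' hh')
    · exact absurd hvw (hA v h hh)
    · exact absurd hvw (hA v h' hh')
    · have := hinv (mk_eq hvw) (by rw [hfl]; exact v.2)
      rw [hfl, hfl] at this
      rw [Subtype.ext this]
  have := Nat.card_le_card_of_injective f hf
  rw [Finite.card_option, Finite.card_option, Nat.card_coe_set_eq] at this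
  unfold c at hc
  have : Nat.card Q ≤ Wᶜ.ncard + 1 := hc
  omega

theorem bdry_walk [Finite H] (X : Set E) (h0 : H) (hh0 : φ.edge h0 ∈ X)
    (hB : ∀ h h', φ.edge h ∈ X → φ.edge h' ∈ X → Orb φ.β (φ.μ X) h h') :
    ∃ (N : ℕ) (w : ℕ → H), 0 < N ∧ (∀ i, φ.edge (w i) ∈ X) ∧ (∀ i, w (i + N) = w i) ∧
      (∀ i, φ.VO X (φ.α (w i)) (w (i + 1))) ∧
      (∀ i j, i < N → j < N → φ.VO X (w i) (w j) → i = j) ∧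
      (∀ i j, w i ≠ φ.α (w j)) ∧
      (∀ h, φ.edge h ∈ X → ∃ i, i < N ∧ (h = w i ∨ h = φ.α (w i))) := by
  classical
  let B := {h : H // φ.edge h ∈ X}
  choose d hd1 hd2 hd3 using fun h : B => φ.VO_other X h.1 h.2
  let δ : B → B := fun h => ⟨d h, hd1 h⟩
  let a : B → B := fun h => ⟨φ.α h.1, by rw [φ.eα]; exact h.2⟩
  have dich : ∀ x y : B, φ.VO X x.1 y.1 → y = x ∨ y = δ x := by
    intro x y hxy
    by_cases hyx : y = x
    · exact Or.inl hyx
    · right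
      apply Subtype.ext
      exact φ.VO_unique X x.2 y.2 (hd1 x) (fun h => hyx (Subtype.ext h)) (hd2 x) hxy (hd3 x)
  have aa : ∀ x, a (a x) = x := fun x => Subtype.ext (φ.αα _)
  have δne : ∀ x, δ x ≠ x := fun x h => hd2 x (congrArg Subtype.val h)
  have δδ : ∀ x, δ (δ x) = x := by
    intro x
    rcases dich (δ x) x (hd3 x).symm with h | h
    · exact absurd h.symm (δne x)
    · exact h.symm
  have ane : ∀ x, a x ≠ x := fun x h => φ.αne _ (congrArg Subtype.val h)
  let τ : B → B := fun x => δ (a x)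
  have τinj : Function.Injective τ := by
    intro x y hxy
    have := congrArg (fun z => a (δ z)) hxy
    simpa [τ, δδ, aa] using this
  let b0 : B := ⟨h0, hh0⟩
  have hper : b0 ∈ Function.periodicPts τ := by
    have : Finite B := inferInstance
    exact Function.Injective.mem_periodicPts τinj b0
  let N := Function.minimalPeriod τ b0
  have hN : 0 < N := Function.minimalPeriod_pos_of_mem_periodicPts hper
  let w : ℕ → B := fun i => τ^[i] b0
  have wN : ∀ i, w (i + N) = w i := by
    intro i
    change τ^[i + N] b0 = τ^[i] b0
    rw [Function.iterate_add_apply, Function.iterate_minimalPeriod]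
  have wk : ∀ i k, w (i + k * N) = w i := by
    intro i k
    induction k with
    | zero => simp
    | succ k ih => rw [Nat.succ_mul, ← Nat.add_assoc, wN, ih]
  have wmod : ∀ i, w (i % N) = w i := by
    intro i
    conv_rhs => rw [← Nat.mod_add_div i N, Nat.mul_comm]
    rw [wk]
  have wsucc : ∀ i, w (i + 1) = δ (a (w i)) := fun i => Function.iterate_succ_apply' τ i b0
  have disj : ∀ i j, w i ≠ a (w j) := by
    intro i j h
    rw [← wk i j] at h
    have h1 : i + j * N = (i + j * N - j) + j := by
      have : j ≤ j * N := Nat.le_mul_of_pos_right j hN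
      omega
    have h2 : w (i + j * N) = τ^[i + j * N - j] (w j) := by
      conv_lhs => rw [h1]
      exact Function.iterate_add_apply τ _ _ b0
    rw [h2] at h
    exact dihedral_disjoint a δ aa δδ ane δne _ _ h
  have wδ : ∀ i, ∃ j, δ (w i) = a (w j) := by
    intro i
    refine ⟨i + N - 1, ?_⟩
    rw [← wN i, show i + N = (i + N - 1) + 1 by omega, wsucc, δδ]
    rfl
  have cover : ∀ x : B, (∃ i, φ.VO X x.1 (w i).1) → ∃ i, x = w i ∨ x = a (w i) := by
    rintro x ⟨i, hi⟩
    rcases dich (w i) x hi.symm with h | h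
    · exact ⟨i, Or.inl h⟩
    · obtain ⟨j, hj⟩ := wδ i
      exact ⟨j, Or.inr (h.trans hj)⟩
  have VOs : ∀ i, φ.VO X (φ.α (w i).1) (w (i + 1)).1 := by
    intro i
    rw [wsucc]
    exact hd3 (a (w i))
  have all : ∀ x : H, Orb φ.β (φ.μ X) h0 x → ∃ i, φ.VO X x (w i).1 := by
    intro x hx
    refine Orb.closed (fun x => ∃ i, φ.VO X x (w i).1) φ.ββ (φ.μμ X) ?_ ?_ hx
      ⟨0, φ.VO_refl X h0⟩
    · rintro x ⟨i, hi⟩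
      exact ⟨i, (φ.VO_β X x).symm.trans hi⟩
    · rintro x ⟨i, hi⟩
      by_cases hx : φ.edge x ∈ X
      · rw [φ.μ_pos hx]
        obtain ⟨j, hj | hj⟩ := cover ⟨x, hx⟩ ⟨i, hi⟩
        · have : x = (w j).1 := congrArg Subtype.val hj
          exact ⟨j + 1, by rw [this]; exact VOs j⟩
        · have : x = φ.α (w j).1 := congrArg Subtype.val hj
          exact ⟨j, by rw [this, φ.αα]; exact φ.VO_refl X _⟩
      · rw [φ.μ_neg hx]
        exact ⟨i, (φ.VO_γ hx).symm.trans hi⟩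
  refine ⟨N, fun i => (w i).1, hN, fun i => (w i).2, fun i => congrArg Subtype.val (wN i), VOs, ?_, ?_, ?_⟩
  · intro i j hi hj hij
    rcases dich (w i) (w j) hij with h | h
    · exact (Function.iterate_eq_iterate_iff_of_lt_minimalPeriod hi hj).1 h.symm
    · obtain ⟨k, hk⟩ := wδ i
      exact absurd (h.trans hk) (disj j k)
  · intro i j h
    exact disj i j (Subtype.ext h)
  · intro h hh
    obtain ⟨i, hi⟩ := cover ⟨h, hh⟩ (all h (hB h0 h hh0 hh))
    refine ⟨i % N, Nat.mod_lt _ hN, ?_⟩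
    show h = (w (i % N)).1 ∨ h = φ.α (w (i % N)).1
    rw [wmod]
    rcases hi with hi | hi
    · exact Or.inl (congrArg Subtype.val hi)
    · exact Or.inr (congrArg Subtype.val hi)

end FS
end CutZ

namespace CutZ
open Multigraph

section Flags
variable {V E F : Type} {G : Multigraph V E}

/-- Flags: an edge occurrence together with one of its two ends. -/
abbrev Fl (bd : F → G.CWalk) : Type := {p : F × ℕ // p.2 < (bd p.1).len} × Bool

variable (bd : F → G.CWalk)

def flV (h : Fl bd) : V := if h.2 then (bd h.1.1.1).vtx (h.1.1.2 + 1) else (bd h.1.1.1).vtx h.1.1.2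
def flE (h : Fl bd) : E := (bd h.1.1.1).edge h.1.1.2
def flF (h : Fl bd) : F := h.1.1.1
def flA (h : Fl bd) : Fl bd := (h.1, !h.2)
def flB (h : Fl bd) : Fl bd :=
  if h.2 then (⟨(h.1.1.1, (h.1.1.2 + 1) % (bd h.1.1.1).len), Nat.mod_lt _ (bd h.1.1.1).len_pos⟩, false)
  else (⟨(h.1.1.1, (h.1.1.2 + ((bd h.1.1.1).len - 1)) % (bd h.1.1.1).len),
    Nat.mod_lt _ (bd h.1.1.1).len_pos⟩, true)

def flagAt (c : F × ℕ) : Fl bd := (⟨(c.1, c.2 % (bd c.1).len), Nat.mod_lt _ (bd c.1).len_pos⟩, false)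

theorem vtx_add_mul (W : G.CWalk) (i k : ℕ) : W.vtx (i + k * W.len) = W.vtx i := by
  induction k with
  | zero => simp
  | succ k ih => rw [Nat.succ_mul, ← add_assoc, W.vtx_per, ih]

theorem edge_add_mul (W : G.CWalk) (i k : ℕ) : W.edge (i + k * W.len) = W.edge i := by
  induction k with
  | zero => simp
  | succ k ih => rw [Nat.succ_mul, ← add_assoc, W.edge_per, ih]

theorem vtx_mod (W : G.CWalk) (i : ℕ) : W.vtx (i % W.len) = W.vtx i := by
  conv_rhs => rw [← Nat.mod_add_div i W.len, mul_comm]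
  rw [vtx_add_mul]

theorem edge_mod (W : G.CWalk) (i : ℕ) : W.edge (i % W.len) = W.edge i := by
  conv_rhs => rw [← Nat.mod_add_div i W.len, mul_comm]
  rw [edge_add_mul]

theorem mod_aux1 (i L : ℕ) (hi : i < L) : ((i + 1) % L + (L - 1)) % L = i := by
  rw [Nat.mod_add_mod, show i + 1 + (L - 1) = i + L by omega, Nat.add_mod_right, Nat.mod_eq_of_lt hi]

theorem mod_aux2 (i L : ℕ) (hi : i < L) : ((i + (L - 1)) % L + 1) % L = i := by
  rw [Nat.mod_add_mod, show i + (L - 1) + 1 = i + L by omega, Nat.add_mod_right, Nat.mod_eq_of_lt hi]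

theorem flAA (h : Fl bd) : flA bd (flA bd h) = h := by simp [flA]

theorem flBB (h : Fl bd) : flB bd (flB bd h) = h := by
  obtain ⟨⟨⟨f, i⟩, hi⟩, b⟩ := h
  cases b
  · simp only [flB]; simp [mod_aux2 i _ hi]
  · simp only [flB]; simp [mod_aux1 i _ hi]

theorem flBne (h : Fl bd) : flB bd h ≠ h := by
  obtain ⟨⟨⟨f, i⟩, hi⟩, b⟩ := h
  cases b <;> simp [flB]

theorem flVB (h : Fl bd) : flV bd (flB bd h) = flV bd h := by
  obtain ⟨⟨⟨f, i⟩, hi⟩, b⟩ := h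
  cases b
  · have := vtx_mod (bd f) ((i + ((bd f).len - 1)) % (bd f).len + 1)
    simp only [flV, flB]
    simp [← this, mod_aux2 i _ hi]
  · simp [flV, flB, vtx_mod]

theorem flEA (h : Fl bd) : flE bd (flA bd h) = flE bd h := rfl
theorem flFA (h : Fl bd) : flF bd (flA bd h) = flF bd h := rfl
theorem flFB (h : Fl bd) : flF bd (flB bd h) = flF bd h := by
  unfold flB flF; split_ifs <;> rfl

theorem flEnds (h : Fl bd) : G.ends (flE bd h) = s(flV bd h, flV bd (flA bd h)) := by
  obtain ⟨⟨⟨f, i⟩, hi⟩, b⟩ := h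
  cases b
  · simp [flV, flA, flE, (bd f).compat]
  · simp [flV, flA, flE, (bd f).compat, Sym2.eq_swap]

theorem flV_at (c : F × ℕ) : flV bd (flagAt bd c) = (bd c.1).vtx c.2 := by
  simp [flV, flagAt, vtx_mod]

theorem flE_at (c : F × ℕ) : flE bd (flagAt bd c) = (bd c.1).edge c.2 := by
  simp [flE, flagAt, edge_mod]

theorem flB_A_at (c : F × ℕ) : flB bd (flA bd (flagAt bd c)) = flagAt bd (c.1, c.2 + 1) := by
  simp [flB, flA, flagAt]

theorem sameF_at (f : F) (i : ℕ) : Orb (flB bd) (flA bd) (flagAt bd (f, 0)) (flagAt bd (f, i)) := by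
  induction i with
  | zero => exact Orb.refl _
  | succ i ih =>
    have := flB_A_at bd (f, i)
    simp only at this
    rw [← this]
    exact (ih.trans (Orb.r _)).trans (Orb.l _)

theorem fl_cases (h : Fl bd) : ∃ i, i < (bd (flF bd h)).len ∧
    (h = flagAt bd (flF bd h, i) ∨ h = flB bd (flagAt bd (flF bd h, i))) := by
  obtain ⟨⟨⟨f, i⟩, hi⟩, b⟩ := h
  cases b
  · exact ⟨i, hi, Or.inl (by simp [flagAt, flF, Nat.mod_eq_of_lt hi])⟩
  · refine ⟨(i + 1) % (bd f).len, Nat.mod_lt _ (bd f).len_pos, Or.inr ?_⟩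
    have : flagAt bd (f, (i + 1) % (bd f).len) = flB bd (⟨⟨f, i⟩, hi⟩, true) := by
      simp [flagAt, flB]
    simp only [flF]
    rw [this, flBB]

theorem fl_cases' (h : Fl bd) : ∃ i, i < (bd (flF bd h)).len ∧
    (h = flagAt bd (flF bd h, i) ∨ h = flA bd (flagAt bd (flF bd h, i))) := by
  obtain ⟨⟨⟨f, i⟩, hi⟩, b⟩ := h
  refine ⟨i, hi, ?_⟩
  cases b
  · exact Or.inl (by simp [flagAt, flF, Nat.mod_eq_of_lt hi])
  · exact Or.inr (by simp [flagAt, flA, flF, Nat.mod_eq_of_lt hi])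

theorem fl_sameF (h h' : Fl bd) (hf : flF bd h = flF bd h') : Orb (flB bd) (flA bd) h h' := by
  have key : ∀ h : Fl bd, Orb (flB bd) (flA bd) h (flagAt bd (flF bd h, 0)) := by
    intro h
    obtain ⟨i, -, hi⟩ := fl_cases bd h
    set f := flF bd h
    have h1 := (sameF_at bd f i).symm
    rcases hi with hi | hi
    · rw [hi]; exact h1
    · rw [hi]; exact (Orb.l _).symm.trans h1
  have h1 := key h
  rw [hf] at h1
  exact h1.trans (key h').symm

theorem fl_occ (h : Fl bd) : IsOcc bd (flE bd h) h.1.1 := ⟨h.1.2, rfl⟩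

end Flags

section Emb
variable {V E F : Type} {G : Multigraph V E} (emb : G.Embedding F)

theorem occ_pair (e : E) : ∃ p p', p ≠ p' ∧ ∀ q, IsOcc emb.boundary e q ↔ q = p ∨ q = p' := by
  obtain ⟨p, p', hne, h⟩ := Set.ncard_eq_two.1 (emb.edge_twice e)
  refine ⟨p, p', hne, fun q => ?_⟩
  have : q ∈ {p | IsOcc emb.boundary e p} ↔ q ∈ ({p, p'} : Set (F × ℕ)) := by rw [h]
  simpa using this

theorem occ_third {e : E} {p q q' : F × ℕ} (hp : IsOcc emb.boundary e p) (hq : IsOcc emb.boundary e q)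
    (hq' : IsOcc emb.boundary e q') (h : q ≠ p) (h' : q' ≠ p) : q = q' := by
  obtain ⟨a, b, hne, H⟩ := occ_pair emb e
  rw [H] at hp hq hq'
  grind

theorem occ_other {e : E} {p : F × ℕ} (hp : IsOcc emb.boundary e p) :
    ∃ q, IsOcc emb.boundary e q ∧ q ≠ p := by
  obtain ⟨a, b, hne, H⟩ := occ_pair emb e
  rcases (H p).1 hp with rfl | rfl
  · exact ⟨b, (H b).2 (Or.inr rfl), hne.symm⟩
  · exact ⟨a, (H a).2 (Or.inl rfl), hne⟩

theorem no_loops [Fintype V] [Fintype E] [Fintype F] (hcyc : ∀ f, (emb.boundary f).IsCycle)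
    (hgen : emb.eulerGenus ≠ 0) (e : E) : ¬ (G.ends e).IsDiag := by
  intro hd
  have len1 : ∀ p, IsOcc emb.boundary e p → (emb.boundary p.1).len = 1 := by
    intro p hp
    by_contra hl
    have hpos := (emb.boundary p.1).len_pos
    have h1 := (emb.boundary p.1).compat p.2
    rw [hp.2] at h1
    rw [h1, Sym2.mk_isDiag_iff] at hd
    rw [← vtx_mod _ (p.2 + 1)] at hd
    have h2 := (hcyc p.1).1 _ _ hp.1 (Nat.mod_lt _ hpos) hd
    have h3 := hp.1
    by_cases h4 : p.2 + 1 < (emb.boundary p.1).len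
    · rw [Nat.mod_eq_of_lt h4] at h2; omega
    · have : p.2 + 1 = (emb.boundary p.1).len := by omega
      rw [this, Nat.mod_self] at h2; omega
  obtain ⟨p, p', hne, H⟩ := occ_pair emb e
  have hp := (H p).2 (Or.inl rfl)
  have hp' := (H p').2 (Or.inr rfl)
  have l1 := len1 p hp
  have l2 := len1 p' hp'
  set v := (emb.boundary p.1).vtx p.2 with hv
  have hpc : IsCorner emb.boundary v p := ⟨hp.1, rfl⟩
  have step : ∀ c c', CornerLinked emb.boundary v c c' → (c = p ∨ c = p') → (c' = p ∨ c' = p') := by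
    rintro c c' ⟨hc, hc', e2, q, q', hqq, hq, hq', hcq, hcq'⟩ hcp
    rw [← H] at hcp
    have hl := len1 c hcp
    have hcq2 : q = c := by
      apply Prod.ext hcq.1.symm
      have a1 := hq.1
      have a2 := hcp.1
      rw [← hcq.1] at a1
      omega
    have he2 : e2 = e := by rw [← hq.2, hcq2, hcp.2]
    rw [he2] at hq'
    have hl' := len1 q' hq'
    have : c' = q' := by
      apply Prod.ext hcq'.1
      have a1 := hq'.1
      have a2 := hc'.1
      rw [hcq'.1] at a2
      omega
    rw [this]
    exact (H q').1 hq'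
  have symL : ∀ c c', CornerLinked emb.boundary v c c' → CornerLinked emb.boundary v c' c := by
    rintro c c' ⟨hc, hc', e2, q, q', hqq, hq, hq', hcq, hcq'⟩
    exact ⟨hc', hc, e2, q', q, hqq.symm, hq', hq, hcq', hcq⟩
  have all : ∀ c c', Relation.EqvGen (CornerLinked emb.boundary v) c c' →
      ((c = p ∨ c = p') ↔ (c' = p ∨ c' = p')) := by
    intro c c' h
    induction h with
    | rel a b h => exact ⟨step _ _ h, step _ _ (symL _ _ h)⟩
    | refl a => rfl
    | symm a b _ ih => exact ih.symm
    | trans a b c _ _ ih1 ih2 => exact ih1.trans ih2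
  have corner : ∀ c, IsCorner emb.boundary v c → IsOcc emb.boundary e c := by
    intro c hc
    rw [H]
    exact (all p c (emb.link_conn v p c hpc hc)).1 (Or.inl rfl)
  have inc : ∀ e', v ∈ G.ends e' → e' = e := by
    intro e' hv'
    obtain ⟨q, _, _, Hq⟩ := occ_pair emb e'
    have hq := (Hq q).2 (Or.inl rfl)
    rw [← hq.2, (emb.boundary q.1).compat, Sym2.mem_iff] at hv'
    rcases hv' with h | h
    · rw [← hq.2]; exact (corner q ⟨hq.1, h.symm⟩).2
    · rw [← vtx_mod] at h
      have hm := Nat.mod_lt (q.2 + 1) (emb.boundary q.1).len_pos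
      have h3 := corner (q.1, (q.2 + 1) % (emb.boundary q.1).len) ⟨hm, h.symm⟩
      have h4 := len1 _ h3
      have h5 := hq.1
      simp only at h4
      have h6 : (q.2 + 1) % (emb.boundary q.1).len = q.2 := by
        rw [h4] at h5 ⊢
        omega
      rw [← h3.2, ← hq.2]
      simp only [h6]
  have hev : G.ends e = s(v, v) := by
    have h1 := (emb.boundary p.1).compat p.2
    rw [hp.2] at h1
    rw [h1, Sym2.mk_isDiag_iff] at hd
    rw [h1, ← hd]
  have hV : ∀ u, u = v := by
    intro u
    by_contra hu
    obtain ⟨w⟩ := emb.conn.preconnected v u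
    cases w with
    | nil => exact hu rfl
    | cons h _ =>
      obtain ⟨hne, e', he'⟩ := h
      have := inc e' (by rw [he']; simp)
      rw [this, hev] at he'
      rw [Sym2.eq_iff] at he'
      rcases he' with h | h
      · exact hne h.2
      · exact hne h.1
  have hE : ∀ e', e' = e := by
    intro e'
    apply inc
    have : ∀ z : Sym2 V, v ∈ z := by
      intro z
      induction z with
      | _ x y => rw [hV x]; simp
    exact this _
  have hF : ∀ f, f = p.1 ∨ f = p'.1 := by
    intro f
    have h1 := corner (f, 0) ⟨(emb.boundary f).len_pos, hV _⟩
    rcases (H _).1 h1 with h | h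
    · exact Or.inl (congrArg Prod.fst h)
    · exact Or.inr (congrArg Prod.fst h)
  have hff : p.1 ≠ p'.1 := by
    intro h
    apply hne
    apply Prod.ext h
    have a1 := hp.1
    have a2 := hp'.1
    omega
  apply hgen
  have c1 : Nat.card V = 1 := by
    rw [Nat.card_eq_one_iff_exists]; exact ⟨v, hV⟩
  have c2 : Nat.card E = 1 := by
    rw [Nat.card_eq_one_iff_exists]; exact ⟨e, hE⟩
  have c3 : Nat.card F = 2 := by
    rw [Nat.card_eq_two_iff]
    refine ⟨p.1, p'.1, hff, ?_⟩
    ext f; simpa using hF f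
  unfold Multigraph.Embedding.eulerGenus
  rw [c1, c2, c3]; norm_num

theorem flVA_ne (hl : ∀ e, ¬ (G.ends e).IsDiag) (h : Fl emb.boundary) :
    flV emb.boundary (flA emb.boundary h) ≠ flV emb.boundary h := by
  intro hh
  apply hl (flE emb.boundary h)
  rw [flEnds, hh]
  simp

theorem fl_ext (hl : ∀ e, ¬ (G.ends e).IsDiag) {h h' : Fl emb.boundary} (h1 : h.1.1 = h'.1.1)
    (h2 : flV emb.boundary h = flV emb.boundary h') : h = h' := by
  obtain ⟨o, b⟩ := h
  obtain ⟨o', b'⟩ := h'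
  have : o = o' := Subtype.ext h1
  subst this
  by_contra hne
  have hb : b' = !b := by
    cases b <;> cases b' <;> simp_all
  subst hb
  exact flVA_ne emb hl (o, b) h2.symm

theorem gam_ex (h : Fl emb.boundary) : ∃ h' : Fl emb.boundary,
    flE emb.boundary h' = flE emb.boundary h ∧ h'.1.1 ≠ h.1.1 ∧
      flV emb.boundary h' = flV emb.boundary h := by
  obtain ⟨q, hq, hqne⟩ := occ_other emb (fl_occ _ h)
  have key : ∀ b, flE emb.boundary (⟨q, hq.1⟩, b) = flE emb.boundary h := fun b => hq.2
  have h1 := flEnds emb.boundary (⟨q, hq.1⟩, false)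
  rw [key, flEnds, Sym2.eq_iff] at h1
  rcases h1 with h1 | h1
  · exact ⟨(⟨q, hq.1⟩, false), key _, hqne, h1.1.symm⟩
  · exact ⟨flA emb.boundary (⟨q, hq.1⟩, false), key _, hqne, h1.1.symm⟩

noncomputable def gam (_hl : ∀ e, ¬ (G.ends e).IsDiag) (h : Fl emb.boundary) : Fl emb.boundary :=
  (gam_ex emb h).choose

variable (hl : ∀ e, ¬ (G.ends e).IsDiag)

theorem gamE (h) : flE emb.boundary (gam emb hl h) = flE emb.boundary h :=
  (gam_ex emb h).choose_spec.1
theorem gamO (h) : (gam emb hl h).1.1 ≠ h.1.1 := (gam_ex emb h).choose_spec.2.1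
theorem gamV (h) : flV emb.boundary (gam emb hl h) = flV emb.boundary h :=
  (gam_ex emb h).choose_spec.2.2

theorem gam_uniq {h h' : Fl emb.boundary} (h1 : flE emb.boundary h' = flE emb.boundary h)
    (h2 : h'.1.1 ≠ h.1.1) (h3 : flV emb.boundary h' = flV emb.boundary h) : h' = gam emb hl h := by
  apply fl_ext emb hl
  · refine occ_third emb (fl_occ _ h) ?_ ?_ h2 (gamO emb hl h)
    · rw [← h1]; exact fl_occ _ h'
    · rw [← gamE emb hl h]; exact fl_occ _ _
  · rw [h3, gamV]

theorem corner_flag (v : V) (c p : F × ℕ) (e : E) (hc : IsCorner emb.boundary v c)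
    (hp : IsOcc emb.boundary e p) (hcp : EndOf emb.boundary c p) :
    ∃ h : Fl emb.boundary, h.1.1 = p ∧ flV emb.boundary h = v ∧ flE emb.boundary h = e ∧
      (h = flagAt emb.boundary c ∨ flB emb.boundary h = flagAt emb.boundary c) := by
  obtain ⟨f, i⟩ := c
  obtain ⟨f', j⟩ := p
  obtain ⟨h1, h2⟩ := hcp
  obtain ⟨h3, h4⟩ := hc
  simp only at h1 h2 h3 h4
  subst h1
  rcases h2 with rfl | h2
  · refine ⟨flagAt emb.boundary (f, i), ?_, ?_, ?_, Or.inl rfl⟩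
    · simp [flagAt, Nat.mod_eq_of_lt h3]
    · rw [flV_at]; exact h4
    · rw [flE_at]; exact hp.2
  · refine ⟨(⟨(f, j), hp.1⟩, true), rfl, ?_, hp.2, Or.inr ?_⟩
    · simp [flV]
      rw [← vtx_mod, ← h2, h4]
    · simp [flB, flagAt, ← h2, Nat.mod_eq_of_lt h3]

theorem fl_sameV (h h' : Fl emb.boundary) (hv : flV emb.boundary h = flV emb.boundary h') :
    Orb (flB emb.boundary) (gam emb hl) h h' := by
  have key : ∀ v c c', Relation.EqvGen (CornerLinked emb.boundary v) c c' →
      Orb (flB emb.boundary) (gam emb hl) (flagAt emb.boundary c) (flagAt emb.boundary c') := by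
    intro v c c' h
    induction h with
    | rel a b h =>
      obtain ⟨ha, hb, e, p, p', hne, hp, hp', h1, h2⟩ := h
      obtain ⟨x, x1, x2, x3, x4⟩ := corner_flag emb v a p e ha hp h1
      obtain ⟨y, y1, y2, y3, y4⟩ := corner_flag emb v b p' e hb hp' h2
      have hy : y = gam emb hl x := gam_uniq emb hl (y3.trans x3.symm)
        (by rw [x1, y1]; exact hne.symm) (y2.trans x2.symm)
      have hxy : Orb (flB emb.boundary) (gam emb hl) x y := by rw [hy]; exact Orb.r _
      have hx : Orb (flB emb.boundary) (gam emb hl) x (flagAt emb.boundary a) := by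
        rcases x4 with h | h
        · rw [h]; exact Orb.refl _
        · rw [← h]; exact Orb.l _
      have hy : Orb (flB emb.boundary) (gam emb hl) y (flagAt emb.boundary b) := by
        rcases y4 with h | h
        · rw [h]; exact Orb.refl _
        · rw [← h]; exact Orb.l _
      exact (hx.symm.trans hxy).trans hy
    | refl a => exact Orb.refl _
    | symm a b _ ih => exact ih.symm
    | trans a b c _ _ ih1 ih2 => exact ih1.trans ih2
  have key2 : ∀ h : Fl emb.boundary, ∃ c, IsCorner emb.boundary (flV emb.boundary h) c ∧
      Orb (flB emb.boundary) (gam emb hl) h (flagAt emb.boundary c) := by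
    intro h
    obtain ⟨i, hi, h1 | h1⟩ := fl_cases emb.boundary h
    · refine ⟨(flF emb.boundary h, i), ⟨hi, ?_⟩, ?_⟩
      · rw [← flV_at, ← h1]
      · rw [← h1]; exact Orb.refl _
    · refine ⟨(flF emb.boundary h, i), ⟨hi, ?_⟩, ?_⟩
      · rw [← flV_at, ← flVB, ← h1]
      · have := Orb.l (a := flB emb.boundary) (b := gam emb hl) (flagAt emb.boundary (flF emb.boundary h, i))
        rw [← h1] at this
        exact this.symm
  obtain ⟨c, hc, oc⟩ := key2 h
  obtain ⟨c', hc', oc'⟩ := key2 h'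
  rw [← hv] at hc'
  exact (oc.trans (key _ c c' (emb.link_conn _ c c' hc hc'))).trans oc'.symm

/-- The flag system of an embedding all of whose faces are cycles. -/
noncomputable def fsOf (hcyc : ∀ f, (emb.boundary f).IsCycle) [Nonempty F] :
    FS G F (Fl emb.boundary) where
  α := flA emb.boundary
  β := flB emb.boundary
  γ := gam emb hl
  vert := flV emb.boundary
  edge := flE emb.boundary
  face := flF emb.boundary
  αα := flAA _
  ββ := flBB _
  γγ h := (gam_uniq emb hl (gamE emb hl h).symm (gamO emb hl h).symm (gamV emb hl h).symm).symm
  βne := flBne _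
  αγ h := by
    apply gam_uniq
    · rw [flEA, flEA, gamE]
    · exact gamO emb hl h
    · have h1 := flEnds emb.boundary h
      have h2 := flEnds emb.boundary (gam emb hl h)
      rw [gamE, h1, gamV, Sym2.eq_iff] at h2
      rcases h2 with h2 | h2
      · exact h2.2.symm
      · exact absurd h2.2 (flVA_ne emb hl h)
  vβ := flVB _
  vγ := gamV emb hl
  eα := flEA _
  eγ := gamE emb hl
  fα := flFA _
  fβ := flFB _
  ends := flEnds _
  vα := flVA_ne emb hl
  fγ h hf := by
    apply gamO emb hl h
    apply Prod.ext hf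
    have h1 := gamE emb hl h
    have hf' : (gam emb hl h).1.1.1 = h.1.1.1 := hf
    apply (hcyc h.1.1.1).2 _ _ _ h.1.2
    · unfold flE at h1; rw [hf'] at h1; exact h1
    · rw [← hf']; exact (gam emb hl h).1.2
  sameE h h' he := by
    have h1 := flEnds emb.boundary h
    have h2 := flEnds emb.boundary h'
    rw [he, h1, Sym2.eq_iff] at h2
    by_cases ho : h'.1.1 = h.1.1
    · rcases h2 with h2 | h2
      · exact Or.inl (fl_ext emb hl ho h2.1.symm)
      · exact Or.inr (Or.inl (fl_ext emb hl ho h2.2.symm))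
    · right; right
      rcases h2 with h2 | h2
      · exact Or.inl (gam_uniq emb hl he ho h2.1.symm)
      · right
        rw [← gam_uniq emb hl (h := h) (h' := flA emb.boundary h') he ho h2.1.symm, flAA]
  sameV := fl_sameV emb hl
  sameF := fl_sameF _
  vsurj v := by
    obtain ⟨f⟩ := ‹Nonempty F›
    have hin : ∃ e, v ∈ G.ends e := by
      by_cases hv : v = (emb.boundary f).vtx 0
      · exact ⟨(emb.boundary f).edge 0, by rw [(emb.boundary f).compat, hv]; simp⟩
      · obtain ⟨w⟩ := emb.conn.preconnected v ((emb.boundary f).vtx 0)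
        cases w with
        | nil => exact absurd rfl hv
        | cons h _ =>
          obtain ⟨hne, e', he'⟩ := h
          exact ⟨e', by rw [he']; simp⟩
    obtain ⟨e, he⟩ := hin
    obtain ⟨q, _, _, Hq⟩ := occ_pair emb e
    have hq := (Hq q).2 (Or.inl rfl)
    have h1 := flEnds emb.boundary (⟨q, hq.1⟩, false)
    have h2 : flE emb.boundary (⟨q, hq.1⟩, false) = e := hq.2
    rw [h2] at h1
    rw [h1, Sym2.mem_iff] at he
    rcases he with h | h
    · exact ⟨_, h.symm⟩
    · exact ⟨_, h.symm⟩
  esurj e := by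
    obtain ⟨q, _, _, Hq⟩ := occ_pair emb e
    have hq := (Hq q).2 (Or.inl rfl)
    exact ⟨(⟨q, hq.1⟩, false), hq.2⟩
  fsurj f := ⟨flagAt emb.boundary (f, 0), rfl⟩

instance fl_finite [Finite F] : Finite (Fl emb.boundary) := by
  have : Finite {p : F × ℕ // p.2 < (emb.boundary p.1).len} := by
    apply Finite.of_injective (β := Σ f : F, Fin (emb.boundary f).len)
      (fun p => ⟨p.1.1, ⟨p.1.2, p.2⟩⟩)
    rintro ⟨⟨f, i⟩, hi⟩ ⟨⟨f', i'⟩, hi'⟩ h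
    simp only [Sigma.mk.injEq] at h
    obtain ⟨rfl, h⟩ := h
    simp at h
    simp [h]
  infer_instance

end Emb
end CutZ

namespace CutZ
namespace FS
variable {V E F H : Type} {G : Multigraph V E} (φ : FS G F H)

noncomputable def vS (X : Set E) : Setoid H := orbSetoid (φ.γc X) φ.β

def eS (X : Set E) : Setoid H where
  r h h' := φ.edge h = φ.edge h' ∧ (φ.edge h ∈ X → h' = h ∨ h' = φ.α h)
  iseqv := by
    refine ⟨fun h => ⟨rfl, fun _ => Or.inl rfl⟩, ?_, ?_⟩
    · rintro x y ⟨h1, h2⟩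
      refine ⟨h1.symm, fun hy => ?_⟩
      rcases h2 (by rwa [h1]) with h | h
      · exact Or.inl h.symm
      · right; rw [h, φ.αα]
    · rintro x y z ⟨h1, h2⟩ ⟨h3, h4⟩
      refine ⟨h1.trans h3, fun hx => ?_⟩
      have h4' := h4 (by rwa [← h1])
      rcases h2 hx with h | h <;> rcases h4' with h' | h' <;> subst h <;> subst h'
      · exact Or.inl rfl
      · exact Or.inr rfl
      · exact Or.inr rfl
      · left; rw [φ.αα]

abbrev Vt (X : Set E) : Type := Quotient (φ.vS X)
abbrev Et (X : Set E) : Type := Quotient (φ.eS X)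
noncomputable def mv (X : Set E) (h : H) : φ.Vt X := Quotient.mk (φ.vS X) h
def me (X : Set E) (h : H) : φ.Et X := Quotient.mk (φ.eS X) h

variable {X : Set E}

theorem mv_eq {h h' : H} : φ.mv X h = φ.mv X h' ↔ φ.VO X h h' := Quotient.eq (r := φ.vS X)
theorem me_eq {h h' : H} : φ.me X h = φ.me X h' ↔
    (φ.edge h = φ.edge h' ∧ (φ.edge h ∈ X → h' = h ∨ h' = φ.α h)) := Quotient.eq (r := φ.eS X)

theorem mv_surj (v : φ.Vt X) : ∃ h, φ.mv X h = v := Quotient.exists_rep v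
theorem me_surj (e : φ.Et X) : ∃ h, φ.me X h = e := Quotient.exists_rep e

theorem mv_β (h : H) : φ.mv X (φ.β h) = φ.mv X h := (φ.mv_eq.2 (φ.VO_β X h)).symm
theorem mv_γ {h : H} (hh : φ.edge h ∉ X) : φ.mv X (φ.γ h) = φ.mv X h := (φ.mv_eq.2 (φ.VO_γ hh)).symm
theorem me_α (h : H) : φ.me X (φ.α h) = φ.me X h :=
  (φ.me_eq.2 ⟨(φ.eα h).symm, fun _ => Or.inr rfl⟩).symm
theorem me_γ {h : H} (hh : φ.edge h ∉ X) : φ.me X (φ.γ h) = φ.me X h :=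
  (φ.me_eq.2 ⟨(φ.eγ h).symm, fun h' => absurd h' hh⟩).symm

theorem me_cases {h h' : H} (hh : φ.me X h = φ.me X h') :
    h' = h ∨ h' = φ.α h ∨ (φ.edge h ∉ X ∧ (h' = φ.γ h ∨ h' = φ.α (φ.γ h))) := by
  obtain ⟨h1, h2⟩ := φ.me_eq.1 hh
  by_cases hX : φ.edge h ∈ X
  · rcases h2 hX with h | h
    · exact Or.inl h
    · exact Or.inr (Or.inl h)
  · rcases φ.sameE h h' h1.symm with h | h | h | h
    · exact Or.inl h
    · exact Or.inr (Or.inl h)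
    · exact Or.inr (Or.inr ⟨hX, Or.inl h⟩)
    · exact Or.inr (Or.inr ⟨hX, Or.inr h⟩)

noncomputable def πV (X : Set E) : φ.Vt X → V := Quotient.lift φ.vert (fun _ _ h => VO.vert (φ := φ) h)
def πE (X : Set E) : φ.Et X → E := Quotient.lift φ.edge (fun _ _ h => h.1)

theorem πV_mk (h : H) : φ.πV X (φ.mv X h) = φ.vert h := rfl
theorem πE_mk (h : H) : φ.πE X (φ.me X h) = φ.edge h := rfl

noncomputable def Gt (X : Set E) : Multigraph (φ.Vt X) (φ.Et X) where
  ends := Quotient.lift (fun h => s(φ.mv X h, φ.mv X (φ.α h))) (by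
    intro h h' hh
    have h1 : φ.me X h = φ.me X h' := Quotient.sound (s := φ.eS X) hh
    rcases φ.me_cases h1 with rfl | rfl | ⟨hX, rfl | rfl⟩
    · rfl
    · simp only [φ.αα]; exact Sym2.eq_swap
    · simp only [φ.αγ, φ.mv_γ hX, φ.mv_γ (X := X) (h := φ.α h) (by rwa [φ.eα])]
    · simp only [φ.αα, φ.αγ, φ.mv_γ hX, φ.mv_γ (X := X) (h := φ.α h) (by rwa [φ.eα])]
      exact Sym2.eq_swap)

theorem Gt_ends (h : H) : (φ.Gt X).ends (φ.me X h) = s(φ.mv X h, φ.mv X (φ.α h)) := rfl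

theorem proj (et : φ.Et X) : Sym2.map (φ.πV X) ((φ.Gt X).ends et) = G.ends (φ.πE X et) := by
  obtain ⟨h, rfl⟩ := φ.me_surj et
  rw [Gt_ends, πE_mk, φ.ends]; rfl

theorem me_γ_ne {h : H} (hh : φ.edge h ∈ X) : φ.me X h ≠ φ.me X (φ.γ h) := by
  intro h1
  rcases φ.me_cases h1 with h2 | h2 | h2
  · exact φ.γne _ h2
  · apply φ.vα h
    rw [← h2, φ.vγ]
  · exact h2.1 hh

theorem cE2 (e : E) (k : H) (hk : φ.edge k = e) (et : φ.Et X) :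
    φ.πE X et = e ↔ (et = φ.me X k ∨ et = φ.me X (φ.γ k)) := by
  constructor
  · intro h1
    obtain ⟨h, rfl⟩ := φ.me_surj et
    rw [πE_mk] at h1
    rcases φ.sameE k h (h1.trans hk.symm) with h | h | h | h
    · left; rw [h]
    · left; rw [h, me_α]
    · right; rw [h]
    · right; rw [h, me_α]
  · rintro (rfl | rfl)
    · exact hk
    · rw [πE_mk, φ.eγ, hk]

theorem cE1 (e : E) (he : e ∉ X) (k : H) (hk : φ.edge k = e) (et : φ.Et X) :
    φ.πE X et = e ↔ et = φ.me X k := by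
  constructor
  · intro h1
    obtain ⟨h, rfl⟩ := φ.me_surj et
    rw [πE_mk] at h1
    exact φ.me_eq.2 ⟨h1.trans hk.symm, fun h2 => absurd h2 (by rwa [h1])⟩
  · rintro rfl; exact hk

theorem cntE2 (e : E) (he : e ∈ X) : (φ.πE X ⁻¹' {e}).ncard = 2 := by
  obtain ⟨k, rfl⟩ := φ.esurj e
  rw [Set.ncard_eq_two]
  refine ⟨_, _, φ.me_γ_ne he, ?_⟩
  ext et
  simpa using φ.cE2 _ k rfl et

theorem cntE1 (e : E) (he : e ∉ X) : (φ.πE X ⁻¹' {e}).ncard = 1 := by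
  obtain ⟨k, rfl⟩ := φ.esurj e
  rw [Set.ncard_eq_one]
  refine ⟨φ.me X k, ?_⟩
  ext et
  simpa using φ.cE1 _ he k rfl et

theorem fibV [Finite H] (W : Set V) (hX2 : ∀ v ∈ W, ∃ e ∈ X, v ∈ G.ends e) (vt : φ.Vt X)
    (hv : φ.πV X vt ∈ W) :
    ∃ x1 x2, x1 ≠ x2 ∧ ∀ x, (φ.edge x ∈ X ∧ φ.mv X x = vt) ↔ (x = x1 ∨ x = x2) := by
  obtain ⟨h, rfl⟩ := φ.mv_surj vt
  obtain ⟨x1, h1, h2⟩ := φ.VO_bdry X W hX2 h hv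
  obtain ⟨x2, h3, h4, h5⟩ := φ.VO_other X x1 h1
  refine ⟨x1, x2, h4.symm, fun x => ⟨?_, ?_⟩⟩
  · rintro ⟨h6, h7⟩
    by_cases hx : x = x1
    · exact Or.inl hx
    · right
      exact φ.VO_unique X h1 h6 h3 hx h4 (h2.symm.trans (φ.mv_eq.1 h7).symm) h5
  · rintro (rfl | rfl)
    · exact ⟨h1, φ.mv_eq.2 h2.symm⟩
    · exact ⟨h3, φ.mv_eq.2 (h2.trans h5).symm⟩

theorem cntV [Finite H] [Finite E] (W : Set V) (hX2 : ∀ v ∈ W, ∃ e ∈ X, v ∈ G.ends e) (v : V)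
    (hv : v ∈ W) : (φ.πV X ⁻¹' {v}).ncard = {e ∈ X | v ∈ G.ends e}.ncard := by
  have h1 := two_to_one {h | φ.edge h ∈ X ∧ φ.vert h = v} (φ.πV X ⁻¹' {v}) (φ.mv X)
    (by rintro x ⟨-, hx⟩; exact hx) (by
      intro y hy
      have hy' : φ.πV X y = v := hy
      obtain ⟨x1, x2, hne, hx⟩ := φ.fibV W hX2 y (by rwa [hy'])
      refine ⟨x1, x2, hne, fun x => ?_⟩
      rw [← hx]
      constructor
      · rintro ⟨⟨a, -⟩, b⟩; exact ⟨a, b⟩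
      · rintro ⟨a, b⟩; exact ⟨⟨a, by rw [← hy', ← b, πV_mk]⟩, b⟩)
  have h2 := two_to_one {h | φ.edge h ∈ X ∧ φ.vert h = v} {e ∈ X | v ∈ G.ends e} φ.edge
    (by rintro x ⟨hx, rfl⟩; exact ⟨hx, by rw [φ.ends]; simp⟩) (by
      rintro e ⟨he, hve⟩
      obtain ⟨k, hk, hkv⟩ := φ.exists_flag e v hve
      refine ⟨k, φ.γ k, (φ.γne k).symm, fun x => ⟨?_, ?_⟩⟩
      · rintro ⟨⟨a, b⟩, c⟩
        rcases φ.sameE k x (c.trans hk.symm) with h | h | h | h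
        · exact Or.inl h
        · exfalso; apply φ.vα k; rw [← h, b, hkv]
        · exact Or.inr h
        · exfalso; apply φ.vα (φ.γ k); rw [← h, b, φ.vγ, hkv]
      · rintro (rfl | rfl)
        · exact ⟨⟨by rwa [hk], hkv⟩, hk⟩
        · exact ⟨⟨by rwa [φ.eγ, hk], by rw [φ.vγ, hkv]⟩, by rw [φ.eγ, hk]⟩)
  omega

theorem cV1 (W : Set V) (hX1 : ∀ e ∈ X, ∀ v ∈ G.ends e, v ∈ W) (v : V) (hv : v ∉ W) (k : H)
    (hk : φ.vert k = v) (vt : φ.Vt X) : φ.πV X vt = v ↔ vt = φ.mv X k := by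
  constructor
  · intro h1
    obtain ⟨h, rfl⟩ := φ.mv_surj vt
    exact φ.mv_eq.2 (φ.VO_out X W hX1 h k (by rw [πV_mk] at h1; rwa [h1]) (h1.trans hk.symm))
  · rintro rfl; exact hk

theorem cntV1 (W : Set V) (hX1 : ∀ e ∈ X, ∀ v ∈ G.ends e, v ∈ W) (v : V) (hv : v ∉ W) :
    (φ.πV X ⁻¹' {v}).ncard = 1 := by
  obtain ⟨k, hk⟩ := φ.vsurj v
  rw [Set.ncard_eq_one]
  refine ⟨φ.mv X k, ?_⟩
  ext vt
  simpa using φ.cV1 W hX1 v hv k hk vt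

theorem card_Et [Finite H] [Finite E] : Nat.card (φ.Et X) = Nat.card E + X.ncard := by
  have h1 := two_to_one (φ.πE X ⁻¹' X) X (φ.πE X) (fun _ hx => hx) (by
    intro e he
    obtain ⟨k, hk⟩ := φ.esurj e
    refine ⟨_, _, φ.me_γ_ne (h := k) (by rwa [hk]), fun x => ?_⟩
    rw [← φ.cE2 e k hk]
    exact ⟨fun h => h.2, fun h => ⟨by rw [Set.mem_preimage, h]; exact he, h⟩⟩)
  have h2 := one_to_one (φ.πE X ⁻¹' X)ᶜ Xᶜ (φ.πE X) (fun _ hx => hx) (by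
    intro e he
    obtain ⟨k, hk⟩ := φ.esurj e
    refine ⟨φ.me X k, fun x => ?_⟩
    rw [← φ.cE1 e he k hk]
    exact ⟨fun h => h.2, fun h => ⟨by rw [Set.mem_compl_iff, Set.mem_preimage, h]; exact he, h⟩⟩)
  have h3 := Set.ncard_add_ncard_compl (φ.πE X ⁻¹' X)
  have h4 := Set.ncard_add_ncard_compl X
  omega

theorem card_Vt [Finite H] [Finite E] [Finite V] (W : Set V)
    (hX1 : ∀ e ∈ X, ∀ v ∈ G.ends e, v ∈ W) (hX2 : ∀ v ∈ W, ∃ e ∈ X, v ∈ G.ends e) :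
    Nat.card (φ.Vt X) + W.ncard = Nat.card V + 2 * X.ncard := by
  have h1 := two_to_one (φ.πE X ⁻¹' X) X (φ.πE X) (fun _ hx => hx) (by
    intro e he
    obtain ⟨k, hk⟩ := φ.esurj e
    refine ⟨_, _, φ.me_γ_ne (h := k) (by rwa [hk]), fun x => ?_⟩
    rw [← φ.cE2 e k hk]
    exact ⟨fun h => h.2, fun h => ⟨by rw [Set.mem_preimage, h]; exact he, h⟩⟩)
  have h2 := two_to_one {h | φ.edge h ∈ X} (φ.πE X ⁻¹' X) (φ.me X) (fun _ hx => hx) (by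
    intro e he
    obtain ⟨k, rfl⟩ := φ.me_surj e
    refine ⟨k, φ.α k, (φ.αne k).symm, fun x => ⟨?_, ?_⟩⟩
    · rintro ⟨-, h⟩
      exact (φ.me_eq.1 h.symm).2 he
    · rintro (rfl | rfl)
      · exact ⟨he, rfl⟩
      · exact ⟨by rw [Set.mem_ofPred_eq, φ.eα]; exact he, φ.me_α k⟩)
  have h3 := two_to_one {h | φ.edge h ∈ X} (φ.πV X ⁻¹' W) (φ.mv X)
    (fun x hx => hX1 _ hx _ (by rw [φ.ends]; simp [πV_mk])) (by
      intro y hy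
      exact φ.fibV W hX2 y hy)
  have h4 := one_to_one (φ.πV X ⁻¹' W)ᶜ Wᶜ (φ.πV X) (fun _ hx => hx) (by
    intro v hv
    obtain ⟨k, hk⟩ := φ.vsurj v
    refine ⟨φ.mv X k, fun x => ?_⟩
    rw [← φ.cV1 W hX1 v hv k hk]
    exact ⟨fun h => h.2, fun h => ⟨by rw [Set.mem_compl_iff, Set.mem_preimage, h]; exact hv, h⟩⟩)
  have h5 := Set.ncard_add_ncard_compl (φ.πV X ⁻¹' W)
  have h6 := Set.ncard_add_ncard_compl W
  omega

theorem Gt_conn (Y : Set E) (hXY : X ⊆ Y) (hO : ∀ h h', Orb φ.β (φ.μ Y) h h') [Nonempty H] :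
    (φ.Gt X).simple.Connected := by
  have key : ∀ h h', (φ.Gt X).simple.Reachable (φ.mv X h) (φ.mv X h') := by
    intro h h'
    refine Orb.lift (R := fun x y => (φ.Gt X).simple.Reachable (φ.mv X x) (φ.mv X y))
      ⟨fun _ => SimpleGraph.Reachable.refl _, fun h => h.symm, fun h h' => h.trans h'⟩ ?_ ?_ (hO h h')
    · intro x; rw [φ.mv_β]
    · intro x
      by_cases hx : φ.edge x ∈ Y
      · rw [φ.μ_pos hx]
        by_cases he : φ.mv X x = φ.mv X (φ.α x)
        · rw [he]
        · exact SimpleGraph.Adj.reachable ⟨he, φ.me X x, φ.Gt_ends x⟩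
      · rw [φ.μ_neg hx, φ.mv_γ (fun h => hx (hXY h))]
  have : Nonempty (φ.Vt X) := ⟨φ.mv X (Classical.arbitrary H)⟩
  refine ⟨?_⟩
  intro a b
  obtain ⟨h, rfl⟩ := φ.mv_surj a
  obtain ⟨h', rfl⟩ := φ.mv_surj b
  exact key h h'

end FS
end CutZ

namespace CutZ
open Multigraph

section Cut
variable {V E F : Type} {G : Multigraph V E} (emb : G.Embedding F)
  (φ : FS G F (Fl emb.boundary)) (hα : φ.α = flA emb.boundary) (hβ : φ.β = flB emb.boundary)
  (X : Set E)

noncomputable def bdOld (f : F) : (φ.Gt X).CWalk where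
  len := (emb.boundary f).len
  len_pos := (emb.boundary f).len_pos
  vtx i := φ.mv X (flagAt emb.boundary (f, i))
  edge i := φ.me X (flagAt emb.boundary (f, i))
  vtx_per i := by simp [flagAt]
  edge_per i := by simp [flagAt]
  compat i := by
    rw [FS.Gt_ends, ← φ.mv_β (φ.α _), hα, hβ, flB_A_at]

noncomputable def bdNew (N : ℕ) (w : ℕ → Fl emb.boundary) (hN : 0 < N)
    (hw : ∀ i, w (i + N) = w i) (hs : ∀ i, φ.VO X (φ.α (w i)) (w (i + 1))) : (φ.Gt X).CWalk where
  len := N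
  len_pos := hN
  vtx i := φ.mv X (w i)
  edge i := φ.me X (w i)
  vtx_per i := by simp [hw]
  edge_per i := by simp [hw]
  compat i := by
    rw [FS.Gt_ends, φ.mv_eq.2 (hs i)]

theorem at_side (k : Fl emb.boundary) (f : F) (i : ℕ) (hi : i < (emb.boundary f).len) :
    (flagAt emb.boundary (f, i) = k ∨ flagAt emb.boundary (f, i) = flA emb.boundary k) ↔ (f, i) = k.1.1 := by
  obtain ⟨⟨⟨f', j⟩, hj⟩, b⟩ := k
  cases b <;> simp [flagAt, flA, Nat.mod_eq_of_lt hi]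

/-- the corner of a flag -/
def cor (h : Fl emb.boundary) : Option F × ℕ :=
  (some h.1.1.1, if h.2 then (h.1.1.2 + 1) % (emb.boundary h.1.1.1).len else h.1.1.2)

theorem cor_B (h : Fl emb.boundary) : cor emb (flB emb.boundary h) = cor emb h := by
  obtain ⟨⟨⟨f, i⟩, hi⟩, b⟩ := h
  cases b
  · simp only [flB, cor]; simp [mod_aux2 i _ hi]
  · simp [flB, cor]

theorem cor_at (f : F) (i : ℕ) (hi : i < (emb.boundary f).len) :
    cor emb (flagAt emb.boundary (f, i)) = (some f, i) := by
  simp [cor, flagAt, Nat.mod_eq_of_lt hi]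

theorem flagAt_cor (h : Fl emb.boundary) : ∃ i, i < (emb.boundary h.1.1.1).len ∧
    cor emb h = (some h.1.1.1, i) ∧
    (flagAt emb.boundary (h.1.1.1, i) = h ∨ flagAt emb.boundary (h.1.1.1, i) = flB emb.boundary h) := by
  obtain ⟨⟨⟨f, i⟩, hi⟩, b⟩ := h
  cases b
  · exact ⟨i, hi, rfl, Or.inl (by simp [flagAt, Nat.mod_eq_of_lt hi])⟩
  · refine ⟨(i + 1) % (emb.boundary f).len, Nat.mod_lt _ (emb.boundary f).len_pos, rfl, Or.inr ?_⟩
    simp [flagAt, flB]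

section Mk
variable (Y : Set E) (hXY : X ⊆ Y) (hO : ∀ h h', Orb φ.β (φ.μ Y) h h')
  (hside : ∀ h, (φ.γ h).1.1 ≠ h.1.1)
  (N : ℕ) (w : ℕ → Fl emb.boundary) (hN : 0 < N) (hwX : ∀ i, φ.edge (w i) ∈ X)
  (hw : ∀ i, w (i + N) = w i) (hs : ∀ i, φ.VO X (φ.α (w i)) (w (i + 1)))
  (hinj : ∀ i j, i < N → j < N → φ.VO X (w i) (w j) → i = j)
  (hdis : ∀ i j, w i ≠ φ.α (w j))
  (hcov : ∀ h, φ.edge h ∈ X → ∃ i, i < N ∧ (h = w i ∨ h = φ.α (w i)))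

noncomputable def bdt : Option F → (φ.Gt X).CWalk
  | some f => bdOld emb φ hα hβ X f
  | none => bdNew emb φ X N w hN hw hs

local notation "BD" => bdt emb φ hα hβ X N w hN hw hs

theorem occ_old (k : Fl emb.boundary) (f : F) (i : ℕ) :
    IsOcc BD (φ.me X k) (some f, i) ↔ i < (emb.boundary f).len ∧
      φ.me X (flagAt emb.boundary (f, i)) = φ.me X k := Iff.rfl

theorem occ_new (k : Fl emb.boundary) (i : ℕ) :
    IsOcc BD (φ.me X k) (none, i) ↔ i < N ∧ φ.me X (w i) = φ.me X k := Iff.rfl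

theorem occ_side (k : Fl emb.boundary) :
    IsOcc BD (φ.me X k) (some k.1.1.1, k.1.1.2) := by
  rw [occ_old]
  refine ⟨k.1.2, ?_⟩
  rcases (at_side emb k _ _ k.1.2).2 rfl with h | h
  · exact congrArg _ h
  · rw [show flagAt emb.boundary ((k.1.1).1, (k.1.1).2) = φ.α k from by rw [hα]; exact h, φ.me_α]

include hside hwX hinj hdis hcov in
theorem twice (et : φ.Et X) : {p : Option F × ℕ | IsOcc BD et p}.ncard = 2 := by
  obtain ⟨k, rfl⟩ := φ.me_surj et
  rw [Set.ncard_eq_two]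
  by_cases hk : φ.edge k ∈ X
  · obtain ⟨j, hj, hkj⟩ := hcov k hk
    refine ⟨(some k.1.1.1, k.1.1.2), (none, j), by simp, ?_⟩
    have hme : φ.me X (w j) = φ.me X k := by
      rcases hkj with h | h
      · rw [h]
      · rw [h, φ.me_α]
    ext ⟨o, i⟩
    simp only [Set.mem_ofPred_eq, Set.mem_insert_iff, Set.mem_singleton_iff]
    cases o with
    | some f =>
      constructor
      · intro h
        left
        obtain ⟨h1, h2⟩ := (occ_old emb φ hα hβ X N w hN hw hs k f i).1 h
        have h3 := (φ.me_eq.1 h2.symm).2 hk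
        rw [hα, at_side emb k f i h1] at h3
        rw [← h3]
      · rintro (h | h)
        · rw [h]; exact occ_side emb φ hα hβ X N w hN hw hs k
        · simp at h
    | none =>
      constructor
      · intro h
        right
        obtain ⟨h1, h2⟩ := (occ_new emb φ hα hβ X N w hN hw hs k i).1 h
        rw [← hme] at h2
        rcases (φ.me_eq.1 h2.symm).2 (hwX j) with h3 | h3
        · rw [hinj i j h1 hj (by rw [h3]; exact φ.VO_refl X _)]
        · exact absurd h3 (hdis i j)
      · rintro (h | h)
        · simp at h
        · rw [h, occ_new]; exact ⟨hj, hme⟩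
  · refine ⟨(some k.1.1.1, k.1.1.2), (some (φ.γ k).1.1.1, (φ.γ k).1.1.2), ?_, ?_⟩
    · intro h
      simp only [Prod.mk.injEq, Option.some.injEq] at h
      exact hside k (Prod.ext h.1.symm h.2.symm)
    ext ⟨o, i⟩
    simp only [Set.mem_ofPred_eq, Set.mem_insert_iff, Set.mem_singleton_iff]
    cases o with
    | some f =>
      constructor
      · intro h
        obtain ⟨h1, h2⟩ := (occ_old emb φ hα hβ X N w hN hw hs k f i).1 h
        have h3 := φ.me_cases h2.symm
        have h4 : ((f, i) = k.1.1) ∨ ((f, i) = (φ.γ k).1.1) := by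
          rw [← at_side emb k f i h1, ← at_side emb (φ.γ k) f i h1, ← hα]
          tauto
        rcases h4 with h4 | h4
        · left; rw [← h4]
        · right; rw [← h4]
      · rintro (h | h)
        · rw [h]; exact occ_side emb φ hα hβ X N w hN hw hs k
        · rw [h, ← φ.me_γ hk]; exact occ_side emb φ hα hβ X N w hN hw hs _
    | none =>
      constructor
      · intro h
        obtain ⟨h1, h2⟩ := (occ_new emb φ hα hβ X N w hN hw hs k i).1 h
        have h3 := (φ.me_eq.1 h2).1
        exact absurd (h3 ▸ hwX i) hk
      · rintro (h | h) <;> simp at h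

theorem cor_corner (h : Fl emb.boundary) : IsCorner BD (φ.mv X h) (cor emb h) := by
  obtain ⟨i, hi, h1, h2⟩ := flagAt_cor emb h
  rw [h1]
  refine ⟨hi, ?_⟩
  show φ.mv X (flagAt emb.boundary (h.1.1.1, i)) = _
  rcases h2 with h2 | h2
  · rw [h2]
  · rw [h2, ← hβ, φ.mv_β]

theorem cor_end (h : Fl emb.boundary) : EndOf BD (cor emb h) (some h.1.1.1, h.1.1.2) := by
  obtain ⟨⟨⟨f, i⟩, hi⟩, b⟩ := h
  cases b
  · exact ⟨rfl, Or.inl rfl⟩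
  · exact ⟨rfl, Or.inr rfl⟩

include hside in
theorem link_VO {h h' : Fl emb.boundary} (hh : φ.VO X h h') :
    φ.mv X h = φ.mv X h' ∧
      Relation.EqvGen (CornerLinked BD (φ.mv X h)) (cor emb h) (cor emb h') := by
  refine Orb.lift (R := fun x y => φ.mv X x = φ.mv X y ∧
      Relation.EqvGen (CornerLinked BD (φ.mv X x)) (cor emb x) (cor emb y)) ?_ ?_ ?_ hh
  · refine ⟨fun x => ⟨rfl, Relation.EqvGen.refl _⟩, ?_, ?_⟩
    · rintro x y ⟨h1, h2⟩
      exact ⟨h1.symm, by rw [← h1]; exact Relation.EqvGen.symm _ _ h2⟩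
    · rintro x y z ⟨h1, h2⟩ ⟨h3, h4⟩
      rw [← h1] at h4
      exact ⟨h1.trans h3, Relation.EqvGen.trans _ _ _ h2 h4⟩
  · intro x
    by_cases hx : φ.edge x ∈ X
    · rw [φ.γc_pos hx]; exact ⟨rfl, Relation.EqvGen.refl _⟩
    · rw [φ.γc_neg hx]
      refine ⟨(φ.mv_γ hx).symm, Relation.EqvGen.rel _ _ ⟨?_, ?_, φ.me X x, (some x.1.1.1, x.1.1.2),
        (some (φ.γ x).1.1.1, (φ.γ x).1.1.2), ?_, ?_, ?_, ?_, ?_⟩⟩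
      · exact cor_corner emb φ hα hβ X N w hN hw hs x
      · rw [← φ.mv_γ hx]; exact cor_corner emb φ hα hβ X N w hN hw hs _
      · intro h
        simp only [Prod.mk.injEq, Option.some.injEq] at h
        exact hside x (Prod.ext h.1.symm h.2.symm)
      · exact occ_side emb φ hα hβ X N w hN hw hs x
      · rw [← φ.me_γ hx]; exact occ_side emb φ hα hβ X N w hN hw hs _
      · exact cor_end emb φ hα hβ X N w hN hw hs x
      · exact cor_end emb φ hα hβ X N w hN hw hs _
  · intro x
    rw [φ.mv_β, hβ, cor_B]
    exact ⟨rfl, Relation.EqvGen.refl _⟩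

theorem link_rep (v : φ.Vt X) (c : Option F × ℕ) (hc : IsCorner BD v c) :
    ∃ h, φ.mv X h = v ∧ Relation.EqvGen (CornerLinked BD v) c (cor emb h) := by
  obtain ⟨o, i⟩ := c
  cases o with
  | some f =>
    refine ⟨flagAt emb.boundary (f, i), hc.2, ?_⟩
    rw [cor_at emb f i hc.1]
    exact Relation.EqvGen.refl _
  | none =>
    have hv : φ.mv X (w i) = v := hc.2
    refine ⟨w i, hv, Relation.EqvGen.rel _ _ ⟨hc, ?_, φ.me X (w i), (none, i),
      (some (w i).1.1.1, (w i).1.1.2), by simp, ⟨hc.1, rfl⟩, ?_, ⟨rfl, Or.inl rfl⟩, ?_⟩⟩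
    · rw [← hv]; exact cor_corner emb φ hα hβ X N w hN hw hs _
    · exact occ_side emb φ hα hβ X N w hN hw hs _
    · exact cor_end emb φ hα hβ X N w hN hw hs _

noncomputable def embt : (φ.Gt X).Embedding (Option F) where
  boundary := BD
  conn := by
    have : Nonempty (Fl emb.boundary) := ⟨w 0⟩
    exact φ.Gt_conn Y hXY hO
  edge_twice := twice emb φ hα hβ X hside N w hN hwX hw hs hinj hdis hcov
  link_conn v c c' hc hc' := by
    obtain ⟨h, h1, h2⟩ := link_rep emb φ hα hβ X N w hN hw hs v c hc
    obtain ⟨h', h1', h2'⟩ := link_rep emb φ hα hβ X N w hN hw hs v c' hc'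
    have h3 := (link_VO emb φ hα hβ X hside N w hN hw hs (φ.mv_eq.1 (h1.trans h1'.symm))).2
    rw [h1] at h3
    exact Relation.EqvGen.trans _ _ _ (Relation.EqvGen.trans _ _ _ h2 h3)
      (Relation.EqvGen.symm _ _ h2')

end Mk
end Cut
end CutZ

/-- cutting along `Z`.
Let `g ≥ 1` and let `G` be a connected multigraph with `n` vertices and `m` edges
embedded in a surface of Euler genus `g` without crossings, where each face is bounded
by a cycle.  Let `T` be a spanning tree of `G` rooted at `r`, let `Q` be the set of `g`
edges of `G` dual to the edges of the dual multigraph `D` outside a spanning tree `T*`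
of `D`, and let `Z = Z₁ ∪ ⋯ ∪ Z_g` where `Zᵢ` consists of the `aᵢr`- and `bᵢr`-paths in
`T` plus the edge `aᵢbᵢ` (for `Q = {a₁b₁, …, a_g b_g}`); say `Z` has `p` vertices.
Then the multigraph `G̃` obtained by cutting `G` along the edges of `Z` (each edge of
`Z` is replaced by two edges and each vertex `v` of `Z` by `deg_Z v` vertices, the
faces of `G` being preserved) is connected, has `n + p − 2 + 2g` vertices and
`m + p − 1 + g` edges, its induced embedding is in the plane (Euler genus 0, with
exactly one new face), and all vertices introduced by the cutting lie on the boundary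
of a single face of `G̃`, whose boundary is a cycle with vertex set exactly the set of
introduced vertices. -/
theorem cut_along_Z (g : ℕ) (hg : 1 ≤ g)
    {V E F : Type} [Fintype V] [Fintype E] [Fintype F]
    (G : Multigraph V E) (emb : G.Embedding F)
    (hcyc : ∀ f, (emb.boundary f).IsCycle)
    (hgen : emb.eulerGenus = (g : ℤ))
    (S : Set E) (hS : G.IsSpanningTree S) (r : V)
    (D : Multigraph F {e : E // e ∉ S})
    (hD : ∀ (e : {e : E // e ∉ S}) (f : F),
      f ∈ D.ends e ↔ (emb.boundary f).HasEdge e.val)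
    (Sd : Set {e : E // e ∉ S}) (hSd : D.IsSpanningTree Sd)
    (Q : Set E) (hQ : Q = {e | ∃ h : e ∉ S, ⟨e, h⟩ ∉ Sd})
    (VZ : Set V)
    (hVZ : VZ = {v | ∃ e ∈ Q, ∃ a ∈ G.ends e, BtwIn (G.simpleOn S) r v a})
    (EZ : Set E)
    (hEZ : EZ = Q ∪ {e | e ∈ S ∧ ∃ e' ∈ Q, ∃ a ∈ G.ends e',
      ∀ w ∈ G.ends e, BtwIn (G.simpleOn S) r w a}) :
    -- there is a multigraph `G̃` (with an embedding, hence connected) obtained by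
    -- cutting `G` along `Z`, i.e. coming with projections `πV`, `πE` and a lifting
    -- `ιF` of the faces of `G` such that:
    ∃ (Vt Et Ft : Type), Finite Vt ∧ Finite Et ∧ Finite Ft ∧
      ∃ (Gt : Multigraph Vt Et) (embt : Gt.Embedding Ft)
        (πV : Vt → V) (πE : Et → E) (ιF : F → Ft),
        -- the projections are compatible with the incidences,
        (∀ et, Sym2.map πV (Gt.ends et) = G.ends (πE et)) ∧
        -- each edge of `Z` is replaced by two edges, every other edge is kept,
        (∀ e ∈ EZ, (πE ⁻¹' {e}).ncard = 2) ∧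
        (∀ e ∉ EZ, (πE ⁻¹' {e}).ncard = 1) ∧
        -- each vertex `v` of `Z` is replaced by `deg_Z v` vertices, all other
        -- vertices are kept,
        (∀ v ∈ VZ, (πV ⁻¹' {v}).ncard = Set.ncard {e ∈ EZ | v ∈ G.ends e}) ∧
        (∀ v ∉ VZ, (πV ⁻¹' {v}).ncard = 1) ∧
        -- each face of `G` is preserved in `G̃`,
        Function.Injective ιF ∧
        (∀ f, (embt.boundary (ιF f)).len = (emb.boundary f).len ∧
          (∀ i, πV ((embt.boundary (ιF f)).vtx i) = (emb.boundary f).vtx i) ∧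
          (∀ i, πE ((embt.boundary (ιF f)).edge i) = (emb.boundary f).edge i)) ∧
        -- conclusions: `G̃` has `n + p − 2 + 2g` vertices and `m + p − 1 + g` edges,
        (Nat.card Vt : ℤ) = (Nat.card V : ℤ) + VZ.ncard - 2 + 2 * g ∧
        (Nat.card Et : ℤ) = (Nat.card E : ℤ) + VZ.ncard - 1 + g ∧
        -- exactly one face is created by the cutting, and `G̃` is plane,
        Nat.card Ft = Nat.card F + 1 ∧
        embt.eulerGenus = 0 ∧
        -- the vertices introduced by the cutting are exactly the vertices of the
        -- boundary of a single face of `G̃`, and that boundary is a cycle.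
        ∃ Fo : Ft, (embt.boundary Fo).IsCycle ∧
          ∀ vt, (embt.boundary Fo).HasVtx vt ↔ πV vt ∈ VZ := by
  classical
  have hFne : Nonempty F := hSd.1.connected.nonempty
  have hl : ∀ e, ¬ (G.ends e).IsDiag := CutZ.no_loops emb hcyc (by rw [hgen]; omega)
  obtain ⟨φ, hφ⟩ : ∃ φ, φ = CutZ.fsOf emb hl hcyc := ⟨_, rfl⟩
  have hα : φ.α = CutZ.flA emb.boundary := by rw [hφ]; rfl
  have hβ : φ.β = CutZ.flB emb.boundary := by rw [hφ]; rfl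
  have hvert : φ.vert = CutZ.flV emb.boundary := by rw [hφ]; rfl
  have hedge : φ.edge = CutZ.flE emb.boundary := by rw [hφ]; rfl
  have hface : φ.face = CutZ.flF emb.boundary := by rw [hφ]; rfl
  have hside : ∀ h, (φ.γ h).1.1 ≠ h.1.1 := by rw [hφ]; exact CutZ.gamO emb hl
  have hHas : ∀ h, (emb.boundary (φ.face h)).HasEdge (φ.edge h) := by
    intro h
    rw [hface, hedge]
    exact ⟨h.1.1.2, h.1.2, rfl⟩
  have hD' : ∀ h, ∀ hh : φ.edge h ∉ S, D.ends ⟨φ.edge h, hh⟩ = s(φ.face h, φ.face (φ.γ h)) := by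
    intro h hh
    refine ((Sym2.mem_and_mem_iff (φ.fγ h).symm).1 ⟨?_, ?_⟩)
    · rw [hD]; exact hHas h
    · rw [hD]; have := hHas (φ.γ h); rwa [φ.eγ] at this
  have hso := φ.single_orbit S D hD' Sd (Set.toFinite _) hSd
  set Y : Set E := (Subtype.val '' Sd)ᶜ with hY
  have hQS : Disjoint Q S := by
    rw [Set.disjoint_left, hQ]
    rintro e ⟨h, -⟩ h'
    exact h h'
  have hYeq : Y = S ∪ Q := by
    ext e
    rw [hY, hQ]
    simp only [Set.mem_compl_iff, Set.mem_image, Set.mem_union, Set.mem_ofPred_eq, Subtype.exists,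
      exists_and_right, exists_eq_right]
    constructor
    · intro h
      by_cases he : e ∈ S
      · exact Or.inl he
      · exact Or.inr ⟨he, fun h' => h ⟨he, h'⟩⟩
    · rintro (h | ⟨h, h'⟩) ⟨h1, h2⟩
      · exact h1 h
      · exact h' h2
  have cS := CutZ.spanning_card G S hS
  have cSd := CutZ.spanning_card D Sd hSd
  have cY : Y.ncard + Sd.ncard = Nat.card E := by
    rw [hY, ← Set.ncard_image_of_injective Sd Subtype.val_injective, add_comm]
    exact Set.ncard_add_ncard_compl _
  have cY2 : Y.ncard = S.ncard + Q.ncard := by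
    rw [hYeq, Set.ncard_union_eq hQS.symm]
  have hgen' := hgen
  unfold Multigraph.Embedding.eulerGenus at hgen'
  have cQ : Q.ncard = g := by omega
  have hQne : Q.Nonempty := by
    rw [← Set.ncard_pos]; omega
  obtain ⟨hX1, cZ, hX2⟩ := CutZ.Z_facts G S hS hl r Q hQne VZ hVZ EZ hEZ
  set SZ : Set E := {e | e ∈ S ∧ ∃ e' ∈ Q, ∃ a ∈ G.ends e',
      ∀ w ∈ G.ends e, BtwIn (G.simpleOn S) r w a} with hSZ
  have hSZS : SZ ⊆ S := fun e he => he.1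
  have cEZ : EZ.ncard = g + SZ.ncard := by
    rw [hEZ, Set.ncard_union_eq (hQS.mono_right hSZS), cQ]
  have hXY : EZ ⊆ Y := by
    rw [hEZ, hYeq]
    exact Set.union_subset Set.subset_union_right (hSZS.trans Set.subset_union_left)
  have hEZY : EZ = Y \ ((S \ SZ).toFinset : Set E) := by
    rw [hEZ, hYeq, Set.coe_toFinset]
    ext e
    have h1 : e ∈ Q → e ∉ S := fun h => Set.disjoint_left.1 hQS h
    have h2 : e ∈ SZ → e ∈ S := fun h => hSZS h
    simp only [Set.mem_union, Set.mem_sdiff]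
    tauto
  have hcY : φ.c Y ≤ 1 := by
    unfold CutZ.FS.c
    rw [Finite.card_le_one_iff_subsingleton]
    constructor
    intro a b
    induction a using Quotient.inductionOn
    induction b using Quotient.inductionOn
    exact Quotient.sound (hso _ _)
  have hc : φ.c EZ ≤ VZᶜ.ncard + 1 := by
    have h1 := φ.c_diff Y (S \ SZ).toFinset
    rw [← hEZY, ← Set.ncard_eq_toFinset_card'] at h1
    have h2 := Set.ncard_sdiff_add_ncard_of_subset hSZS
    have h3 := Set.ncard_add_ncard_compl VZ
    omega
  have hB := φ.bdry_single EZ VZ hX1 hc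
  obtain ⟨e0, he0⟩ := hQne
  have he0Z : e0 ∈ EZ := by rw [hEZ]; exact Or.inl he0
  obtain ⟨h0, rfl⟩ := φ.esurj e0
  obtain ⟨N, w, hN, hwX, hw, hs, hinj, hdis, hcov⟩ := φ.bdry_walk EZ h0 he0Z hB
  have cV := φ.card_Vt (X := EZ) VZ hX1 hX2
  have cE := φ.card_Et (X := EZ)
  have cF : Nat.card (Option F) = Nat.card F + 1 := Finite.card_option
  refine ⟨φ.Vt EZ, φ.Et EZ, Option F, inferInstance, inferInstance, inferInstance, φ.Gt EZ,
    CutZ.embt emb φ hα hβ EZ Y hXY hso hside N w hN hwX hw hs hinj hdis hcov,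
    φ.πV EZ, φ.πE EZ, some, φ.proj, φ.cntE2, φ.cntE1, φ.cntV VZ hX2, φ.cntV1 VZ hX1,
    Option.some_injective F, ?_, by omega, by omega, cF, ?_, none, ?_, ?_⟩
  · intro f
    refine ⟨rfl, fun i => ?_, fun i => ?_⟩
    · show φ.vert (CutZ.flagAt emb.boundary (f, i)) = _
      rw [hvert, CutZ.flV_at]
    · show φ.edge (CutZ.flagAt emb.boundary (f, i)) = _
      rw [hedge, CutZ.flE_at]
  · unfold Multigraph.Embedding.eulerGenus
    omega
  · constructor
    · intro i j hi hj hij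
      exact hinj i j hi hj (φ.mv_eq.1 hij)
    · intro i j hi hj hij
      rcases (φ.me_eq.1 hij).2 (hwX i) with h | h
      · exact hinj i j hi hj (by rw [h]; exact φ.VO_refl EZ _)
      · exact absurd h (hdis j i)
  · intro vt
    constructor
    · rintro ⟨i, -, rfl⟩
      exact hX1 _ (hwX i) _ (by rw [φ.ends]; exact Sym2.mem_mk_left _ _)
    · intro hv
      obtain ⟨h, rfl⟩ := φ.mv_surj vt
      obtain ⟨h', h1, h2⟩ := φ.VO_bdry EZ VZ hX2 h hv
      obtain ⟨i, hi, h3⟩ := hcov h' h1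
      rcases h3 with h3 | h3
      · exact ⟨i, hi, φ.mv_eq.2 (by rw [← h3]; exact h2.symm)⟩
      · have h4 := hs i
        rw [← h3] at h4
        by_cases hi' : i + 1 < N
        · exact ⟨i + 1, hi', φ.mv_eq.2 (h2.trans h4).symm⟩
        · have h5 : i + 1 = 0 + N := by omega
          rw [h5, hw] at h4
          exact ⟨0, hN, φ.mv_eq.2 (h2.trans h4).symm⟩
end

section
/- For every integer g ≥ 0, every graph with Euler genus g is a subgraph of a (g,3)-framed multigraph. -/
namespace GSF

/-- A combinatorial side system. -/
structure Sys (V E F O : Type) where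
  ends : E → Sym2 V
  face : O → F
  start : O → V
  edge : O → E
  next : Equiv.Perm O
  opp : O → O
  face_next : ∀ p, face (next p) = face p
  face_conn : ∀ p q, face p = face q → Relation.EqvGen (fun a b => b = next a) p q
  face_surj : Function.Surjective face
  edge_surj : Function.Surjective edge
  ends_edge : ∀ p, ends (edge p) = s(start p, start (next p))
  opp_opp : ∀ p, opp (opp p) = p
  opp_ne : ∀ p, opp p ≠ p
  edge_opp : ∀ p, edge (opp p) = edge p
  edge_eq : ∀ p q, edge p = edge q → q = p ∨ q = opp p
  link : ∀ R : O × Bool → O × Bool → Prop, Equivalence R →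
    (∀ p, R (p, true) (next p, false)) →
    (∀ p b b', (bif b then start (next p) else start p) =
      (bif b' then start (next (opp p)) else start (opp p)) → R (p, b) (opp p, b')) →
    ∀ φ ψ : O × Bool, (bif φ.2 then start (next φ.1) else start φ.1) =
      (bif ψ.2 then start (next ψ.1) else start ψ.1) → R φ ψ

namespace Sys

variable {V E F O : Type} (S : Sys V E F O)

/-- vertex of a flag -/
def nu (φ : O × Bool) : V := bif φ.2 then S.start (S.next φ.1) else S.start φ.1

/-- corner involution -/
def sg (φ : O × Bool) : O × Bool :=
  bif φ.2 then (S.next φ.1, false) else (S.next.symm φ.1, true)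

/-- gluing involution -/
def tau (δ : O → Bool) (φ : O × Bool) : O × Bool :=
  (S.opp φ.1, xor φ.2 (xor (δ φ.1) (δ (S.opp φ.1))))

/-- one step relation -/
def Step (δ : O → Bool) (φ ψ : O × Bool) : Prop := ψ = S.sg φ ∨ ψ = S.tau δ φ

/-- connectedness of flags -/
def C (δ : O → Bool) : O × Bool → O × Bool → Prop := Relation.EqvGen (S.Step δ)

/-- valid gluing -/
def Valid (δ : O → Bool) : Prop := ∀ φ, S.nu (S.tau δ φ) = S.nu φ

/-- side is a loop -/
def Lp (e : E) : Prop := (S.ends e).IsDiag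

lemma sg_sg (φ) : S.sg (S.sg φ) = φ := by
  obtain ⟨p, b⟩ := φ
  cases b <;> simp [sg]

lemma sg_ne (φ) : S.sg φ ≠ φ := by
  obtain ⟨p, b⟩ := φ
  cases b <;> simp [sg]

lemma tau_tau (δ φ) : S.tau δ (S.tau δ φ) = φ := by
  obtain ⟨p, b⟩ := φ
  simp only [tau, S.opp_opp]
  cases b <;> cases δ p <;> cases δ (S.opp p) <;> rfl

lemma tau_ne (δ φ) : S.tau δ φ ≠ φ := by
  intro h
  exact S.opp_ne φ.1 (congrArg Prod.fst h)

lemma lp_iff (p : O) : S.Lp (S.edge p) ↔ S.start p = S.start (S.next p) := by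
  rw [Lp, S.ends_edge, Sym2.mk_isDiag_iff]

lemma exists_valid : ∃ δ, S.Valid δ := by
  classical
  refine ⟨fun p => decide (S.start p ≠ (Quot.out (S.ends (S.edge p))).1), ?_⟩
  have key : ∀ φ : O × Bool, S.nu φ =
      bif xor φ.2 (decide (S.start φ.1 ≠ (Quot.out (S.ends (S.edge φ.1))).1))
      then (Quot.out (S.ends (S.edge φ.1))).2 else (Quot.out (S.ends (S.edge φ.1))).1 := by
    rintro ⟨p, b⟩
    have h1 : s((Quot.out (S.ends (S.edge p))).1, (Quot.out (S.ends (S.edge p))).2)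
        = s(S.start p, S.start (S.next p)) := by
      rw [← S.ends_edge]
      exact Quot.out_eq _
    simp only [nu]
    generalize Quot.out (S.ends (S.edge p)) = o at *
    rw [Sym2.eq_iff] at h1
    by_cases h : S.start p = o.1
    · cases b <;> simp [h] <;> grind
    · cases b <;> simp [h] <;> grind
  rintro ⟨p, b⟩
  rw [key, key]
  simp only [tau, S.edge_opp]
  congr 1
  generalize decide (S.start p ≠ _) = x
  generalize decide (S.start (S.opp p) ≠ _) = y
  cases b <;> cases x <;> cases y <;> rfl

lemma C_equiv (δ) : Equivalence (S.C δ) := Relation.EqvGen.is_equivalence _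

lemma C_mono {r s : O × Bool → O × Bool → Prop} (h : ∀ a b, r a b → Relation.EqvGen s a b)
    {a b} (hab : Relation.EqvGen r a b) : Relation.EqvGen s a b := by
  induction hab with
  | rel a b hh => exact h a b hh
  | refl a => exact .refl a
  | symm a b _ ih => exact .symm _ _ ih
  | trans a b c _ _ i1 i2 => exact .trans _ _ _ i1 i2

/-- steps avoiding edge e -/
def Step0 (δ : O → Bool) (e : E) (φ ψ : O × Bool) : Prop :=
  ψ = S.sg φ ∨ (S.edge φ.1 ≠ e ∧ ψ = S.tau δ φ)

lemma parity [Finite O] (δ : O → Bool) (e : E) (φ : O × Bool) (hφ : S.edge φ.1 = e) :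
    ∃ ψ, ψ ≠ φ ∧ S.edge ψ.1 = e ∧ Relation.EqvGen (S.Step0 δ e) φ ψ := by
  classical
  by_contra hcon
  push Not at hcon
  have := Fintype.ofFinite O
  let T : Finset (O × Bool) := Finset.univ.filter (fun ψ => Relation.EqvGen (S.Step0 δ e) φ ψ)
  have h1 : ∑ _x ∈ T, (1 : ZMod 2) = 0 := by
    refine Finset.sum_involution (fun a _ => S.sg a) (fun _ _ => by decide)
      (fun a _ _ => S.sg_ne a) ?_ (fun a _ => S.sg_sg a)
    intro a ha
    simp only [T, Finset.mem_filter, Finset.mem_univ, true_and] at ha ⊢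
    exact .trans _ _ _ ha (.rel _ _ (Or.inl rfl))
  have hφT : φ ∈ T := by simpa [T] using Relation.EqvGen.refl φ
  have h2 : ∑ _x ∈ T.erase φ, (1 : ZMod 2) = 0 := by
    refine Finset.sum_involution (fun a _ => S.tau δ a) (fun _ _ => by decide)
      (fun a _ _ => S.tau_ne δ a) ?_ (fun a _ => S.tau_tau δ a)
    intro a ha
    simp only [T, Finset.mem_filter, Finset.mem_univ, true_and, Finset.mem_erase] at ha ⊢
    have hae : S.edge a.1 ≠ e := fun h => hcon a ha.1 h ha.2
    refine ⟨?_, .trans _ _ _ ha.2 (.rel _ _ (Or.inr ⟨hae, rfl⟩))⟩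
    intro h
    apply hae
    rw [← hφ, ← h]
    exact (S.edge_opp _).symm
  rw [← Finset.add_sum_erase _ _ hφT, h2] at h1
  exact absurd h1 (by decide)

lemma merge [Finite O] (δ : O → Bool) (hδ : S.Valid δ) (p : O) (hp : S.Lp (S.edge p))
    (hc : ¬ S.C δ (p, true) (p, false)) :
    ∃ δ', S.Valid δ' ∧ (∀ a b, S.C δ a b → S.C δ' a b) ∧ S.C δ' (p, true) (p, false) := by
  classical
  let δ' := Function.update δ p (!δ p)
  have hoff : ∀ q, q ≠ p → δ' q = δ q := fun q hq => by simp [δ', hq]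
  have hon : δ' p = !δ p := by simp [δ']
  have hoo : δ' (S.opp p) = δ (S.opp p) := hoff _ (S.opp_ne p)
  have htau : ∀ φ : O × Bool, S.edge φ.1 ≠ S.edge p → S.tau δ' φ = S.tau δ φ := by
    intro φ h
    have h1 : φ.1 ≠ p := fun h' => h (by rw [h'])
    have h2 : S.opp φ.1 ≠ p := fun h' => h (by rw [← h', S.edge_opp])
    simp [tau, hoff _ h1, hoff _ h2]
  have htau2 : ∀ φ : O × Bool, S.edge φ.1 = S.edge p →
      S.tau δ' φ = S.tau δ (φ.1, !φ.2) := by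
    rintro ⟨q, b⟩ h
    rcases S.edge_eq p q h.symm with rfl | rfl
    · simp only [tau, hon, hoo]
      cases b <;> cases δ q <;> cases δ (S.opp q) <;> rfl
    · simp only [tau, hon, hoo, S.opp_opp]
      cases b <;> cases δ p <;> cases δ (S.opp p) <;> rfl
  have hflip : ∀ q b, S.tau δ (q, !b) = ((S.tau δ (q, b)).1, !(S.tau δ (q, b)).2) := by
    intro q b
    simp [tau]
  have hCt : ∀ ε φ, S.C ε φ (S.tau ε φ) := fun ε φ => .rel _ _ (Or.inr rfl)
  have R0 : ∀ a b, Relation.EqvGen (S.Step0 δ (S.edge p)) a b → S.C δ a b := by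
    intro a b h
    refine C_mono ?_ h
    rintro a b (h | h)
    · exact .rel _ _ (Or.inl h)
    · exact .rel _ _ (Or.inr h.2)
  have R1 : ∀ a b, Relation.EqvGen (S.Step0 δ (S.edge p)) a b → S.C δ' a b := by
    intro a b h
    refine C_mono ?_ h
    rintro a b (h | h)
    · exact .rel _ _ (Or.inl h)
    · exact .rel _ _ (Or.inr (by rw [h.2, htau _ h.1]))
  have hn : ∀ b, ¬ S.C δ (p, b) (p, !b) := by
    rintro (_ | _) h
    · exact hc (.symm _ _ h)
    · exact hc h
  have hn' : ∀ φ : O × Bool, S.edge φ.1 = S.edge p → ¬ S.C δ φ (φ.1, !φ.2) := by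
    rintro ⟨q, b⟩ h hh
    rcases S.edge_eq p q h.symm with rfl | rfl
    · exact hn _ hh
    · have a1 := hCt δ (S.opp p, b)
      have a2 := hCt δ (S.opp p, !b)
      rw [hflip] at a2
      have a3 : S.C δ (S.tau δ (S.opp p, b))
        ((S.tau δ (S.opp p, b)).1, !(S.tau δ (S.opp p, b)).2) :=
        .trans _ _ _ (.symm _ _ a1) (.trans _ _ _ hh a2)
      have a4 : S.tau δ (S.opp p, b) = (p, (S.tau δ (S.opp p, b)).2) := by
        simp [tau, S.opp_opp]
      rw [a4] at a3
      exact hn _ a3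
  have key : ∀ φ : O × Bool, S.edge φ.1 = S.edge p →
      Relation.EqvGen (S.Step0 δ (S.edge p)) φ (S.tau δ φ) := by
    intro φ h
    obtain ⟨ψ, h1, h2, h3⟩ := S.parity δ _ φ h
    have h4 := R0 _ _ h3
    rcases S.edge_eq φ.1 ψ.1 (h.trans h2.symm) with h5 | h5
    · exfalso
      have : ψ = (φ.1, !φ.2) := by
        obtain ⟨q, b⟩ := φ
        obtain ⟨q', b'⟩ := ψ
        simp only at h5
        subst h5
        cases b <;> cases b' <;> simp_all
      rw [this] at h4
      exact hn' _ h h4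
    · by_cases h6 : ψ = S.tau δ φ
      · rw [← h6]; exact h3
      · exfalso
        have h7 : ψ = S.tau δ (φ.1, !φ.2) := by
          rw [hflip]
          have : (S.tau δ φ).1 = S.opp φ.1 := rfl
          obtain ⟨q', b'⟩ := ψ
          simp only at h5
          subst h5
          generalize htt : S.tau δ φ = t at *
          obtain ⟨t1, t2⟩ := t
          simp only at this
          subst this
          cases b' <;> cases t2 <;> simp_all
        rw [h7] at h4
        exact hn' _ h (.trans _ _ _ h4 (.symm _ _ (hCt _ _)))
  refine ⟨δ', ?_, ?_, ?_⟩
  · intro φ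
    by_cases h : S.edge φ.1 = S.edge p
    · rw [htau2 φ h, hδ]
      have : S.Lp (S.edge φ.1) := by rw [h]; exact hp
      rw [lp_iff] at this
      obtain ⟨q, b⟩ := φ
      cases b
      · exact this.symm
      · exact this
    · rw [htau _ h, hδ]
  · intro a b h
    refine C_mono ?_ h
    rintro a b (h | h)
    · exact .rel _ _ (Or.inl h)
    · by_cases he : S.edge a.1 = S.edge p
      · rw [h]
        exact R1 _ _ (key _ he)
      · exact .rel _ _ (Or.inr (by rw [h, htau _ he]))
  · have h1 := hCt δ' (p, true)
    rw [htau2 _ rfl] at h1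
    exact .trans _ _ _ h1 (.symm _ _ (R1 _ _ (key (p, false) rfl)))

lemma exists_good [Finite O] : ∃ δ, S.Valid δ ∧ ∀ φ ψ, S.nu φ = S.nu ψ → S.C δ φ ψ := by
  classical
  obtain ⟨δ, hδ, hmax⟩ := Set.exists_max_image {δ | S.Valid δ}
    (fun δ => {x : (O × Bool) × (O × Bool) | S.C δ x.1 x.2}.ncard) (Set.toFinite _) S.exists_valid
  refine ⟨δ, hδ, ?_⟩
  have hl : ∀ p, S.Lp (S.edge p) → S.C δ (p, true) (p, false) := by
    intro p hp
    by_contra hc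
    obtain ⟨δ', h1, h2, h3⟩ := S.merge δ hδ p hp hc
    have := hmax δ' h1
    refine absurd this (not_le.2 (Set.ncard_lt_ncard ?_ (Set.toFinite _)))
    refine ⟨fun x hx => h2 _ _ hx, fun h => hc (@h ((p, true), (p, false)) h3)⟩
  have hCt : ∀ φ, S.C δ φ (S.tau δ φ) := fun φ => .rel _ _ (Or.inr rfl)
  intro φ ψ h
  refine S.link (S.C δ) (S.C_equiv δ) (fun p => .rel _ _ (Or.inl rfl)) ?_ φ ψ h
  intro p b b' hb
  have h1 := hCt (p, b)
  by_cases hb' : (S.tau δ (p, b)).2 = b'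
  · rw [← hb']; exact h1
  · have hv := hδ (p, b)
    by_cases hp : S.Lp (S.edge p)
    · have h2 := hl (S.opp p) (by rw [S.edge_opp]; exact hp)
      refine .trans _ _ _ h1 ?_
      have : (S.tau δ (p, b)) = (S.opp p, !b') := by
        ext
        · rfl
        · simpa using (Bool.eq_not_of_ne hb')
      rw [this]
      cases b'
      · exact h2
      · exact .symm _ _ h2
    · exfalso
      have : (S.tau δ (p, b)) = (S.opp p, !b') := by
        ext
        · rfl
        · simpa using (Bool.eq_not_of_ne hb')
      rw [this] at hv
      rw [← S.edge_opp, lp_iff] at hp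
      cases b <;> cases b' <;> simp_all [nu]

end Sys
end GSF

namespace GSF

open Multigraph

section FromEmb

variable {V E F : Type} {M : Multigraph V E}

lemma vtx_mod (W : M.CWalk) (n : ℕ) : W.vtx (n % W.len) = W.vtx n :=
  Function.Periodic.map_mod_nat (f := W.vtx) (a := W.len) W.vtx_per n

/-- sides of an embedding -/
abbrev Side (emb : M.Embedding F) : Type := {p : F × ℕ // p.2 < (emb.boundary p.1).len}

/-- next side -/
def nextSide (emb : M.Embedding F) : Equiv.Perm (Side emb) where
  toFun p := ⟨(p.1.1, (p.1.2 + 1) % (emb.boundary p.1.1).len),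
    Nat.mod_lt _ (emb.boundary p.1.1).len_pos⟩
  invFun p := ⟨(p.1.1, (p.1.2 + ((emb.boundary p.1.1).len - 1)) % (emb.boundary p.1.1).len),
    Nat.mod_lt _ (emb.boundary p.1.1).len_pos⟩
  left_inv := by
    rintro ⟨⟨f, i⟩, h⟩
    simp only at h
    have := (emb.boundary f).len_pos
    simp only [Subtype.mk.injEq, Prod.mk.injEq, true_and, Nat.mod_add_mod]
    rw [show i + 1 + ((emb.boundary f).len - 1) = i + (emb.boundary f).len by omega,
      Nat.add_mod_right, Nat.mod_eq_of_lt h]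
  right_inv := by
    rintro ⟨⟨f, i⟩, h⟩
    simp only at h
    have := (emb.boundary f).len_pos
    simp only [Subtype.mk.injEq, Prod.mk.injEq, true_and, Nat.mod_add_mod]
    rw [show i + ((emb.boundary f).len - 1) + 1 = i + (emb.boundary f).len by omega,
      Nat.add_mod_right, Nat.mod_eq_of_lt h]

lemma exists_opp (emb : M.Embedding F) (p : Side emb) :
    ∃ q : Side emb, q ≠ p ∧ (emb.boundary q.1.1).edge q.1.2 = (emb.boundary p.1.1).edge p.1.2 ∧
      ∀ r : Side emb, (emb.boundary p.1.1).edge p.1.2 = (emb.boundary r.1.1).edge r.1.2 →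
        r = p ∨ r = q := by
  obtain ⟨x, y, hxy, hs⟩ := Set.ncard_eq_two.1 (emb.edge_twice ((emb.boundary p.1.1).edge p.1.2))
  have hm : ∀ r : Side emb, (emb.boundary p.1.1).edge p.1.2 = (emb.boundary r.1.1).edge r.1.2 →
      r.1 = x ∨ r.1 = y := by
    intro r hr
    have : r.1 ∈ ({x, y} : Set (F × ℕ)) := by
      rw [← hs]; exact ⟨r.2, hr.symm⟩
    simpa using this
  have hx : x ∈ {q : F × ℕ | IsOcc emb.boundary ((emb.boundary p.1.1).edge p.1.2) q} := by
    rw [hs]; simp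
  have hy : y ∈ {q : F × ℕ | IsOcc emb.boundary ((emb.boundary p.1.1).edge p.1.2) q} := by
    rw [hs]; simp
  rcases hm p rfl with h | h
  · refine ⟨⟨y, hy.1⟩, ?_, hy.2, ?_⟩
    · intro h'; apply hxy; rw [← h, ← h']
    · intro r hr
      rcases hm r hr with h1 | h1
      · left; exact Subtype.ext (h1.trans h.symm)
      · right; exact Subtype.ext h1
  · refine ⟨⟨x, hx.1⟩, ?_, hx.2, ?_⟩
    · intro h'; apply hxy; rw [← h, ← h']
    · intro r hr
      rcases hm r hr with h1 | h1
      · right; exact Subtype.ext h1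
      · left; exact Subtype.ext (h1.trans h.symm)

/-- corner flag -/
def chi (emb : M.Embedding F) (c : F × ℕ) : Side emb × Bool :=
  (⟨(c.1, c.2 % (emb.boundary c.1).len), Nat.mod_lt _ (emb.boundary c.1).len_pos⟩, false)

lemma emb_link (emb : M.Embedding F) (opp : Side emb → Side emb)
    (hopp : ∀ p r : Side emb, (emb.boundary p.1.1).edge p.1.2 = (emb.boundary r.1.1).edge r.1.2 →
        r = p ∨ r = opp p)
    (R : Side emb × Bool → Side emb × Bool → Prop) (hR : Equivalence R)
    (st : Side emb → V) (hst : ∀ p, st p = (emb.boundary p.1.1).vtx p.1.2)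
    (h1 : ∀ p, R (p, true) (nextSide emb p, false))
    (h2 : ∀ p b b', (bif b then st (nextSide emb p) else st p) =
      (bif b' then st (nextSide emb (opp p)) else st (opp p)) → R (p, b) (opp p, b'))
    (φ ψ : Side emb × Bool) (h : (bif φ.2 then st (nextSide emb φ.1) else st φ.1) =
      (bif ψ.2 then st (nextSide emb ψ.1) else st ψ.1)) : R φ ψ := by
  have hend : ∀ (v : V) (c : F × ℕ) (P : Side emb), IsCorner emb.boundary v c →
      EndOf emb.boundary c P.1 → ∃ b : Bool,
        (bif b then st (nextSide emb P) else st P) = v ∧ R (P, b) (chi emb c) := by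
    rintro v ⟨f, i⟩ ⟨⟨g, j⟩, hj⟩ ⟨hc1, hc2⟩ ⟨he1, he2⟩
    simp only at hc1 hc2 he1 he2 hj
    subst he1
    rcases he2 with rfl | he2
    · refine ⟨false, by rw [cond_false, hst]; exact hc2, ?_⟩
      have : chi emb (f, i) = (⟨(f, i), hj⟩, false) := by
        simp [chi, Nat.mod_eq_of_lt hj]
      rw [this]
      exact hR.refl _
    · refine ⟨true, ?_, ?_⟩
      · rw [cond_true, hst, ← hc2, he2]
        rfl
      · have : chi emb (f, i) = (nextSide emb ⟨(f, j), hj⟩, false) := by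
          simp only [chi, nextSide, Nat.mod_eq_of_lt hc1]
          simp [he2]
        rw [this]
        exact h1 _
  have hl : ∀ v c c', CornerLinked emb.boundary v c c' → R (chi emb c) (chi emb c') := by
    rintro v c c' ⟨hc, hc', e, p, p', hpp, hp, hp', he, he'⟩
    obtain ⟨b, hb, hb2⟩ := hend v c ⟨p, hp.1⟩ hc he
    obtain ⟨b', hb', hb2'⟩ := hend v c' ⟨p', hp'.1⟩ hc' he'
    have ho : (⟨p', hp'.1⟩ : Side emb) = opp ⟨p, hp.1⟩ := by
      rcases hopp ⟨p, hp.1⟩ ⟨p', hp'.1⟩ (hp.2.trans hp'.2.symm) with h | h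
      · exact absurd (congrArg Subtype.val h).symm hpp
      · exact h
    rw [ho] at hb' hb2'
    exact hR.trans (hR.symm hb2) (hR.trans (h2 _ _ _ (hb.trans hb'.symm)) hb2')
  have hl2 : ∀ v c c', Relation.EqvGen (CornerLinked emb.boundary v) c c' →
      R (chi emb c) (chi emb c') := by
    intro v c c' h
    induction h with
    | rel a b h => exact hl v a b h
    | refl a => exact hR.refl _
    | symm a b _ ih => exact hR.symm ih
    | trans a b c _ _ i1 i2 => exact hR.trans i1 i2
  have hf : ∀ φ : Side emb × Bool, ∃ c, IsCorner emb.boundary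
      (bif φ.2 then st (nextSide emb φ.1) else st φ.1) c ∧ R φ (chi emb c) := by
    have hf0 : ∀ P : Side emb, chi emb P.1 = (P, false) := by
      rintro ⟨⟨f, i⟩, hi⟩
      simp only at hi
      simp [chi, Nat.mod_eq_of_lt hi]
    rintro ⟨P, b⟩
    cases b
    · refine ⟨P.1, ⟨P.2, (hst P).symm⟩, ?_⟩
      rw [hf0]
      exact hR.refl _
    · refine ⟨(nextSide emb P).1, ⟨(nextSide emb P).2, (hst _).symm⟩, ?_⟩
      rw [hf0]
      exact h1 P
  obtain ⟨c, hc, hc2⟩ := hf φ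
  obtain ⟨c', hc', hc2'⟩ := hf ψ
  rw [← h] at hc'
  exact hR.trans hc2 (hR.trans (hl2 _ c c' (emb.link_conn _ c c' hc hc')) (hR.symm hc2'))

lemma exists_sys (emb : M.Embedding F) : ∃ S : Sys V E F (Side emb), S.ends = M.ends := by
  choose opp ho1 ho2 ho3 using exists_opp emb
  refine ⟨{
    ends := M.ends
    face := fun p => p.1.1
    start := fun p => (emb.boundary p.1.1).vtx p.1.2
    edge := fun p => (emb.boundary p.1.1).edge p.1.2
    next := nextSide emb
    opp := opp
    face_next := fun p => rfl
    face_conn := ?_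
    face_surj := fun f => ⟨⟨(f, 0), (emb.boundary f).len_pos⟩, rfl⟩
    edge_surj := ?_
    ends_edge := ?_
    opp_opp := ?_
    opp_ne := ho1
    edge_opp := ho2
    edge_eq := ho3
    link := ?_ }, rfl⟩
  · have h0 : ∀ f i (hi : i < (emb.boundary f).len), Relation.EqvGen
        (fun a b => b = nextSide emb a) ⟨(f, 0), (emb.boundary f).len_pos⟩ ⟨(f, i), hi⟩ := by
      intro f i
      induction i with
      | zero => intro hi; exact .refl _
      | succ n ih =>
        intro hi
        refine .trans _ _ _ (ih (by omega)) (.rel _ _ ?_)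
        simp [nextSide, Nat.mod_eq_of_lt hi]
    rintro ⟨⟨f, i⟩, hi⟩ ⟨⟨g, j⟩, hj⟩ hfg
    simp only at hfg
    subst hfg
    exact .trans _ _ _ (.symm _ _ (h0 f i hi)) (h0 f j hj)
  · intro e
    obtain ⟨x, y, hxy, hs⟩ := Set.ncard_eq_two.1 (emb.edge_twice e)
    have hx : x ∈ {q : F × ℕ | IsOcc emb.boundary e q} := by rw [hs]; simp
    exact ⟨⟨x, hx.1⟩, hx.2⟩
  · rintro ⟨⟨f, i⟩, hi⟩
    simp only [nextSide, Equiv.coe_fn_mk, vtx_mod]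
    exact (emb.boundary f).compat i
  · intro p
    rcases ho3 (opp p) p (ho2 p) with h | h
    · exact absurd h.symm (ho1 p)
    · exact h.symm
  · intro R hR h1 h2 φ ψ h
    exact emb_link emb opp ho3 R hR _ (fun _ => rfl) h1 h2 φ ψ h

end FromEmb

section Tri

variable {V E F : Type} {M : Multigraph V E}

/-- triangle walk -/
def triWalk (vt : Fin 3 → V) (ed : Fin 3 → E) (h : ∀ i, M.ends (ed i) = s(vt i, vt (i + 1))) :
    M.CWalk where
  len := 3
  len_pos := by norm_num
  vtx n := vt (Fin.ofNat 3 n)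
  edge n := ed (Fin.ofNat 3 n)
  vtx_per i := by congr 1; ext; simp [Fin.ofNat]
  edge_per i := by congr 1; ext; simp [Fin.ofNat]
  compat i := by
    rw [h]
    congr 3
    ext
    simp [Fin.ofNat, Fin.val_add]

lemma ofNat_val (i : Fin 3) : Fin.ofNat 3 i.val = i := by
  ext; simp [Fin.ofNat, Nat.mod_eq_of_lt i.2]

/-- triangle corner link -/
def TLink (vt : F → Fin 3 → V) (ed : F → Fin 3 → E) (v : V) (c c' : F × Fin 3) : Prop :=
  vt c.1 c.2 = v ∧ vt c'.1 c'.2 = v ∧ ∃ j j' : Fin 3, (c.1, j) ≠ (c'.1, j') ∧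
    ed c.1 j = ed c'.1 j' ∧ (c.2 = j ∨ c.2 = j + 1) ∧ (c'.2 = j' ∨ c'.2 = j' + 1)

lemma exists_tri (vt : F → Fin 3 → V) (ed : F → Fin 3 → E)
    (hc : ∀ f i, M.ends (ed f i) = s(vt f i, vt f (i + 1)))
    (conn : M.simple.Connected)
    (h2 : ∀ e, ∃ x y : F × Fin 3, x ≠ y ∧ ∀ z : F × Fin 3, ed z.1 z.2 = e ↔ z = x ∨ z = y)
    (hl : ∀ v (c c' : F × Fin 3), vt c.1 c.2 = v → vt c'.1 c'.2 = v →
      Relation.EqvGen (TLink vt ed v) c c')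
    (hv : ∀ f, Function.Injective (vt f)) (he : ∀ f, Function.Injective (ed f)) :
    ∃ emb : M.Embedding F, ∀ f, (emb.boundary f).IsCycle := by
  let up : F × Fin 3 → F × ℕ := fun c => (c.1, c.2.val)
  have upinj : Function.Injective up := by
    rintro ⟨f, i⟩ ⟨g, j⟩ h
    simp only [up, Prod.mk.injEq] at h
    exact Prod.ext h.1 (Fin.ext h.2)
  have hup : ∀ c : F × ℕ, c.2 < 3 → ∃ d, up d = c := fun c hc => ⟨(c.1, ⟨c.2, hc⟩), rfl⟩
  let bd : F → M.CWalk := fun f => triWalk (vt f) (ed f) (hc f)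
  have hocc : ∀ e z, IsOcc bd e (up z) ↔ ed z.1 z.2 = e := by
    intro e z
    simp [IsOcc, bd, triWalk, up, -Fin.ofNat_eq_cast]
  have hcor : ∀ v z, Multigraph.IsCorner bd v (up z) ↔ vt z.1 z.2 = v := by
    intro e z
    simp [Multigraph.IsCorner, bd, triWalk, up, -Fin.ofNat_eq_cast]
  have hend : ∀ f (i j : Fin 3), (i = j ∨ i = j + 1) → EndOf bd (up (f, i)) (up (f, j)) := by
    intro f i j h
    refine ⟨rfl, ?_⟩
    rcases h with rfl | rfl
    · left; rfl
    · right; simp [up, bd, triWalk, Fin.val_add]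
  have hlink : ∀ v c c', TLink vt ed v c c' → CornerLinked bd v (up c) (up c') := by
    rintro v ⟨f, i⟩ ⟨f', i'⟩ ⟨h1, h2, j, j', hne, hed, h3, h4⟩
    refine ⟨(hcor _ _).2 h1, (hcor _ _).2 h2, ed f j, up (f, j), up (f', j'),
      fun h => hne (upinj h), (hocc _ _).2 rfl, (hocc _ _).2 hed.symm, hend _ _ _ h3, hend _ _ _ h4⟩
  refine ⟨⟨bd, conn, ?_, ?_⟩, ?_⟩
  · intro e
    obtain ⟨x, y, hxy, hz⟩ := h2 e
    have : {p : F × ℕ | IsOcc bd e p} = {up x, up y} := by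
      ext p
      simp only [Set.mem_ofPred_eq, Set.mem_insert_iff, Set.mem_singleton_iff]
      constructor
      · intro hp
        obtain ⟨d, rfl⟩ := hup p hp.1
        rw [hocc, hz] at hp
        exact hp.imp (congrArg up) (congrArg up)
      · rintro (rfl | rfl)
        · rw [hocc, hz]; exact Or.inl rfl
        · rw [hocc, hz]; exact Or.inr rfl
    rw [this]
    exact Set.ncard_pair (fun h => hxy (upinj h))
  · intro v c c' hc hc'
    obtain ⟨d, rfl⟩ := hup c hc.1
    obtain ⟨d', rfl⟩ := hup c' hc'.1
    rw [hcor] at hc hc'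
    have := hl v d d' hc hc'
    clear hc hc'
    induction this with
    | rel a b h => exact .rel _ _ (hlink _ _ _ h)
    | refl a => exact .refl _
    | symm a b _ ih => exact .symm _ _ ih
    | trans a b c _ _ i1 i2 => exact .trans _ _ _ i1 i2
  · have key : ∀ i j : ℕ, i < 3 → j < 3 → Fin.ofNat 3 i = Fin.ofNat 3 j → i = j := by
      intro i j hi hj h
      have := congrArg Fin.val h
      simp only [Fin.ofNat, Nat.mod_eq_of_lt hi, Nat.mod_eq_of_lt hj] at this
      exact this
    intro f
    exact ⟨fun i j hi hj h => key i j hi hj (hv f h), fun i j hi hj h => key i j hi hj (he f h)⟩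

end Tri
end GSF

namespace GSF

open Multigraph

lemma TLink.intro {V E F : Type} {vt : F → Fin 3 → V} {ed : F → Fin 3 → E} {v : V}
    {c c' : F × Fin 3} (s s' : F × Fin 3) (h1 : vt c.1 c.2 = v) (h2 : vt c'.1 c'.2 = v)
    (hne : s ≠ s') (he : ed s.1 s.2 = ed s'.1 s'.2)
    (hc : c.1 = s.1 ∧ (c.2 = s.2 ∨ c.2 = s.2 + 1))
    (hc' : c'.1 = s'.1 ∧ (c'.2 = s'.2 ∨ c'.2 = s'.2 + 1)) : TLink vt ed v c c' := by
  obtain ⟨f, i⟩ := c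
  obtain ⟨f', i'⟩ := c'
  obtain ⟨g, j⟩ := s
  obtain ⟨g', j'⟩ := s'
  obtain ⟨rfl, hc⟩ := hc
  obtain ⟨rfl, hc'⟩ := hc'
  exact ⟨h1, h2, j, j', hne, he, hc, hc'⟩

namespace Sys

variable {V E F O : Type} (S : Sys V E F O)

/-- new vertices -/
abbrev V1 : Type := V ⊕ (F ⊕ {e : E // S.Lp e})
/-- new edges -/
abbrev E1 : Type := ({e : E // ¬ S.Lp e} ⊕ ({e : E // S.Lp e} × Bool)) ⊕
  (O ⊕ {p : O // S.Lp (S.edge p)})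
/-- new faces -/
abbrev F1 : Type := {p : O // ¬ S.Lp (S.edge p)} ⊕ ({p : O // S.Lp (S.edge p)} × Bool)

/-- centre -/
abbrev cen (f : F) : S.V1 := .inr (.inl f)
/-- midpoint -/
abbrev mpt (e : {e : E // S.Lp e}) : S.V1 := .inr (.inr e)
/-- spoke -/
abbrev spoke (p : O) : S.E1 := .inr (.inl p)

/-- endpoints -/
noncomputable def M1 : Multigraph S.V1 S.E1 where
  ends
    | .inl (.inl e) => (S.ends e.1).map Sum.inl
    | .inl (.inr (e, _)) => s(.inl (Quot.out (S.ends e.1)).1, S.mpt e)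
    | .inr (.inl p) => s(S.cen (S.face p), .inl (S.start p))
    | .inr (.inr p) => s(S.mpt ⟨S.edge p.1, p.2⟩, S.cen (S.face p.1))

/-- triangle vertices -/
def vt : S.F1 → Fin 3 → S.V1
  | .inl p => ![S.cen (S.face p.1), .inl (S.start p.1), .inl (S.start (S.next p.1))]
  | .inr (p, b) => ![S.cen (S.face p.1), .inl (S.nu (p.1, b)), S.mpt ⟨S.edge p.1, p.2⟩]

/-- corner side -/
def cor (φ : O × Bool) : O := bif φ.2 then S.next φ.1 else φ.1

/-- triangle edges -/
def ed (δ : O → Bool) : S.F1 → Fin 3 → S.E1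
  | .inl p => ![S.spoke p.1, .inl (.inl ⟨S.edge p.1, p.2⟩), S.spoke (S.next p.1)]
  | .inr (p, b) => ![S.spoke (S.cor (p.1, b)),
      .inl (.inr (⟨S.edge p.1, p.2⟩, xor b (δ p.1))), .inr (.inr p)]

lemma lp_vert (p : O) (h : S.Lp (S.edge p)) (b : Bool) :
    (Quot.out (S.ends (S.edge p))).1 = S.nu (p, b) := by
  have h1 : (Quot.out (S.ends (S.edge p))).1 ∈ S.ends (S.edge p) := Sym2.out_fst_mem _
  rw [lp_iff] at h
  rw [S.ends_edge, Sym2.mem_iff] at h1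
  rw [S.ends_edge, h1.elim id (fun h' => h'.trans h.symm)]
  cases b
  · rfl
  · exact h

lemma compat1 (δ) (f : S.F1) (i : Fin 3) :
    S.M1.ends (S.ed δ f i) = s(S.vt f i, S.vt f (i + 1)) := by
  rcases f with p | ⟨p, b⟩
  · fin_cases i
    · rfl
    · simp [ed, vt, M1, S.ends_edge]
    · simp [ed, vt, M1, S.face_next, Sym2.eq_swap]
  · fin_cases i
    · cases b
      · rfl
      · simp [ed, vt, M1, cor, nu, S.face_next]
    · simp [ed, vt, M1, S.lp_vert p.1 p.2 b]
    · rfl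

lemma vt_inj (f : S.F1) : Function.Injective (S.vt f) := by
  rcases f with p | ⟨p, b⟩
  · have h := p.2
    rw [lp_iff] at h
    intro i j hij
    fin_cases i <;> fin_cases j <;> simp [vt] at hij ⊢
    · exact h hij
    · exact h hij.symm
  · intro i j hij
    fin_cases i <;> fin_cases j <;> simp [vt] at hij ⊢

lemma ed_inj (δ) (f : S.F1) : Function.Injective (S.ed δ f) := by
  rcases f with p | ⟨p, b⟩
  · have h := p.2
    rw [lp_iff] at h
    intro i j hij
    fin_cases i <;> fin_cases j <;> simp [ed] at hij ⊢
    · exact h (congrArg S.start hij)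
    · exact h (congrArg S.start hij).symm
  · intro i j hij
    fin_cases i <;> fin_cases j <;> simp [ed] at hij ⊢

open Classical in
/-- face with corner positions -/
noncomputable def pos (i j k : Fin 3) (φ : O × Bool) : S.F1 × Fin 3 :=
  if h : S.Lp (S.edge φ.1) then (.inr (⟨φ.1, h⟩, φ.2), k)
  else (.inl ⟨φ.1, h⟩, bif φ.2 then j else i)

lemma pos_lp (i j k : Fin 3) (φ : O × Bool) (h : S.Lp (S.edge φ.1)) :
    S.pos i j k φ = (.inr (⟨φ.1, h⟩, φ.2), k) := by simp [pos, h]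

lemma pos_nl (i j k : Fin 3) (φ : O × Bool) (h : ¬ S.Lp (S.edge φ.1)) :
    S.pos i j k φ = (.inl ⟨φ.1, h⟩, bif φ.2 then j else i) := by simp [pos, h]

/-- underlying side of a face -/
def und : S.F1 → O
  | .inl p => p.1
  | .inr p => p.1.1

lemma und_pos (i j k : Fin 3) (φ) : S.und (S.pos i j k φ).1 = φ.1 := by
  by_cases h : S.Lp (S.edge φ.1)
  · rw [pos_lp _ _ _ _ _ h]; rfl
  · rw [pos_nl _ _ _ _ _ h]; rfl

lemma vt_kap (φ) : S.vt (S.pos 1 2 1 φ).1 (S.pos 1 2 1 φ).2 = .inl (S.nu φ) := by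
  by_cases h : S.Lp (S.edge φ.1)
  · rw [pos_lp _ _ _ _ _ h]; rfl
  · rw [pos_nl _ _ _ _ _ h]; obtain ⟨p, b⟩ := φ; cases b <;> rfl

lemma vt_cc (φ) : S.vt (S.pos 0 0 0 φ).1 (S.pos 0 0 0 φ).2 = S.cen (S.face φ.1) := by
  by_cases h : S.Lp (S.edge φ.1)
  · rw [pos_lp _ _ _ _ _ h]; rfl
  · rw [pos_nl _ _ _ _ _ h]; obtain ⟨p, b⟩ := φ; cases b <;> rfl

lemma ed_sp (δ φ) : S.ed δ (S.pos 0 2 0 φ).1 (S.pos 0 2 0 φ).2 = S.spoke (S.cor φ) := by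
  by_cases h : S.Lp (S.edge φ.1)
  · rw [pos_lp _ _ _ _ _ h]; rfl
  · rw [pos_nl _ _ _ _ _ h]; obtain ⟨p, b⟩ := φ; cases b <;> rfl

lemma sp_inj : Function.Injective (S.pos 0 2 0) := by
  rintro ⟨p, b⟩ ⟨q, c⟩ h
  have h1 : p = q := by
    have := congrArg (fun z => S.und z.1) h
    simpa only [und_pos] using this
  subst h1
  by_cases hp : S.Lp (S.edge p)
  · simp only [pos_lp _ _ _ _ (p, b) hp, pos_lp _ _ _ _ (p, c) hp] at h
    simp at h
    rw [h]
  · simp only [pos_nl _ _ _ _ (p, b) hp, pos_nl _ _ _ _ (p, c) hp] at h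
    cases b <;> cases c <;> simp at h ⊢

lemma exists_kap (z : S.F1 × Fin 3) (v : V) (h : S.vt z.1 z.2 = .inl v) :
    ∃ φ, z = S.pos 1 2 1 φ ∧ S.nu φ = v := by
  suffices hh : ∃ φ, z = S.pos 1 2 1 φ by
    obtain ⟨φ, rfl⟩ := hh
    rw [vt_kap] at h
    exact ⟨φ, rfl, Sum.inl_injective h⟩
  obtain ⟨p | ⟨p, b⟩, i⟩ := z
  · fin_cases i
    · simp [vt] at h
    · exact ⟨(p.1, false), by rw [pos_nl _ _ _ _ _ p.2]; rfl⟩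
    · exact ⟨(p.1, true), by rw [pos_nl _ _ _ _ _ p.2]; rfl⟩
  · fin_cases i
    · simp [vt] at h
    · exact ⟨(p.1, b), by rw [pos_lp _ _ _ _ _ p.2]; rfl⟩
    · simp [vt] at h

lemma exists_cc (z : S.F1 × Fin 3) (f : F) (h : S.vt z.1 z.2 = S.cen f) :
    ∃ φ, z = S.pos 0 0 0 φ ∧ S.face φ.1 = f := by
  suffices hh : ∃ φ, z = S.pos 0 0 0 φ by
    obtain ⟨φ, rfl⟩ := hh
    rw [vt_cc] at h
    exact ⟨φ, rfl, Sum.inl_injective (Sum.inr_injective h)⟩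
  obtain ⟨p | ⟨p, b⟩, i⟩ := z
  · fin_cases i
    · exact ⟨(p.1, false), by rw [pos_nl _ _ _ _ _ p.2]; rfl⟩
    · simp [vt] at h
    · simp [vt] at h
  · fin_cases i
    · exact ⟨(p.1, b), by rw [pos_lp _ _ _ _ _ p.2]; rfl⟩
    · simp [vt] at h
    · simp [vt] at h

lemma exists_sp (δ) (z : S.F1 × Fin 3) (p : O) (h : S.ed δ z.1 z.2 = S.spoke p) :
    ∃ φ, z = S.pos 0 2 0 φ ∧ S.cor φ = p := by
  suffices hh : ∃ φ, z = S.pos 0 2 0 φ by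
    obtain ⟨φ, rfl⟩ := hh
    rw [ed_sp] at h
    exact ⟨φ, rfl, Sum.inl_injective (Sum.inr_injective h)⟩
  obtain ⟨p | ⟨p, b⟩, i⟩ := z
  · fin_cases i
    · exact ⟨(p.1, false), by rw [pos_nl _ _ _ _ _ p.2]; rfl⟩
    · simp [ed] at h
    · exact ⟨(p.1, true), by rw [pos_nl _ _ _ _ _ p.2]; rfl⟩
  · fin_cases i
    · exact ⟨(p.1, b), by rw [pos_lp _ _ _ _ _ p.2]; rfl⟩
    · simp [ed] at h
    · simp [ed] at h

lemma two1 (δ) (e : S.E1) : ∃ x y : S.F1 × Fin 3, x ≠ y ∧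
    ∀ z : S.F1 × Fin 3, S.ed δ z.1 z.2 = e ↔ z = x ∨ z = y := by
  rcases e with (⟨e, he⟩ | ⟨⟨e, he⟩, h⟩) | (p | p)
  · obtain ⟨p, rfl⟩ := S.edge_surj e
    refine ⟨(.inl ⟨p, he⟩, 1), (.inl ⟨S.opp p, by rwa [S.edge_opp]⟩, 1), ?_, ?_⟩
    · have := S.opp_ne p
      simp [Ne.symm this]
    · rintro ⟨⟨q, hq⟩ | ⟨⟨q, hq⟩, b⟩, i⟩
      · fin_cases i
        · simp [ed]
        · simp only [ed]
          simp
          constructor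
          · intro h; exact S.edge_eq p q h.symm
          · rintro (rfl | rfl)
            · rfl
            · exact S.edge_opp _
        · simp [ed]
      · fin_cases i <;> simp [ed]
  · obtain ⟨p, rfl⟩ := S.edge_surj e
    refine ⟨(.inr (⟨p, he⟩, xor h (δ p)), 1),
      (.inr (⟨S.opp p, by rwa [S.edge_opp]⟩, xor h (δ (S.opp p))), 1), ?_, ?_⟩
    · have := S.opp_ne p
      simp [Ne.symm this]
    · rintro ⟨⟨q, hq⟩ | ⟨⟨q, hq⟩, b⟩, i⟩
      · fin_cases i <;> simp [ed]
      · fin_cases i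
        · simp [ed]
        · simp only [ed]
          simp
          constructor
          · rintro ⟨h1, rfl⟩
            rcases S.edge_eq p q h1.symm with rfl | rfl
            · left; simp
            · right; simp
          · rintro (⟨rfl, rfl⟩ | ⟨rfl, rfl⟩)
            · simp
            · simp [S.edge_opp]
        · simp [ed]
  · refine ⟨S.pos 0 2 0 (p, false), S.pos 0 2 0 (S.next.symm p, true), ?_, ?_⟩
    · intro h
      simpa using S.sp_inj h
    · intro z
      constructor
      · intro h
        obtain ⟨⟨q, b⟩, rfl, h2⟩ := S.exists_sp δ z p h
        cases b
        · left; rw [← h2]; rfl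
        · right; rw [← h2]; simp [cor]
      · rintro (rfl | rfl)
        · rw [ed_sp]; rfl
        · rw [ed_sp]; simp [cor]
  · refine ⟨(.inr (p, false), 2), (.inr (p, true), 2), by simp, ?_⟩
    rintro ⟨⟨q, hq⟩ | ⟨q, b⟩, i⟩
    · fin_cases i <;> simp [ed]
    · fin_cases i <;> cases b <;> simp [ed]

lemma pos_adj (i j k i' j' k' : Fin 3) (φ) (h1 : i = i' ∨ i = i' + 1) (h2 : j = j' ∨ j = j' + 1)
    (h3 : k = k' ∨ k = k' + 1) :
    (S.pos i j k φ).1 = (S.pos i' j' k' φ).1 ∧ ((S.pos i j k φ).2 = (S.pos i' j' k' φ).2 ∨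
      (S.pos i j k φ).2 = (S.pos i' j' k' φ).2 + 1) := by
  by_cases h : S.Lp (S.edge φ.1)
  · rw [pos_lp _ _ _ _ _ h, pos_lp _ _ _ _ _ h]; exact ⟨rfl, h3⟩
  · rw [pos_nl _ _ _ _ _ h, pos_nl _ _ _ _ _ h]
    obtain ⟨p, b⟩ := φ
    cases b
    · exact ⟨rfl, h1⟩
    · exact ⟨rfl, h2⟩

lemma cor_sg (φ) : S.cor (S.sg φ) = S.cor φ := by
  obtain ⟨p, b⟩ := φ
  cases b <;> simp [cor, sg]

lemma nu_eq (φ) : S.nu φ = S.start (S.cor φ) := by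
  obtain ⟨p, b⟩ := φ
  cases b <;> rfl

lemma ed_hs (δ φ) : S.ed δ (S.pos 1 1 1 φ).1 (S.pos 1 1 1 φ).2 =
    S.ed δ (S.pos 1 1 1 (S.tau δ φ)).1 (S.pos 1 1 1 (S.tau δ φ)).2 := by
  have h0 : S.edge (S.tau δ φ).1 = S.edge φ.1 := S.edge_opp _
  by_cases h : S.Lp (S.edge φ.1)
  · rw [pos_lp _ _ _ _ _ h, pos_lp _ _ _ _ _ (by rwa [h0])]
    simp [ed, h0]
    simp [tau]
  · rw [pos_nl _ _ _ _ _ h, pos_nl _ _ _ _ _ (by rwa [h0])]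
    simp [ed, h0]

lemma link1 (δ) (hv : S.Valid δ) (hC : ∀ φ ψ, S.nu φ = S.nu ψ → S.C δ φ ψ)
    (v : S.V1) (c c' : S.F1 × Fin 3) (h : S.vt c.1 c.2 = v) (h' : S.vt c'.1 c'.2 = v) :
    Relation.EqvGen (TLink S.vt (S.ed δ) v) c c' := by
  have hsp : ∀ φ, S.pos 0 2 0 φ ≠ S.pos 0 2 0 (S.sg φ) := fun φ hh => S.sg_ne φ (S.sp_inj hh).symm
  have hesp : ∀ φ, S.ed δ (S.pos 0 2 0 φ).1 (S.pos 0 2 0 φ).2 =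
      S.ed δ (S.pos 0 2 0 (S.sg φ)).1 (S.pos 0 2 0 (S.sg φ)).2 := by
    intro φ; rw [ed_sp, ed_sp, cor_sg]
  rcases v with v | f | e
  · obtain ⟨φ, rfl, rfl⟩ := S.exists_kap c v h
    obtain ⟨ψ, rfl, hψ⟩ := S.exists_kap c' _ h'
    have hnsg : ∀ φ, S.nu (S.sg φ) = S.nu φ := by
      intro φ; rw [nu_eq, nu_eq, cor_sg]
    have key : ∀ a b, S.C δ a b → S.nu a = S.nu b ∧
        Relation.EqvGen (TLink S.vt (S.ed δ) (.inl (S.nu a))) (S.pos 1 2 1 a) (S.pos 1 2 1 b) := by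
      intro a b hab
      induction hab with
      | rel a b hab =>
        rcases hab with rfl | rfl
        · refine ⟨(hnsg a).symm, .rel _ _ (TLink.intro (S.pos 0 2 0 a) (S.pos 0 2 0 (S.sg a)) (S.vt_kap a)
            ((S.vt_kap _).trans (by rw [hnsg])) (hsp a) (hesp a) ?_ ?_)⟩
          · exact S.pos_adj _ _ _ _ _ _ _ (by decide) (by decide) (by decide)
          · exact S.pos_adj _ _ _ _ _ _ _ (by decide) (by decide) (by decide)
        · refine ⟨(hv a).symm, .rel _ _ (TLink.intro (S.pos 1 1 1 a) (S.pos 1 1 1 (S.tau δ a)) (S.vt_kap a)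
            ((S.vt_kap _).trans (by rw [hv])) ?_ (S.ed_hs δ a) ?_ ?_)⟩
          · intro hh
            have := congrArg (fun z => S.und z.1) hh
            simp only [und_pos] at this
            exact S.opp_ne _ this.symm
          · exact S.pos_adj _ _ _ _ _ _ _ (by decide) (by decide) (by decide)
          · exact S.pos_adj _ _ _ _ _ _ _ (by decide) (by decide) (by decide)
      | refl a => exact ⟨rfl, .refl _⟩
      | symm a b _ ih => exact ⟨ih.1.symm, by rw [← ih.1]; exact .symm _ _ ih.2⟩
      | trans a b c _ _ i1 i2 =>
        exact ⟨i1.1.trans i2.1, .trans _ _ _ i1.2 (by rw [i1.1]; exact i2.2)⟩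
    exact (key φ ψ (hC _ _ hψ.symm)).2
  · obtain ⟨⟨p, b⟩, rfl, rfl⟩ := S.exists_cc c f h
    obtain ⟨⟨q, b'⟩, rfl, hq⟩ := S.exists_cc c' _ h'
    have k1 : ∀ p, Relation.EqvGen (TLink S.vt (S.ed δ) (S.cen (S.face p)))
        (S.pos 0 0 0 (p, false)) (S.pos 0 0 0 (p, true)) := by
      intro p
      by_cases hp : S.Lp (S.edge p)
      · rw [S.pos_lp 0 0 0 (p, false) hp, S.pos_lp 0 0 0 (p, true) hp]
        exact .rel _ _ (TLink.intro (.inr (⟨p, hp⟩, false), 2) (.inr (⟨p, hp⟩, true), 2)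
          rfl rfl (by simp) rfl ⟨rfl, Or.inr rfl⟩ ⟨rfl, Or.inr rfl⟩)
      · rw [S.pos_nl 0 0 0 (p, false) hp, S.pos_nl 0 0 0 (p, true) hp]
        exact .refl _
    have k2 : ∀ p, Relation.EqvGen (TLink S.vt (S.ed δ) (S.cen (S.face p)))
        (S.pos 0 0 0 (p, true)) (S.pos 0 0 0 (S.next p, false)) := by
      intro p
      refine .rel _ _ (TLink.intro (S.pos 0 2 0 (p, true)) (S.pos 0 2 0 (S.next p, false)) (S.vt_cc _)
            ((S.vt_cc _).trans (by rw [S.face_next])) (hsp (p, true)) (hesp (p, true)) ?_ ?_)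
      · exact S.pos_adj _ _ _ _ _ _ _ (by decide) (by decide) (by decide)
      · exact S.pos_adj _ _ _ _ _ _ _ (by decide) (by decide) (by decide)
    have k3 : ∀ p q, Relation.EqvGen (fun a b => b = S.next a) p q → S.face p = S.face q ∧
        Relation.EqvGen (TLink S.vt (S.ed δ) (S.cen (S.face p)))
          (S.pos 0 0 0 (p, false)) (S.pos 0 0 0 (q, false)) := by
      intro p q hpq
      induction hpq with
      | rel a b hab =>
        subst hab
        exact ⟨(S.face_next a).symm, .trans _ _ _ (k1 a) (k2 a)⟩
      | refl a => exact ⟨rfl, .refl _⟩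
      | symm a b _ ih => exact ⟨ih.1.symm, by rw [← ih.1]; exact .symm _ _ ih.2⟩
      | trans a b c _ _ i1 i2 =>
        exact ⟨i1.1.trans i2.1, .trans _ _ _ i1.2 (by rw [i1.1]; exact i2.2)⟩
    have k4 : ∀ p b, Relation.EqvGen (TLink S.vt (S.ed δ) (S.cen (S.face p)))
        (S.pos 0 0 0 (p, false)) (S.pos 0 0 0 (p, b)) := by
      intro p b
      cases b
      · exact .refl _
      · exact k1 p
    simp only at hq
    have k5 := k4 q b'
    rw [hq] at k5
    exact .trans _ _ _ (.symm _ _ (k4 p b))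
      (.trans _ _ _ (k3 p q (S.face_conn _ _ hq.symm)).2 k5)
  · have k0 : ∀ z : S.F1 × Fin 3, S.vt z.1 z.2 = S.mpt e →
        ∃ p b, z = (.inr (p, b), 2) ∧ S.edge p.1 = e.1 := by
      rintro ⟨p | ⟨p, b⟩, i⟩ hz
      · fin_cases i <;> simp [vt] at hz
      · fin_cases i
        · simp [vt] at hz
        · simp [vt] at hz
        · simp [vt] at hz
          exact ⟨p, b, rfl, congrArg Subtype.val hz⟩
    obtain ⟨p, b, rfl, hp⟩ := k0 c h
    obtain ⟨q, b', rfl, hq⟩ := k0 c' h'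
    have k1 : ∀ (p : {p : O // S.Lp (S.edge p)}) b b', S.edge p.1 = e.1 →
        Relation.EqvGen (TLink S.vt (S.ed δ) (S.mpt e)) (.inr (p, b), 2) (.inr (p, b'), 2) := by
      intro p b b' hp
      by_cases hb : b = b'
      · subst hb; exact .refl _
      · have : S.mpt ⟨S.edge p.1, p.2⟩ = S.mpt e := by
          exact congrArg S.mpt (Subtype.ext hp)
        exact .rel _ _ (TLink.intro (.inr (p, b), 2) (.inr (p, b'), 2) this this
          (by simp [hb]) rfl ⟨rfl, Or.inl rfl⟩ ⟨rfl, Or.inl rfl⟩)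
    rcases S.edge_eq p.1 q.1 (hp.trans hq.symm) with h1 | h1
    · obtain rfl : q = p := Subtype.ext h1
      exact k1 _ _ _ hp
    · refine .trans _ _ _ ?_ (k1 q (xor b (xor (δ p.1) (δ q.1))) b' hq)
      have e1 : S.mpt ⟨S.edge p.1, p.2⟩ = S.mpt e := by
        exact congrArg S.mpt (Subtype.ext hp)
      have e2 : S.mpt ⟨S.edge q.1, q.2⟩ = S.mpt e := by
        exact congrArg S.mpt (Subtype.ext hq)
      refine .rel _ _ (TLink.intro (.inr (p, b), 1)
        (.inr (q, (xor b (xor (δ p.1) (δ q.1)))), 1) e1 e2 ?_ ?_ ⟨rfl, Or.inr rfl⟩ ⟨rfl, Or.inr rfl⟩)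
      · intro hh
        have := congrArg (fun z => S.und z.1) hh
        simp only [und] at this
        exact S.opp_ne p.1 (h1.symm.trans this.symm)
      · simp [ed, hp, hq]

lemma adj1 {u v : V} (hne : u ≠ v) {e : E} (he : S.ends e = s(u, v)) :
    S.M1.simple.Adj (.inl u) (.inl v) := by
  refine ⟨fun h => hne (Sum.inl_injective h), ?_⟩
  have hl : ¬ S.Lp e := by rw [Lp, he, Sym2.mk_isDiag_iff]; exact hne
  exact ⟨.inl (.inl ⟨e, hl⟩), by simp [M1, he]⟩

lemma conn1 (M : Multigraph V E) (hM : S.ends = M.ends) (hc : M.simple.Connected) :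
    S.M1.simple.Connected := by
  let f : M.simple →g S.M1.simple := ⟨Sum.inl, by
    rintro u v ⟨hne, e, he⟩
    exact S.adj1 hne (by rw [hM, he])⟩
  obtain ⟨v0⟩ := hc.nonempty
  have hr : ∀ v : V, S.M1.simple.Reachable (.inl v0) (.inl v) := fun v =>
    (hc.preconnected v0 v).map f
  have hr2 : ∀ x : S.V1, S.M1.simple.Reachable (.inl v0) x := by
    rintro (v | g | e)
    · exact hr v
    · obtain ⟨p, rfl⟩ := S.face_surj g
      refine (hr (S.start p)).trans (SimpleGraph.Adj.reachable ?_)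
      exact ⟨by simp, S.spoke p, Sym2.eq_swap⟩
    · refine (hr (Quot.out (S.ends e.1)).1).trans (SimpleGraph.Adj.reachable ?_)
      exact ⟨by simp, .inl (.inr (e, true)), rfl⟩
  have : Nonempty S.V1 := ⟨.inl v0⟩
  exact ⟨fun x y => (hr2 x).symm.trans (hr2 y)⟩

lemma card_fib [Finite O] [Finite E] (P : E → Prop) :
    Nat.card {p : O // P (S.edge p)} = 2 * Nat.card {e : E // P e} := by
  classical
  have := Fintype.ofFinite O
  have := Fintype.ofFinite E
  choose r hr using S.edge_surj
  let g : {e : E // P e} × Bool → {p : O // P (S.edge p)} := fun x =>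
    bif x.2 then ⟨r x.1.1, by rw [hr]; exact x.1.2⟩
    else ⟨S.opp (r x.1.1), by rw [S.edge_opp, hr]; exact x.1.2⟩
  have hg : Function.Bijective g := by
    constructor
    · rintro ⟨⟨e, he⟩, b⟩ ⟨⟨e', he'⟩, b'⟩ h
      have h1 : ∀ x, S.edge (g x).1 = x.1.1 := by
        rintro ⟨⟨e, he⟩, b⟩
        cases b <;> simp [g, S.edge_opp, hr]
      have h2 : e = e' := by
        exact (h1 (⟨e, he⟩, b)).symm.trans ((congrArg (fun z => S.edge z.1) h).trans (h1 (⟨e', he'⟩, b')))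
      subst h2
      have := S.opp_ne (r e)
      cases b <;> cases b' <;> simp [g, this, this.symm] at h ⊢
    · rintro ⟨p, hp⟩
      rcases S.edge_eq (r (S.edge p)) p (hr _) with h | h
      · exact ⟨(⟨S.edge p, hp⟩, true), Subtype.ext h.symm⟩
      · exact ⟨(⟨S.edge p, hp⟩, false), Subtype.ext h.symm⟩
  rw [← Nat.card_congr (Equiv.ofBijective g hg), Nat.card_prod]
  simp [mul_comm]

lemma card1 [Finite V] [Finite E] [Finite F] [Finite O] :
    (Nat.card S.V1 : ℤ) - Nat.card S.E1 + Nat.card S.F1 =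
      (Nat.card V : ℤ) - Nat.card E + Nat.card F := by
  classical
  have h1 := S.card_fib (fun e => S.Lp e)
  have h2 := S.card_fib (fun e => ¬ S.Lp e)
  have h3 : Nat.card E = Nat.card {e : E // S.Lp e} + Nat.card {e : E // ¬ S.Lp e} := by
    rw [← Nat.card_sum]
    exact Nat.card_congr (Equiv.sumCompl S.Lp).symm
  have h4 : Nat.card O = Nat.card {p : O // S.Lp (S.edge p)} +
      Nat.card {p : O // ¬ S.Lp (S.edge p)} := by
    rw [← Nat.card_sum]
    exact Nat.card_congr (Equiv.sumCompl (fun p => S.Lp (S.edge p))).symm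
  have h5 : Nat.card Bool = 2 := by simp
  simp only [V1, E1, F1, Nat.card_sum, Nat.card_prod, h5]
  push_cast
  omega

end Sys

lemma side_finite {V E F : Type} {M : Multigraph V E} [Finite F] (emb : M.Embedding F) :
    Finite (Side emb) := by
  let g : Side emb → Σ f : F, Fin (emb.boundary f).len := fun p => ⟨p.1.1, ⟨p.1.2, p.2⟩⟩
  refine Finite.of_injective g ?_
  rintro ⟨⟨f, i⟩, hi⟩ ⟨⟨f', i'⟩, hi'⟩ h
  simp only [g, Sigma.mk.injEq] at h
  obtain ⟨rfl, h⟩ := h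
  simp at h
  subst h
  rfl

end GSF

/-- For every integer `g ≥ 0`, every graph with Euler genus `g` is a subgraph of a
`(g,3)`-framed multigraph. -/
theorem genus_subgraph_framed (g : ℕ) {V : Type} (G : SimpleGraph V)
    (hG : HasEulerGenusLE G g) :
    ∃ (V' E' F' : Type), Finite V' ∧ Finite E' ∧ Finite F' ∧
      ∃ (M : Multigraph V' E') (emb : M.Embedding F'),
        (∀ f, (emb.boundary f).IsCycle) ∧
        emb.eulerGenus ≤ (g : ℤ) ∧
        G.IsContainedIn (Multigraph.framedGraph emb 3) := by

  obtain ⟨V', E', F', hV, hE, hF, M, emb, hg, φ, hφ⟩ := hG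
  have hO := GSF.side_finite emb
  obtain ⟨S, hS⟩ := GSF.exists_sys emb
  obtain ⟨δ, hv, hC⟩ := S.exists_good
  obtain ⟨emb', hcyc⟩ := GSF.exists_tri S.vt (S.ed δ) (S.compat1 δ) (S.conn1 M hS emb.conn)
    (S.two1 δ) (S.link1 δ hv hC) S.vt_inj (S.ed_inj δ)
  refine ⟨S.V1, S.E1, S.F1, inferInstance, inferInstance, inferInstance, S.M1, emb', hcyc, ?_, ?_⟩
  · unfold Multigraph.Embedding.eulerGenus at hg ⊢
    rw [S.card1]
    exact hg
  · refine ⟨⟨fun v => Sum.inl (φ v), ?_⟩, fun a b h => hφ (Sum.inl_injective h)⟩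
    intro a b hab
    obtain ⟨hne, e, he⟩ := φ.map_rel hab
    obtain ⟨h1, h2⟩ := S.adj1 hne (e := e) (by rw [hS, he])
    exact ⟨h1, Or.inl h2⟩
end
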